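/- Let (R, m) be an analytically unramified Cohen-Macaulay local ring of dimension d ≥ 3, type t(R), infinite residue field. Let I be an ideal with closure(I) = m and J a minimal reduction of I. If ē₃(I) = 0, then λ(closure(I²)/(J·closure(I))) ≤ t(R). -/

import Mathlib

set_option synthInstance.maxHeartbeats 1000000
set_option maxHeartbeats 2000000

open IsLocalRing Polynomial Finset

variable {R : Type*}

/-- `x` is integral over the ideal `I`: it satisfies an equation
`x^n + a₁ x^{n-1} + ⋯ + aₙ = 0` with `aᵢ ∈ Iⁱ`. -/
def IsIntegralOverIdeal [CommRing R] (I : Ideal R) (x : R) : Prop :=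
  ∃ n : ℕ, 0 < n ∧ ∃ a : ℕ → R, (∀ i ∈ Finset.Icc 1 n, a i ∈ I ^ i) ∧
    x ^ n + ∑ i ∈ Finset.Icc 1 n, a i * x ^ (n - i) = 0

/-- The integral closure of an ideal (the set of integral elements is an ideal,
so the span equals it). -/
def intCl [CommRing R] (I : Ideal R) : Ideal R :=
  Ideal.span {x | IsIntegralOverIdeal I x}

/-- Length of a module, as the Krull dimension of its lattice of submodules. -/
noncomputable def mlen (R M : Type*) [CommRing R] [AddCommGroup M] [Module R M] :
    WithBot ℕ∞ :=
  Order.krullDim (Submodule R M)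

/-- The quotient module `N/(K ∩ N)` for ideals `N K`. -/
abbrev idealQuot [CommRing R] (N K : Ideal R) :=
  N ⧸ (Submodule.comap N.subtype K)

/-- Depth of `M` with respect to the ideal `J`: sup of lengths of `M`-regular
sequences contained in `J`. -/
noncomputable def rdepth (A : Type*) [CommRing A] (J : Ideal A)
    (M : Type*) [AddCommGroup M] [Module A M] : ℕ∞ :=
  sSup {n : ℕ∞ | ∃ rs : List A, (rs.length : ℕ∞) = n ∧ (∀ x ∈ rs, x ∈ J) ∧
    RingTheory.Sequence.IsRegular M rs}

/-- A local ring is Cohen-Macaulay if its depth equals its Krull dimension. -/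
def IsCMLocal (R : Type*) [CommRing R] [IsLocalRing R] : Prop :=
  (rdepth R (maximalIdeal R) R : WithBot ℕ∞) = ringKrullDim R

/-- A local ring is analytically unramified if its `m`-adic completion is reduced. -/
def AnalyticallyUnramified (R : Type*) [CommRing R] [IsLocalRing R] : Prop :=
  IsReduced (AdicCompletion (maximalIdeal R) R)

/-- An ideal is `m`-primary. -/
def IsMPrimary [CommRing R] [IsLocalRing R] (I : Ideal R) : Prop :=
  I.radical = maximalIdeal R

/-- `J ⊆ I` is a minimal reduction: generated by `d = dim R` elements and
`I^{n+1} = J I^n` for `n ≫ 0`. -/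
def IsMinimalReduction [CommRing R] (d : ℕ) (J I : Ideal R) : Prop :=
  J ≤ I ∧ (∃ s : Fin d → R, J = Ideal.span (Set.range s)) ∧
    ∃ N : ℕ, ∀ n ≥ N, I ^ (n + 1) = J * I ^ n

/-- Normal Hilbert data: `L n = λ(R/ intCl(I^{n+1}))` and for `n ≫ 0` this agrees
with the polynomial whose normalized coefficients are the `e i`. -/
def NormalHilbertData [CommRing R] (d : ℕ) (I : Ideal R) (L : ℕ → ℕ) (e : ℕ → ℤ) : Prop :=
  (∀ n, mlen R (R ⧸ intCl (I ^ (n + 1))) = (L n : WithBot ℕ∞)) ∧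
    ∃ N : ℕ, ∀ n ≥ N, (L n : ℤ) =
      ∑ i ∈ Finset.range (d + 1), (-1 : ℤ) ^ i * e i * ((n + d - i).choose (d - i))

/-- `t` is the Cohen-Macaulay type of the local ring `R` of dimension `d`:
`t = λ((Q : m)/Q)` for every ideal `Q` generated by a maximal regular sequence in `m`. -/
def CMTypeData (R : Type*) [CommRing R] [IsLocalRing R] (d t : ℕ) : Prop :=
  ∀ s : List R, s.length = d → (∀ x ∈ s, x ∈ maximalIdeal R) →
    RingTheory.Sequence.IsRegular R s →
      mlen R (idealQuot ((Ideal.span {x | x ∈ s}).colon (maximalIdeal R))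
        (Ideal.span {x | x ∈ s})) = (t : WithBot ℕ∞)

/-- The quotient module `N/(K ∩ N)` for submodules `N K` of a module. -/
abbrev submoduleQuot {A M : Type*} [CommRing A] [AddCommGroup M] [Module A M]
    (N K : Submodule A M) :=
  N ⧸ (Submodule.comap N.subtype K)

set_option linter.all false
set_option linter.unusedSectionVars false
set_option linter.style.haveILetI false

namespace LI2
open RingTheory.Sequence
open scoped Pointwise

section SOP
universe u
variable {A : Type u} [CommRing A] [IsLocalRing A] [IsNoetherianRing A]

lemma smul_top_lt (M : Type u) [AddCommGroup M] [Module A M] [Module.Finite A M] [Nontrivial M] :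
    maximalIdeal A • (⊤ : Submodule A M) < ⊤ := by
  refine lt_top_iff_ne_top.mpr fun h => ?_
  have := Submodule.eq_bot_of_le_smul_of_le_jacobson_bot (maximalIdeal A) (⊤ : Submodule A M)
    Module.Finite.fg_top h.ge (maximalIdeal_le_jacobson _)
  exact (bot_ne_top (α := Submodule A M)) this.symm

lemma depth_quot (n : ℕ) (M : Type u) [AddCommGroup M] [Module A M] [Module.Finite A M]
    (rs : List A) (hlen : rs.length = n + 1) (hm : ∀ r ∈ rs, r ∈ maximalIdeal A)
    (hreg : IsRegular M rs) (x : A) (hx : x ∈ maximalIdeal A) (hxr : IsSMulRegular M x) :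
    ∃ rs' : List A, rs'.length = n ∧ (∀ r ∈ rs', r ∈ maximalIdeal A) ∧
      IsRegular (QuotSMulTop x M) rs' := by
  haveI := hreg.nontrivial
  have h := (ModuleCat.exists_isRegular_tfae (maximalIdeal A) (n+1) (ModuleCat.of A M)
    (smul_top_lt M))
  have h1 := (h.out 3 0 rfl rfl).mp ⟨rs, hlen, hm, hreg⟩
  haveI : Nontrivial (QuotSMulTop x M) := nontrivial_quotSMulTop_of_mem_maximalIdeal M hx
  have h' := (ModuleCat.exists_isRegular_tfae (maximalIdeal A) n
    (ModuleCat.of A (QuotSMulTop x M)) (smul_top_lt _))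
  refine (h'.out 3 0 rfl rfl).mpr ?_
  intro N hN hf hs i hi
  have h_ext := h1 N hN hf hs
  have zero1 := AddCommGrpCat.isZero_of_iff_subsingleton.mpr (h_ext i (by omega))
  have zero2 := AddCommGrpCat.isZero_of_iff_subsingleton.mpr (h_ext (i + 1) (by omega))
  exact AddCommGrpCat.subsingleton_of_isZero <|
    CategoryTheory.ShortComplex.Exact.isZero_of_both_zeros
    ((CategoryTheory.Abelian.Ext.covariant_sequence_exact₃' N
      (IsSMulRegular.smulShortComplex_shortExact (M := ModuleCat.of A M) hxr)) i (i + 1) rfl)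
    (zero1.eq_zero_of_src _) (zero2.eq_zero_of_tgt _)

lemma ass_dim (n : ℕ) : ∀ (M : Type u) [AddCommGroup M] [Module A M] [Module.Finite A M]
    (rs : List A) (_ : rs.length = n) (_ : ∀ r ∈ rs, r ∈ maximalIdeal A)
    (_ : IsRegular M rs) (p : Ideal A) (_ : p ∈ associatedPrimes A M),
    (n : WithBot ℕ∞) ≤ ringKrullDim (A ⧸ p) := by
  induction n with
  | zero =>
    intro M _ _ _ rs _ _ _ p hp
    haveI : p.IsPrime := hp.1
    exact_mod_cast ringKrullDim_nonneg_of_nontrivial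
  | succ n ih =>
    intro M _ _ _ rs hlen hm hreg p hp
    haveI hpp : p.IsPrime := hp.1
    match rs, hlen with
    | y :: rs, hlen =>
      simp only [isRegular_cons_iff] at hreg
      simp only [List.mem_cons, forall_eq_or_imp] at hm
      have hyp : y ∉ p := by
        intro hy
        have : y ∈ ⋃ p ∈ associatedPrimes A M, (p : Set A) := Set.mem_biUnion hp hy
        rw [biUnion_associatedPrimes_eq_compl_regular] at this
        exact this hreg.1
      -- the submodule killed by p
      let N : Submodule A M := Submodule.torsionBySet A M (p : Set A)
      have hNne : N ≠ ⊥ := by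
        obtain ⟨_, z, hz⟩ := isAssociatedPrime_iff.mp hp
        intro hb
        have hzN : z ∈ N := by
          rw [Submodule.mem_torsionBySet_iff]
          rintro ⟨a, ha⟩
          have : a ∈ p := ha
          rw [hz, Submodule.mem_colon_singleton, Submodule.mem_bot] at this
          exact this
        rw [hb, Submodule.mem_bot] at hzN
        apply hpp.ne_top
        rw [hz, hzN]
        simp
      have hNn : ¬ N ≤ y • (⊤ : Submodule A M) := by
        intro hle
        apply hNne
        refine Submodule.eq_bot_of_le_smul_of_le_jacobson_bot (Ideal.span {y}) N
          (IsNoetherian.noetherian N) ?_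
          ((Ideal.span_singleton_le_iff_mem _).mpr (maximalIdeal_le_jacobson _ hm.1))
        intro w hw
        obtain ⟨v, -, hv⟩ := Submodule.mem_smul_pointwise_iff_exists _ _ _ |>.mp (hle hw)
        rw [← hv]
        refine Submodule.smul_mem_smul (Ideal.mem_span_singleton_self y) ?_
        rw [Submodule.mem_torsionBySet_iff] at hw ⊢
        rintro ⟨a, ha⟩
        have h1 := hw ⟨a, ha⟩
        rw [← hv] at h1
        simp only at h1 ⊢
        rw [smul_comm] at h1
        exact hreg.1 (by simpa using h1)
      obtain ⟨w, hwN, hw⟩ := Set.not_subset.mp hNn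
      -- associated prime of M/yM containing ann of w
      have hwne : (Submodule.Quotient.mk w : QuotSMulTop y M) ≠ 0 := by
        intro h
        exact hw ((Submodule.Quotient.mk_eq_zero _).mp h)
      obtain ⟨q, hq, hle⟩ := exists_le_isAssociatedPrime_of_isNoetherianRing A _ hwne
      have hpq : p ≤ q := by
        intro a ha
        apply hle
        have : a • w = 0 := (Submodule.mem_torsionBySet_iff _ _).mp hwN ⟨a, ha⟩
        simp [← Submodule.Quotient.mk_smul, this]
      have hyq : y ∈ q := by
        apply hle
        rw [Submodule.mem_colon_singleton, Submodule.mem_bot, ← Submodule.Quotient.mk_smul,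
          Submodule.Quotient.mk_eq_zero]
        exact Submodule.smul_mem_pointwise_smul w y ⊤ trivial
      have h2 := ih (QuotSMulTop y M) rs (by simpa using hlen) hm.2 hreg.2 q hq
      haveI := hq.1
      have h3 : ringKrullDim (A ⧸ q) + 1 ≤ ringKrullDim (A ⧸ p) := by
        refine ringKrullDim_succ_le_of_surjective (r := Ideal.Quotient.mk p y)
          (Ideal.Quotient.factor hpq) (Ideal.Quotient.factor_surjective hpq) ?_ ?_
        · rw [mem_nonZeroDivisors_iff_ne_zero]
          rwa [Ne, Ideal.Quotient.eq_zero_iff_mem]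
        · simpa [Ideal.Quotient.eq_zero_iff_mem] using hyq
      refine le_trans ?_ h3
      push_cast
      gcongr


lemma sop_regular (n : ℕ) : ∀ (M : Type u) [AddCommGroup M] [Module A M] [Module.Finite A M]
    (rs : List A) (_ : rs.length = n) (_ : ∀ r ∈ rs, r ∈ maximalIdeal A)
    (_ : IsRegular M rs) (xs : List A) (_ : xs.length = n) (_ : ∀ r ∈ xs, r ∈ maximalIdeal A)
    (N : ℕ) (_ : maximalIdeal A ^ N ≤ Ideal.ofList xs ⊔ Module.annihilator A M),
    IsRegular M xs := by
  induction n with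
  | zero =>
    intro M _ _ _ rs _ _ hreg xs hxs _ N _
    obtain rfl := List.length_eq_zero_iff.mp hxs
    haveI := hreg.nontrivial
    exact IsRegular.nil A M
  | succ n ih =>
    intro M _ _ _ rs hlen hm hreg xs hxs hxm N hN
    match xs, hxs with
    | x :: xs, hxs =>
      simp only [List.mem_cons, forall_eq_or_imp] at hxm
      have hlen' : xs.length = n := by simpa using hxs
      have hx : IsSMulRegular M x := by
        by_contra hx
        have : x ∈ ⋃ p ∈ associatedPrimes A M, (p : Set A) := by
          rw [biUnion_associatedPrimes_eq_compl_regular]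
          exact hx
        obtain ⟨p, hp, hxp⟩ := Set.mem_iUnion₂.mp this
        have h1 := ass_dim (n+1) M rs hlen hm hreg p hp
        haveI hpp : p.IsPrime := hp.1
        have hann : Module.annihilator A M ≤ p := by
          have := IsAssociatedPrime.annihilator_le hp
          rwa [Submodule.annihilator_top] at this
        have hN' : maximalIdeal A ^ N ≤ Ideal.ofList xs ⊔ p := by
          refine hN.trans ?_
          rw [Ideal.ofList_cons]
          refine sup_le (sup_le ?_ le_sup_left) (hann.trans le_sup_right)
          exact ((Ideal.span_singleton_le_iff_mem _).mpr hxp).trans le_sup_right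
        -- dimension of A/p
        classical
        let B := A ⧸ p
        haveI : IsLocalRing B := IsLocalRing.of_surjective' _ (Ideal.Quotient.mk_surjective (I := p))
        let s : Finset B := (xs.map (Ideal.Quotient.mk p)).toFinset
        have hs : s.card ≤ n := (List.toFinset_card_le _).trans (by simp [hlen'])
        have hmB : maximalIdeal B = (maximalIdeal A).map (Ideal.Quotient.mk p) := by
          refine (IsLocalRing.eq_maximalIdeal ?_).symm
          exact Ideal.map_eq_top_or_isMaximal_of_surjective _ Ideal.Quotient.mk_surjective
            inferInstance |>.resolve_left (fun h => by
              have := Ideal.comap_map_of_surjective' (Ideal.Quotient.mk p)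
                Ideal.Quotient.mk_surjective (maximalIdeal A)
              rw [h, Ideal.comap_top, Ideal.mk_ker, sup_eq_left.mpr (le_maximalIdeal hpp.ne_top)] at this
              exact Ideal.IsPrime.ne_top inferInstance this.symm)
        have hpw : maximalIdeal B ^ N ≤ Ideal.span (s : Set B) := by
          rw [hmB, ← Ideal.map_pow]
          refine (Ideal.map_mono hN').trans ?_
          rw [Ideal.map_sup, Ideal.map_quotient_self, sup_bot_eq, Ideal.ofList, Ideal.map_span]
          refine Ideal.span_mono ?_
          rintro _ ⟨a, ha, rfl⟩
          simp only [s, List.coe_toFinset, List.mem_map, Set.mem_setOf_eq]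
          exact ⟨a, ha, rfl⟩
        have hle : Ideal.span (s : Set B) ≤ maximalIdeal B := by
          rw [Ideal.span_le]
          intro b hb
          simp only [s, List.coe_toFinset, List.mem_map, Set.mem_setOf_eq] at hb
          obtain ⟨a, ha, rfl⟩ := hb
          rw [hmB]
          exact Ideal.mem_map_of_mem _ (hxm.2 a ha)
        have hmin : maximalIdeal B ∈ (Ideal.span (s : Set B)).minimalPrimes := by
          refine ⟨⟨inferInstance, hle⟩, ?_⟩
          rintro q ⟨hq, hq'⟩ -
          exact Ideal.IsPrime.le_of_pow_le (hpw.trans hq')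
        have h2 := Ideal.height_le_card_of_mem_minimalPrimes_span_finset hmin
        have h3 : ringKrullDim B ≤ (n : WithBot ℕ∞) := by
          rw [← IsLocalRing.maximalIdeal_height_eq_ringKrullDim]
          exact_mod_cast h2.trans (by exact_mod_cast hs)
        have h4 := h1.trans h3
        have : n + 1 ≤ n := by exact_mod_cast h4
        omega
      refine IsRegular.cons hx ?_
      obtain ⟨rs', h1, h2, h3⟩ := depth_quot n M rs hlen hm hreg x hxm.1 hx
      refine ih _ rs' h1 h2 h3 xs hlen' hxm.2 N (hN.trans ?_)
      rw [Ideal.ofList_cons]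
      refine sup_le (sup_le ?_ le_sup_left) ?_
      · refine le_trans ?_ le_sup_right
        rw [Ideal.span_singleton_le_iff_mem, Module.mem_annihilator]
        intro v
        obtain ⟨w, rfl⟩ := Submodule.Quotient.mk_surjective _ v
        rw [← Submodule.Quotient.mk_smul, Submodule.Quotient.mk_eq_zero]
        exact Submodule.smul_mem_pointwise_smul w x ⊤ trivial
      · refine le_trans ?_ le_sup_right
        exact LinearMap.annihilator_le_of_surjective (Submodule.mkQ _) (Submodule.mkQ_surjective _)

end SOP
end LI2

namespace LI2
open RingTheory.Sequence
open scoped Pointwise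

section QR
variable [CommRing R]

/-- the ideal generated by a family -/
abbrev gen {σ : Type*} (x : σ → R) : Ideal R := Ideal.span (Set.range x)

lemma wt_one {σ : Type*} (m : σ →₀ ℕ) : Finsupp.weight (1 : σ → ℕ) m = m.degree :=
  (DFunLike.congr_fun (Finsupp.degree_eq_weight_one (R := ℕ)) m).symm

lemma eval_mem_mul_pow {σ : Type*} (x : σ → R) (I : Ideal R) (n : ℕ) (F : MvPolynomial σ R)
    (hF : F.IsHomogeneous n) (hc : ∀ m, F.coeff m ∈ I) : MvPolynomial.eval x F ∈ I * gen x ^ n := by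
  rw [MvPolynomial.eval_eq]
  refine Ideal.sum_mem _ fun m hm => Ideal.mul_mem_mul (hc m) ?_
  have := hF (MvPolynomial.mem_support_iff.mp hm)
  rw [wt_one, Finsupp.degree_apply] at this
  rw [← this, ← Finset.prod_pow_eq_pow_sum]
  exact Ideal.prod_mem_prod fun i _ => Ideal.pow_mem_pow
    (Ideal.subset_span (Set.mem_range_self i) : x i ∈ gen x) _

lemma eval_mem_pow {σ : Type*} (x : σ → R) (n : ℕ) (F : MvPolynomial σ R)
    (hF : F.IsHomogeneous n) : MvPolynomial.eval x F ∈ gen x ^ n := by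
  have := eval_mem_mul_pow x ⊤ n F hF (fun _ => Submodule.mem_top)
  rwa [Ideal.top_mul] at this

lemma mem_mul_pow {σ : Type*} (x : σ → R) (I : Ideal R) (n : ℕ) (y : R) (hy : y ∈ I * gen x ^ n) :
    ∃ F : MvPolynomial σ R, F.IsHomogeneous n ∧ (∀ m, F.coeff m ∈ I) ∧ MvPolynomial.eval x F = y := by
  induction hy using Submodule.mul_induction_on' with
  | mem_mul_mem a ha b hb =>
    obtain ⟨p, hp, rfl⟩ := (Ideal.mem_span_pow_iff_exists_isHomogeneous x b).mp hb
    refine ⟨MvPolynomial.C a * p, by simpa using (MvPolynomial.isHomogeneous_C σ a).mul hp, ?_, by simp⟩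
    intro m
    rw [MvPolynomial.coeff_C_mul]
    exact I.mul_mem_right _ ha
  | add a _ b _ iha ihb =>
    obtain ⟨F, hF, hFc, rfl⟩ := iha
    obtain ⟨G, hG, hGc, rfl⟩ := ihb
    exact ⟨F + G, hF.add hG, fun m => by simpa using I.add_mem (hFc m) (hGc m), by simp⟩

/-- quasi-regular family -/
def QR {σ : Type*} (x : σ → R) : Prop := ∀ n (F : MvPolynomial σ R), F.IsHomogeneous n →
  MvPolynomial.eval x F ∈ gen x ^ (n+1) → ∀ m, F.coeff m ∈ gen x

lemma q0_of_zero {σ : Type*} (x : σ → R) (n : ℕ)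
    (h : ∀ (F : MvPolynomial σ R), F.IsHomogeneous n → MvPolynomial.eval x F = 0 →
      ∀ m, F.coeff m ∈ gen x) (F : MvPolynomial σ R) (hF : F.IsHomogeneous n)
      (hx : MvPolynomial.eval x F ∈ gen x ^ (n+1)) (m : σ →₀ ℕ) : F.coeff m ∈ gen x := by
  rw [pow_succ'] at hx
  obtain ⟨G, hG, hGc, hGe⟩ := mem_mul_pow x _ n _ hx
  have := h (F - G) (hF.sub hG) (by simp [hGe]) m
  rw [MvPolynomial.coeff_sub] at this
  simpa using (gen x).add_mem this (hGc m)

lemma qr_nzd {d : ℕ} (x' : Fin d → R) (hq : QR x') (x0 : R)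
    (h0 : ∀ a, x0 * a ∈ gen x' → a ∈ gen x') (n : ℕ) (a : R) (ha : x0 * a ∈ gen x' ^ n) :
    a ∈ gen x' ^ n := by
  suffices ∀ m ≤ n, a ∈ gen x' ^ m from this n le_rfl
  intro m
  induction m with
  | zero => intro _; simp
  | succ m ih =>
    intro hm
    obtain ⟨G, hG, rfl⟩ := (Ideal.mem_span_pow_iff_exists_isHomogeneous x' a).mp (ih (by omega))
    have h1 : ∀ k, G.coeff k ∈ gen x' := by
      intro k
      apply h0
      have := hq m (MvPolynomial.C x0 * G) (by simpa using (MvPolynomial.isHomogeneous_C _ x0).mul hG)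
        (by simpa using Ideal.pow_le_pow_right hm ha) k
      rwa [MvPolynomial.coeff_C_mul] at this
    rw [pow_succ']
    exact eval_mem_mul_pow x' _ m G hG h1

lemma qr_cons {d : ℕ} (x' : Fin d → R) (hq : QR x') (x0 : R)
    (h0 : ∀ a, x0 * a ∈ gen x' → a ∈ gen x') : QR (Fin.cons x0 x' : Fin (d+1) → R) := by
  set x : Fin (d+1) → R := Fin.cons x0 x' with hx
  have hle : gen x' ≤ gen x := by
    refine Ideal.span_mono ?_
    rintro _ ⟨i, rfl⟩
    exact ⟨i.succ, by simp [hx]⟩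
  have hx0 : x0 ∈ gen x := Ideal.subset_span ⟨0, by simp [hx]⟩
  intro n
  induction n with
  | zero =>
    apply q0_of_zero
    intro F hF he m
    rw [← MvPolynomial.totalDegree_zero_iff_isHomogeneous, MvPolynomial.totalDegree_eq_zero_iff_eq_C] at hF
    rw [hF] at he ⊢
    simp only [MvPolynomial.eval_C] at he
    simp [he]
  | succ n ih =>
    apply q0_of_zero
    intro F hF he m
    let p := MvPolynomial.finSuccEquiv R d F
    let G := p.coeff 0
    let H := (MvPolynomial.finSuccEquiv R d).symm p.divX
    have hGc : ∀ m, G.coeff m = F.coeff (Finsupp.cons 0 m) := fun m =>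
      MvPolynomial.finSuccEquiv_coeff_coeff m F 0
    have hHc : ∀ i m, H.coeff (Finsupp.cons i m) = F.coeff (Finsupp.cons (i+1) m) := fun i m => by
      rw [← MvPolynomial.finSuccEquiv_coeff_coeff, ← MvPolynomial.finSuccEquiv_coeff_coeff]
      simp [H, p, Polynomial.coeff_divX]
    have hdeg : ∀ (i : ℕ) (m : Fin d →₀ ℕ), Finsupp.weight (1 : Fin (d+1) → ℕ) (Finsupp.cons i m)
        = i + Finsupp.weight (1 : Fin d → ℕ) m := by
      intro i m
      simp [wt_one, Finsupp.degree_eq_sum, Fin.sum_univ_succ]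
    have hG : G.IsHomogeneous (n+1) := by
      intro m hm
      rw [hGc] at hm
      have := hF hm
      rw [hdeg] at this
      simpa using this
    have hH : H.IsHomogeneous n := by
      intro m hm
      rw [← Finsupp.cons_tail m] at hm ⊢
      rw [hHc] at hm
      have := hF hm
      rw [hdeg] at this ⊢
      omega
    have heq : MvPolynomial.eval x F = x0 * MvPolynomial.eval x H + MvPolynomial.eval x' G := by
      rw [hx, MvPolynomial.eval_eq_eval_mv_eval', MvPolynomial.eval_eq_eval_mv_eval']
      conv_lhs => rw [← Polynomial.divX_mul_X_add (MvPolynomial.finSuccEquiv R d F)]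
      simp only [H, G, p, AlgEquiv.apply_symm_apply, Polynomial.map_add, Polynomial.map_mul,
        Polynomial.map_X, Polynomial.map_C, Polynomial.eval_add, Polynomial.eval_mul,
        Polynomial.eval_X, Polynomial.eval_C]
      ring
    have hxH : MvPolynomial.eval x H ∈ gen x' ^ (n+1) := by
      apply qr_nzd x' hq x0 h0
      rw [he] at heq
      rw [eq_neg_of_add_eq_zero_left heq.symm]
      exact neg_mem (eval_mem_pow x' _ G hG)
    obtain ⟨h, hh, hhe⟩ := (Ideal.mem_span_pow_iff_exists_isHomogeneous x' _).mp hxH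
    have h1 : ∀ m, H.coeff m ∈ gen x := ih H hH (Ideal.pow_right_mono hle _ hxH)
    have h2 : ∀ m, G.coeff m ∈ gen x := by
      intro m
      have := hq (n+1) (G + MvPolynomial.C x0 * h)
        (hG.add (by simpa using (MvPolynomial.isHomogeneous_C _ x0).mul hh)) (by
          rw [map_add, map_mul, MvPolynomial.eval_C, hhe, add_comm (MvPolynomial.eval x' G), ← heq, he]
          exact zero_mem _) m
      rw [MvPolynomial.coeff_add, MvPolynomial.coeff_C_mul] at this
      have h3 := (gen x).sub_mem (hle this) ((gen x).mul_mem_right (h.coeff m) hx0)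
      simpa using h3
    rw [← Finsupp.cons_tail m]
    rcases h : m 0 with _ | i
    · rw [← hGc]; exact h2 _
    · rw [← hHc]; exact h1 _

lemma qr_of_weaklyRegular : ∀ {d : ℕ} (x : Fin d → R), IsWeaklyRegular R (List.ofFn x).reverse → QR x := by
  intro d
  induction d with
  | zero =>
    intro x _ n F hF he m
    have h0 : gen x = ⊥ := by simp [gen]
    rw [h0] at he ⊢
    have h1 : F = MvPolynomial.C (MvPolynomial.coeff 0 F) := MvPolynomial.eq_C_of_isEmpty F
    have h2 : MvPolynomial.coeff 0 F = 0 := by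
      rw [h1] at he
      simpa using he
    rw [h1, h2]
    simp
  | succ d ih =>
    intro x hx
    rw [← Fin.cons_self_tail x]
    rw [List.ofFn_succ, List.reverse_cons, isWeaklyRegular_append_iff, isWeaklyRegular_singleton_iff] at hx
    refine qr_cons _ (ih (Fin.tail x) hx.1) _ ?_
    intro a ha
    have h1 := hx.2
    have : Ideal.ofList (List.ofFn fun i : Fin d => x i.succ).reverse • (⊤ : Submodule R R) = gen (Fin.tail x) := by
      simp only [Ideal.ofList, List.mem_reverse, List.mem_ofFn', smul_eq_mul, Ideal.mul_top]
      rfl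
    have h2 := mem_of_isSMulRegular_quotient_of_smul_mem h1 (x := a) (by rw [this]; exact ha)
    rwa [this] at h2

lemma qr_of_regular [IsLocalRing R] [IsNoetherianRing R] {d : ℕ} (x : Fin d → R)
    (h : IsRegular R (List.ofFn x)) : QR x := by
  apply qr_of_weaklyRegular
  exact (IsLocalRing.isRegular_of_perm h (List.reverse_perm _).symm).toIsWeaklyRegular

end QR
end LI2

namespace LI2
open RingTheory.Sequence
open scoped Pointwise

section Q1
variable [CommRing R]

lemma nzd_of_unit_coeff {d : ℕ} : ∀ (w : MvPolynomial (Fin d) R) (m : Fin d →₀ ℕ)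
    (_ : IsUnit (w.coeff m)) (g : MvPolynomial (Fin d) R) (_ : w * g = 0), g = 0 := by
  induction d with
  | zero =>
    intro w m hm g hg
    obtain rfl : m = 0 := Subsingleton.elim _ _
    have h1 := MvPolynomial.eq_C_of_isEmpty w
    rw [h1] at hg
    have := (hm.map (MvPolynomial.C (σ := Fin 0) (R := R))).mul_right_eq_zero.mp hg
    exact this
  | succ d ih =>
    intro w m hm g hg
    have h1 : MvPolynomial.finSuccEquiv R d w ∈ nonZeroDivisors (Polynomial (MvPolynomial (Fin d) R)) := by
      rw [Polynomial.mem_nonZeroDivisors_iff]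
      intro a ha
      have h2 : MvPolynomial.coeff (Finsupp.tail m) ((MvPolynomial.finSuccEquiv R d w).coeff (m 0)) = w.coeff m := by
        rw [MvPolynomial.finSuccEquiv_coeff_coeff, Finsupp.cons_tail]
      refine ih _ (Finsupp.tail m) (by rw [h2]; exact hm) a ?_
      have := congrArg (fun p => p.coeff (m 0)) ha
      simpa [mul_comm] using this
    have h3 : MvPolynomial.finSuccEquiv R d g = 0 := by
      refine (mem_nonZeroDivisors_iff.mp h1).1 _ ?_
      rw [← map_mul, hg, map_zero]
    simpa using h3

/-- content lemma -/
lemma mc {d : ℕ} (q : Ideal R) (w φ : MvPolynomial (Fin d) R) (m : Fin d →₀ ℕ)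
    (hm : IsUnit (w.coeff m)) (h : ∀ k, (w * φ).coeff k ∈ q) : ∀ k, φ.coeff k ∈ q := by
  have h1 : MvPolynomial.map (Ideal.Quotient.mk q) φ = 0 := by
    refine nzd_of_unit_coeff (MvPolynomial.map (Ideal.Quotient.mk q) w) m ?_ _ ?_
    · rw [MvPolynomial.coeff_map]; exact hm.map _
    · rw [← map_mul]
      ext k
      rw [MvPolynomial.coeff_map, MvPolynomial.coeff_zero]
      exact Ideal.Quotient.eq_zero_iff_mem.mpr (h k)
  intro k
  have := congrArg (MvPolynomial.coeff k) h1
  rw [MvPolynomial.coeff_map, MvPolynomial.coeff_zero] at this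
  exact Ideal.Quotient.eq_zero_iff_mem.mp this

lemma q1 {d : ℕ} (x : Fin d → R) (hq : QR x) (e : ℕ) (Ω : MvPolynomial (Fin d) R) (hΩ : Ω.IsHomogeneous e)
    (m : Fin d →₀ ℕ) (hm : IsUnit (Ω.coeff m)) (n : ℕ) (y : R)
    (hy : MvPolynomial.eval x Ω * y ∈ gen x ^ (n + e)) : y ∈ gen x ^ n := by
  suffices ∀ j ≤ n, y ∈ gen x ^ j from this n le_rfl
  intro j
  induction j with
  | zero => intro _; simp
  | succ j ih =>
    intro hj
    obtain ⟨G, hG, rfl⟩ := (Ideal.mem_span_pow_iff_exists_isHomogeneous x y).mp (ih (by omega))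
    have h1 : ∀ k, G.coeff k ∈ gen x := by
      refine mc (gen x) Ω G m hm ?_
      refine hq (e + j) _ (hΩ.mul hG) ?_
      rw [map_mul]
      exact Ideal.pow_le_pow_right (by omega) hy
    rw [pow_succ']
    exact eval_mem_mul_pow x _ j G hG h1

lemma q1_var {d : ℕ} (x : Fin d → R) (hq : QR x) (i : Fin d) (e n : ℕ) (y : R)
    (hy : x i ^ e * y ∈ gen x ^ (n + e)) : y ∈ gen x ^ n := by
  refine q1 x hq e (MvPolynomial.X i ^ e) ?_ (Finsupp.single i e) ?_ n y ?_
  · simpa using (MvPolynomial.isHomogeneous_X R i).pow e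
  · rw [MvPolynomial.X_pow_eq_monomial, MvPolynomial.coeff_monomial, if_pos rfl]; exact isUnit_one
  · simpa using hy

lemma x_mem {σ : Type*} (x : σ → R) (i : σ) : x i ∈ gen x := Ideal.subset_span ⟨i, rfl⟩

/-- variant of the previous lemma -/
lemma q1' {d : ℕ} (x : Fin d → R) (hq : QR x) (i j : Fin d) (hij : i ≠ j) (e m n : ℕ) (y : R)
    (hy : ∃ u, x j ^ e * y - x i ^ m * u ∈ gen x ^ (n + e)) : ∃ v, y - x i ^ m * v ∈ gen x ^ n := by
  suffices ∀ k ≤ n, ∃ v, y - x i ^ m * v ∈ gen x ^ k from this n le_rfl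
  intro k
  induction k with
  | zero => intro _; exact ⟨0, by simp⟩
  | succ k ih =>
    intro hk
    obtain ⟨v, hv⟩ := ih (by omega)
    obtain ⟨u, hu⟩ := hy
    obtain ⟨G, hG, hGe⟩ := (Ideal.mem_span_pow_iff_exists_isHomogeneous x _).mp hv
    -- x_j^e G(x) - x_i^m u' ∈ J^(n+e)
    set u' := u - x j ^ e * v with hu'
    have h1 : x j ^ e * MvPolynomial.eval x G - x i ^ m * u' ∈ gen x ^ (n + e) := by
      rw [hGe, hu']; convert hu using 1; ring
    have hGk : MvPolynomial.eval x G ∈ gen x ^ k := eval_mem_pow x k G hG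
    have h2 : x i ^ m * u' ∈ gen x ^ (k + e) := by
      have h3 := Ideal.sub_mem (I := gen x ^ (k+e)) (a := x j ^ e * MvPolynomial.eval x G) (b := x j ^ e * MvPolynomial.eval x G - x i ^ m * u') ?_ ?_
      · simpa using h3
      · rw [add_comm, pow_add]; exact Ideal.mul_mem_mul (Ideal.pow_mem_pow (x_mem x j) e) hGk
      · exact Ideal.pow_le_pow_right (by omega) h1
    by_cases hm : m ≤ k + e
    · obtain ⟨l, hl⟩ := Nat.exists_eq_add_of_le hm
      have h3 : u' ∈ gen x ^ l := q1_var x hq i m l u' (by rw [add_comm l m, ← hl]; exact h2)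
      obtain ⟨U, hU, hUe⟩ := (Ideal.mem_span_pow_iff_exists_isHomogeneous x _).mp h3
      have h4 : ∀ t, (MvPolynomial.X j ^ e * G - MvPolynomial.X i ^ m * U).coeff t ∈ gen x := by
        refine hq (k + e) _ ?_ ?_
        · have a1 : (MvPolynomial.X j ^ e * G).IsHomogeneous (k + e) := by
            have := ((MvPolynomial.isHomogeneous_X R j).pow e).mul hG
            rwa [one_mul, add_comm] at this
          have a2 : (MvPolynomial.X i ^ m * U).IsHomogeneous (k + e) := by
            have := ((MvPolynomial.isHomogeneous_X R i).pow m).mul hU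
            rwa [one_mul, ← hl] at this
          exact a1.sub a2
        · simp only [map_sub, map_mul, map_pow, MvPolynomial.eval_X, hUe]
          exact Ideal.pow_le_pow_right (by omega) h1
      -- split G into monomials divisible by X_i^m and the others
      have h5 : ∀ t : Fin d →₀ ℕ, t i < m → G.coeff t ∈ gen x := by
        intro t ht
        have := h4 (Finsupp.single j e + t)
        rw [MvPolynomial.coeff_sub, MvPolynomial.X_pow_eq_monomial, MvPolynomial.X_pow_eq_monomial,
          MvPolynomial.coeff_monomial_mul, MvPolynomial.coeff_monomial_mul', if_neg, one_mul, sub_zero] at this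
        · exact this
        · intro hle
          have := hle i
          simp [Finsupp.single_apply, hij.symm] at this
          omega
      have h6 : ∃ v', MvPolynomial.eval x G - x i ^ m * v' ∈ gen x ^ (k+1) := by
        rw [MvPolynomial.eval_eq]
        have : ∀ t ∈ G.support, ∃ v', G.coeff t * ∏ i ∈ t.support, x i ^ t i - x i ^ m * v' ∈ gen x ^ (k+1) := by
          intro t ht
          by_cases hti : t i < m
          · refine ⟨0, ?_⟩
            rw [mul_zero, sub_zero, pow_succ']
            refine Ideal.mul_mem_mul (h5 t hti) ?_
            have hdeg := hG (MvPolynomial.mem_support_iff.mp ht)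
            rw [wt_one, Finsupp.degree_apply] at hdeg
            rw [← hdeg, ← Finset.prod_pow_eq_pow_sum]
            exact Ideal.prod_mem_prod fun i _ => Ideal.pow_mem_pow (x_mem x i) _
          · push Not at hti
            by_cases hm0 : m = 0
            · exact ⟨G.coeff t * ∏ i ∈ t.support, x i ^ t i, by simp [hm0]⟩
            have hi : i ∈ t.support := by simp; omega
            refine ⟨G.coeff t * (x i ^ (t i - m) * ∏ l ∈ t.support.erase i, x l ^ t l), ?_⟩
            have : G.coeff t * ∏ i ∈ t.support, x i ^ t i = x i ^ m * (G.coeff t * (x i ^ (t i - m) * ∏ l ∈ t.support.erase i, x l ^ t l)) := by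
              rw [← Finset.mul_prod_erase _ _ hi]
              have : x i ^ t i = x i ^ m * x i ^ (t i - m) := by rw [← pow_add]; congr 1; omega
              rw [this]; ring
            rw [this, sub_self]; exact zero_mem _
        choose! v' hv' using this
        refine ⟨∑ t ∈ G.support, v' t, ?_⟩
        rw [Finset.mul_sum, ← Finset.sum_sub_distrib]
        exact Ideal.sum_mem _ hv'
      obtain ⟨v', hv'⟩ := h6
      refine ⟨v + v', ?_⟩
      rw [hGe] at hv'
      convert hv' using 1; ring
    · -- m > k + e : then x_i^m u' ∈ J^(k+e+1), so x_j^e G(x) ∈ J^(k+e+1)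
      refine ⟨v, ?_⟩
      rw [← hGe]
      refine q1_var x hq j e (k+1) _ ?_
      have h3 := (gen x ^ (k + 1 + e)).add_mem (Ideal.pow_le_pow_right (by omega) h1)
        (show x i ^ m * u' ∈ gen x ^ (k + 1 + e) from
          (gen x ^ (k + 1 + e)).mul_mem_right _ (Ideal.pow_le_pow_right (by omega) (Ideal.pow_mem_pow (x_mem x i) m)))
      simpa using h3

end Q1
end LI2

namespace LI2
open scoped Pointwise

section Fr
variable [CommRing R]

/-- real-indexed integral closure filtration of the ideal `J`. -/
def Fr (J : Ideal R) (r : ℝ) : Ideal R where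
  carrier := {y | ∃ c : ℝ, ∀ s : ℕ, y ^ s ∈ J ^ ⌊r * s - c⌋₊}
  zero_mem' := by
    refine ⟨0, fun s => ?_⟩
    rcases s with _ | s
    · simp
    · simp
  add_mem' := by
    rintro y z ⟨c, hc⟩ ⟨c', hc'⟩
    refine ⟨c + c' + 2, fun s => ?_⟩
    rw [add_pow]
    refine Ideal.sum_mem _ fun a ha => Ideal.mul_mem_right _ _ ?_
    have has : a ≤ s := by simpa [Nat.lt_succ_iff] using ha
    refine Ideal.pow_le_pow_right ?_ (by rw [pow_add]; exact Ideal.mul_mem_mul (hc a) (hc' (s - a)))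
    have h1 := Nat.lt_floor_add_one (r * a - c)
    have h2 := Nat.lt_floor_add_one (r * ((s - a : ℕ) : ℝ) - c')
    rw [Nat.cast_sub has] at h2
    apply Nat.floor_le_of_le
    push_cast [Nat.cast_sub has]
    nlinarith
  smul_mem' := by
    rintro a y ⟨c, hc⟩
    exact ⟨c, fun s => by rw [smul_eq_mul, mul_pow]; exact Ideal.mul_mem_left _ _ (hc s)⟩

variable {J : Ideal R}

lemma mem_Fr {r : ℝ} {y : R} : y ∈ Fr J r ↔ ∃ c : ℝ, ∀ s : ℕ, y ^ s ∈ J ^ ⌊r * s - c⌋₊ := Iff.rfl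

lemma Fr_anti {r r' : ℝ} (h : r ≤ r') : Fr J r' ≤ Fr J r := by
  rintro y ⟨c, hc⟩
  refine ⟨c, fun s => Ideal.pow_le_pow_right (Nat.floor_mono ?_) (hc s)⟩
  have : (0:ℝ) ≤ s := by positivity
  nlinarith

lemma Fr_mul {r r' : ℝ} {y z : R} (hy : y ∈ Fr J r) (hz : z ∈ Fr J r') : y * z ∈ Fr J (r + r') := by
  obtain ⟨c, hc⟩ := hy
  obtain ⟨c', hc'⟩ := hz
  refine ⟨c + c' + 2, fun s => ?_⟩
  rw [mul_pow]
  refine Ideal.pow_le_pow_right ?_ (by rw [pow_add]; exact Ideal.mul_mem_mul (hc s) (hc' s))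
  have h1 := Nat.lt_floor_add_one (r * s - c)
  have h2 := Nat.lt_floor_add_one (r' * s - c')
  apply Nat.floor_le_of_le
  push_cast
  nlinarith

lemma Fr_mul_le (r r' : ℝ) : Fr J r * Fr J r' ≤ Fr J (r + r') :=
  Ideal.mul_le.mpr fun _ hy _ hz => Fr_mul hy hz

lemma pow_le_Fr (n : ℕ) : J ^ n ≤ Fr J n := by
  intro y hy
  refine ⟨0, fun s => ?_⟩
  have : ⌊(n:ℝ) * s - 0⌋₊ = n * s := by
    rw [sub_zero]; exact_mod_cast Nat.floor_natCast (n * s)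
  rw [this, pow_mul]
  exact Ideal.pow_mem_pow hy s

lemma le_Fr_one : J ≤ Fr J 1 := by simpa using pow_le_Fr (J := J) 1

lemma Fr_nonpos {r : ℝ} (h : r ≤ 0) : Fr J r = ⊤ := by
  rw [Ideal.eq_top_iff_one]
  refine ⟨0, fun s => ?_⟩
  have : ⌊r * s - 0⌋₊ = 0 := Nat.floor_of_nonpos (by
    have : (0:ℝ) ≤ s := by positivity
    nlinarith)
  rw [this]; simp

lemma Fr_pow {r : ℝ} {y : R} (hy : y ∈ Fr J r) (t : ℕ) : y ^ t ∈ Fr J (t * r) := by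
  obtain ⟨c, hc⟩ := hy
  refine ⟨c, fun s => ?_⟩
  have := hc (t * s)
  rw [pow_mul] at this
  convert this using 3
  push_cast; ring

/-- criterion with an additive constant -/
lemma mem_Fr_of_lb {r : ℝ} {y : R} (c : ℝ) (h : ∀ s n : ℕ, (n : ℝ) + c ≤ r * s → y ^ s ∈ J ^ n) : y ∈ Fr J r := by
  refine ⟨c, fun s => ?_⟩
  by_cases h0 : 0 ≤ r * s - c
  · exact h s _ (by have := Nat.floor_le h0; linarith)
  · rw [Nat.floor_of_nonpos (by linarith)]; simp

lemma mem_pow_of_mem_Fr {r : ℝ} {y : R} (h : y ∈ Fr J r) :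
    ∃ c : ℝ, 0 ≤ c ∧ ∀ s n : ℕ, (n : ℝ) + c ≤ r * s → y ^ s ∈ J ^ n := by
  obtain ⟨c, hc⟩ := h
  refine ⟨|c|, abs_nonneg c, fun s n hn => Ideal.pow_le_pow_right (Nat.le_floor ?_) (hc s)⟩
  have := le_abs_self c
  linarith

lemma q1_pow {d : ℕ} (x : Fin d → R) (hq : QR x) (e : ℕ) (Ω : MvPolynomial (Fin d) R) (hΩ : Ω.IsHomogeneous e)
    (m : Fin d →₀ ℕ) (hm : IsUnit (Ω.coeff m)) (s n : ℕ) (y : R)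
    (hy : MvPolynomial.eval x Ω ^ s * y ∈ gen x ^ (n + e * s)) : y ∈ gen x ^ n := by
  induction s generalizing n y with
  | zero => simpa using hy
  | succ s ih =>
    apply ih
    apply q1 x hq e Ω hΩ m hm
    have : n + e * s + e = n + e * (s+1) := by ring
    rw [this, ← mul_assoc, ← pow_succ']; exact hy

lemma Fr_colon {d : ℕ} (x : Fin d → R) (hq : QR x) (e : ℕ) (Ω : MvPolynomial (Fin d) R) (hΩ : Ω.IsHomogeneous e)
    (m : Fin d →₀ ℕ) (hm : IsUnit (Ω.coeff m)) (r : ℝ) (y : R)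
    (hy : MvPolynomial.eval x Ω * y ∈ Fr (gen x) (r + e)) : y ∈ Fr (gen x) r := by
  obtain ⟨c, _, hc⟩ := mem_pow_of_mem_Fr hy
  refine mem_Fr_of_lb c fun s n hn => ?_
  apply q1_pow x hq e Ω hΩ m hm s
  rw [← mul_pow]
  apply hc
  push_cast
  linarith

lemma Fr_colon_var {d : ℕ} (x : Fin d → R) (hq : QR x) (i : Fin d) (e : ℕ) (r : ℝ) (y : R)
    (hy : x i ^ e * y ∈ Fr (gen x) (r + e)) : y ∈ Fr (gen x) r := by
  refine Fr_colon x hq e (MvPolynomial.X i ^ e) ?_ (Finsupp.single i e) ?_ r y ?_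
  · simpa using (MvPolynomial.isHomogeneous_X R i).pow e
  · rw [MvPolynomial.X_pow_eq_monomial, MvPolynomial.coeff_monomial, if_pos rfl]; exact isUnit_one
  · simpa using hy

/-- Functoriality -/
lemma Fr_map {S : Type*} [CommRing S] (f : R →+* S) (r : ℝ) {y : R} (hy : y ∈ Fr J r) :
    f y ∈ Fr (J.map f) r := by
  obtain ⟨c, hc⟩ := hy
  refine ⟨c, fun s => ?_⟩
  rw [← map_pow, ← Ideal.map_pow]
  exact Ideal.mem_map_of_mem f (hc s)

lemma gen_map {σ : Type*} {S : Type*} [CommRing S] (f : R →+* S) (x : σ → R) :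
    (gen x).map f = gen (f ∘ x) := by
  rw [gen, Ideal.map_span, gen, ← Set.range_comp]

/-! comparison with `intCl` -/

lemma intCl_le_Fr {I : Ideal R} (hJI : J ≤ I) (N : ℕ) (hN : ∀ n ≥ N, I ^ (n+1) = J * I ^ n) (n : ℕ) :
    intCl (I ^ n) ≤ Fr J n := by
  have hNt : ∀ t, I ^ (N + t) ≤ J ^ t := by
    intro t
    induction t with
    | zero => simp
    | succ t ih =>
      rw [← add_assoc, hN _ (by omega), pow_succ']
      exact Ideal.mul_mono le_rfl ih
  refine Ideal.span_le.mpr ?_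
  rintro y ⟨m, hm, a, ha, he⟩
  have key : ∀ s, y ^ s ∈ (I ^ n) ^ (s + 1 - m) := by
    intro s
    induction s using Nat.strong_induction_on with
    | _ s ih =>
      by_cases hs : s < m
      · rw [show s + 1 - m = 0 by omega]; simp
      push Not at hs
      have h1 : y ^ s = y ^ (s - m) * y ^ m := by rw [← pow_add]; congr 1; omega
      rw [h1, eq_neg_of_add_eq_zero_left he, mul_neg, Finset.mul_sum]
      refine neg_mem (Ideal.sum_mem _ fun i hi => ?_)
      have hi' := Finset.mem_Icc.mp hi
      have h2 := ih (s - i) (by omega)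
      have h3 : y ^ (s - m) * (a i * y ^ (m - i)) = a i * y ^ (s - i) := by
        rw [show s - i = (s - m) + (m - i) by omega, pow_add]; ring
      rw [h3]
      refine Ideal.pow_le_pow_right ?_ (by rw [pow_add]; exact Ideal.mul_mem_mul (ha i hi) h2)
      omega
  refine mem_Fr_of_lb (n * m + N) fun s k hk => ?_
  have h1 := key s
  rw [← pow_mul] at h1
  have h2 : N + k ≤ n * (s + 1 - m) := by
    have h3 : k + (n * m + N) ≤ n * s := by exact_mod_cast hk
    have h4 : n * s ≤ n * (s + 1 - m) + n * m := by
      rw [← mul_add]; exact Nat.mul_le_mul_left _ (by omega)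
    omega
  exact hNt k (Ideal.pow_le_pow_right h2 h1)

lemma sup_span_pow (L : Ideal R) (y : R) (s : ℕ) (z : R) (hz : z ∈ (L ⊔ Ideal.span {y}) ^ s) :
    ∃ a : ℕ → R, (∀ i, a i ∈ L ^ i) ∧ z = ∑ i ∈ range (s+1), a i * y ^ (s - i) := by
  induction s generalizing z with
  | zero => exact ⟨fun i => if i = 0 then z else 0, fun i => by by_cases h : i = 0 <;> simp [h], by simp⟩
  | succ s ih =>
    rw [pow_succ'] at hz
    induction hz using Submodule.mul_induction_on' with
    | mem_mul_mem u hu v hv =>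
      obtain ⟨a, ha, rfl⟩ := ih v hv
      obtain ⟨l, hl, w, hw, rfl⟩ := Submodule.mem_sup.mp hu
      obtain ⟨b, rfl⟩ := Ideal.mem_span_singleton'.mp hw
      refine ⟨fun i => (if i = 0 then 0 else l * a (i-1)) + (if i = s+1 then 0 else b * a i), ?_, ?_⟩
      · intro i
        refine add_mem ?_ ?_
        · rcases i with _ | i
          · simp
          · simp only [Nat.add_eq_zero_iff, one_ne_zero, and_false, if_false, Nat.add_sub_cancel]
            rw [pow_succ']; exact Ideal.mul_mem_mul hl (ha i)
        · split_ifs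
          · exact zero_mem _
          · exact Ideal.mul_mem_left _ _ (ha i)
      · simp only [add_mul, Finset.sum_add_distrib]
        congr 1
        · rw [Finset.sum_range_succ' _ (s+1)]
          simp only [Nat.add_eq_zero_iff, one_ne_zero, and_false, if_false, Nat.add_sub_cancel, if_true, zero_mul, add_zero, Nat.add_sub_add_right]
          rw [Finset.mul_sum]
          exact Finset.sum_congr rfl fun i _ => by ring
        · rw [Finset.sum_range_succ _ (s+1)]
          simp only [if_true, zero_mul, add_zero]
          rw [Finset.mul_sum]
          refine Finset.sum_congr rfl fun i hi => ?_
          have := Finset.mem_range.mp hi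
          rw [if_neg (by omega), show s + 1 - i = (s - i) + 1 by omega, pow_succ]; ring
    | add u _ v _ hu hv =>
      obtain ⟨a, ha, rfl⟩ := hu
      obtain ⟨b, hb, rfl⟩ := hv
      exact ⟨fun i => a i + b i, fun i => add_mem (ha i) (hb i), by simp [add_mul, Finset.sum_add_distrib]⟩

lemma Fr_isInt [IsNoetherianRing R] {I : Ideal R} (hJI : J ≤ I) (n : ℕ) (x0 : R) (hx0 : x0 ∈ J)
    (hreg : IsSMulRegular R x0) : ∀ y ∈ Fr J n, IsIntegralOverIdeal (I ^ n) y := by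
  intro y hy
  obtain ⟨c, hc0, hc⟩ := mem_pow_of_mem_Fr hy
  set L := J ^ n with hL
  set K := L ⊔ Ideal.span {y} with hK
  obtain ⟨c', hc'⟩ := exists_nat_ge c
  have h1 : ∀ t, x0 ^ (c' + 1) * y ^ t ∈ L ^ t := by
    intro t
    rw [hL, ← pow_mul]
    by_cases hle : n * t ≤ c' + 1
    · exact Ideal.mul_mem_right _ _ (Ideal.pow_le_pow_right hle (Ideal.pow_mem_pow hx0 _))
    · push Not at hle
      have h2 := hc t (n * t - (c' + 1)) (by
        rw [Nat.cast_sub hle.le]; push_cast; linarith)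
      have := Ideal.mul_mem_mul (Ideal.pow_mem_pow hx0 (c'+1)) h2
      rw [← pow_add] at this
      exact Ideal.pow_le_pow_right (by omega) this
  set b := x0 ^ (c' + 1) with hb
  have hbreg : IsSMulRegular R b := hreg.pow _
  have h2 : ∀ s t, K ^ s * Ideal.span {b * y ^ t} ≤ L ^ (s + t) := by
    intro s
    induction s with
    | zero => intro t; simpa [Ideal.span_singleton_le_iff_mem] using h1 t
    | succ s ih =>
      intro t
      have e1 : K ^ (s+1) * Ideal.span {b * y ^ t} =
          (K ^ s * Ideal.span {b * y ^ t}) * L ⊔ K ^ s * Ideal.span {b * y ^ (t+1)} := by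
        rw [pow_succ, hK, Ideal.mul_sup, Ideal.sup_mul]
        congr 1
        · ring
        · rw [mul_assoc, Ideal.span_singleton_mul_span_singleton]; congr 3; ring
      rw [e1]
      refine sup_le ?_ ?_
      · calc _ ≤ L ^ (s + t) * L := Ideal.mul_mono (ih t) le_rfl
          _ = L ^ (s + 1 + t) := by rw [← pow_succ]; congr 1; omega
      · have := ih (t+1)
        rwa [show s + (t + 1) = s + 1 + t by omega] at this
  let F : L.Filtration R :=
    { N := fun s => K ^ s * Ideal.span {b}
      mono := fun s => Ideal.mul_mono (Ideal.pow_le_pow_right (Nat.le_succ s)) le_rfl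
      smul_le := fun s => by
        rw [smul_eq_mul, ← mul_assoc, pow_succ']
        exact Ideal.mul_mono (Ideal.mul_mono le_sup_left le_rfl) le_rfl }
  have hF : F.Stable := by
    refine Ideal.Filtration.Stable.of_le (Ideal.stableFiltration_stable L ⊤) ?_
    intro s
    simpa [F] using h2 s 0
  obtain ⟨s0, hs0⟩ := hF
  have h3 := hs0 s0 le_rfl
  simp only [F, smul_eq_mul] at h3
  have h4 : y ^ (s0+1) ∈ L * K ^ s0 := by
    have : b * y ^ (s0+1) ∈ K ^ (s0+1) * Ideal.span {b} := by
      rw [mul_comm b]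
      exact Ideal.mul_mem_mul (Ideal.pow_mem_pow (Ideal.mem_sup_right (Ideal.mem_span_singleton_self y)) _)
        (Ideal.mem_span_singleton_self b)
    rw [← h3, ← mul_assoc, mul_comm, Ideal.mem_span_singleton_mul] at this
    obtain ⟨z, hz, hbz⟩ := this
    rwa [← hbreg (show b • z = b • y ^ (s0+1) from hbz)]
  have h5 : ∃ a : ℕ → R, (∀ i, a i ∈ L ^ (i+1)) ∧ y ^ (s0+1) = ∑ i ∈ range (s0+1), a i * y ^ (s0 - i) := by
    refine Submodule.mul_induction_on h4 ?_ ?_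
    · intro l hl z hz
      obtain ⟨a, ha, rfl⟩ := sup_span_pow L y s0 z hz
      refine ⟨fun i => l * a i, fun i => by rw [pow_succ']; exact Ideal.mul_mem_mul hl (ha i), ?_⟩
      rw [Finset.mul_sum]
      exact Finset.sum_congr rfl fun i _ => by ring
    · rintro u v ⟨a, ha, rfl⟩ ⟨b, hb, rfl⟩
      exact ⟨fun i => a i + b i, fun i => add_mem (ha i) (hb i), by simp [add_mul, Finset.sum_add_distrib]⟩
  obtain ⟨a, ha, he⟩ := h5
  refine ⟨s0 + 1, by omega, fun i => - a (i-1), ?_, ?_⟩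
  · intro i hi
    have hi' := Finset.mem_Icc.mp hi
    have := ha (i-1)
    rw [Nat.sub_add_cancel hi'.1] at this
    exact neg_mem (Ideal.pow_right_mono (Ideal.pow_right_mono hJI n) i this)
  · rw [he]
    have : Finset.Icc 1 (s0+1) = (range (s0+1)).image (· + 1) := by
      ext i; simp only [Finset.mem_Icc, Finset.mem_image, Finset.mem_range]
      constructor
      · intro h; exact ⟨i - 1, by omega, by omega⟩
      · rintro ⟨j, hj, rfl⟩; omega
    rw [this, Finset.sum_image (by intro a _ b _ h; simpa using h), ← Finset.sum_add_distrib]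
    refine Finset.sum_eq_zero fun i hi => ?_
    simp only [Nat.add_sub_cancel, Nat.add_sub_add_right]
    ring

lemma Fr_le_intCl [IsNoetherianRing R] {I : Ideal R} (hJI : J ≤ I) (n : ℕ) (x0 : R) (hx0 : x0 ∈ J)
    (hreg : IsSMulRegular R x0) : Fr J n ≤ intCl (I ^ n) :=
  fun y hy => Ideal.subset_span (Fr_isInt hJI n x0 hx0 hreg y hy)

end Fr
end LI2

namespace LI2
variable [CommRing R]

/-- length of the quotient ring -/
noncomputable def lq (I : Ideal R) : ℕ∞ := Module.length R (R ⧸ I)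

/-- colon by an element -/
def col (K : Ideal R) (a : R) : Ideal R := Submodule.comap (LinearMap.mulLeft R a) K

lemma mem_col {K : Ideal R} {a y : R} : y ∈ col K a ↔ a * y ∈ K := Iff.rfl

lemma lq_anti {I K : Ideal R} (h : I ≤ K) : lq K ≤ lq I :=
  Module.length_le_of_surjective (Submodule.factor h) (Submodule.factor_surjective h)

lemma lq_col (K : Ideal R) (a : R) : lq K = lq (col K a) + lq (K ⊔ Ideal.span {a}) := by
  have key : ∀ (C S : Submodule R R) (hC : C = Submodule.comap (LinearMap.mulLeft R a) K) (hS : S = K ⊔ Ideal.span {a}),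
      Module.length R (R ⧸ (K : Submodule R R)) = Module.length R (R ⧸ C) + Module.length R (R ⧸ S) := by
    intro C S hC hS
    have hKS : (K : Submodule R R) ≤ S := hS ▸ le_sup_left
    refine Module.length_eq_add_of_exact
      (Submodule.mapQ C K (LinearMap.mulLeft R a) hC.le)
      (Submodule.mapQ K S LinearMap.id hKS) ?_ ?_ ?_
    · rw [← LinearMap.ker_eq_bot, Submodule.ker_mapQ, ← hC]
      simp [Submodule.mkQ_map_self]
    · intro z
      obtain ⟨z, rfl⟩ := Submodule.Quotient.mk_surjective _ z
      exact ⟨Submodule.Quotient.mk z, rfl⟩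
    · rw [LinearMap.exact_iff]
      ext z
      obtain ⟨z, rfl⟩ := Submodule.Quotient.mk_surjective _ z
      rw [LinearMap.mem_ker, LinearMap.mem_range, Submodule.mapQ_apply, Submodule.Quotient.mk_eq_zero,
        LinearMap.id_apply]
      constructor
      · intro h
        rw [hS] at h
        obtain ⟨k, hk, b, hb, rfl⟩ := Submodule.mem_sup.mp h
        obtain ⟨c, rfl⟩ := Ideal.mem_span_singleton'.mp hb
        refine ⟨Submodule.Quotient.mk c, ?_⟩
        rw [Submodule.mapQ_apply, Submodule.Quotient.eq]
        have : LinearMap.mulLeft R a c - (k + c * a) = -k := by simp; ring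
        rw [this]; exact K.neg_mem hk
      · rintro ⟨c, hc⟩
        obtain ⟨c, rfl⟩ := Submodule.Quotient.mk_surjective _ c
        rw [Submodule.mapQ_apply, Submodule.Quotient.eq] at hc
        have : z = -(LinearMap.mulLeft R a c - z) + c * a := by simp; ring
        rw [this, hS]
        exact Submodule.add_mem_sup (K.neg_mem hc) (Ideal.mul_mem_left _ _ (Ideal.mem_span_singleton_self a))
  exact key _ _ rfl rfl

lemma lq_lower {ι : Type*} [DecidableEq ι] (v : ι → R) (S : Finset ι) (U q : Ideal R)
    (h : ∀ c : ι → R, ∑ i ∈ S, c i * v i ∈ U → ∀ i ∈ S, c i ∈ q) :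
    S.card • lq q + lq (U ⊔ Ideal.span (v '' S)) ≤ lq U := by
  induction S using Finset.induction_on with
  | empty => simp
  | insert i S hi ih =>
    have h1 := ih (fun c hc j hj => by
      have := h (fun k => if k = i then 0 else c k) (by
        rw [Finset.sum_insert hi]
        simp only [if_true, zero_mul, zero_add]
        rw [Finset.sum_congr rfl (g := fun k => c k * v k) (fun k hk => by
          rw [if_neg (by rintro rfl; exact hi hk)])]
        exact hc) j (Finset.mem_insert_of_mem hj)
      simpa [show j ≠ i by rintro rfl; exact hi hj] using this)
    set U' := U ⊔ Ideal.span (v '' S)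
    have h2 := lq_col U' (v i)
    have h3 : col U' (v i) ≤ q := by
      intro y hy
      rw [mem_col] at hy
      obtain ⟨u, hu, w, hw, huw⟩ := Submodule.mem_sup.mp hy
      obtain ⟨c, hc⟩ : ∃ c : ι → R, ∑ k ∈ S, c k • v k = w := by
        obtain ⟨c, hc⟩ := (Submodule.mem_span_image_finset_iff_exists_fun R).mp hw
        refine ⟨fun k => if h : k ∈ S then c ⟨k, h⟩ else 0, ?_⟩
        rw [← hc, ← Finset.sum_coe_sort S]
        exact Finset.sum_congr rfl fun k _ => by simp
      have := h (fun k => if k = i then y else - c k) (by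
        rw [Finset.sum_insert hi]
        simp only [if_true]
        rw [Finset.sum_congr rfl (g := fun k => - (c k • v k)) (fun k hk => by
          rw [if_neg (by rintro rfl; exact hi hk)]; simp)]
        rw [Finset.sum_neg_distrib, hc]
        have : y * v i + -w = u := by rw [mul_comm, ← huw]; ring
        rw [this]; exact hu) i (Finset.mem_insert_self _ _)
      simpa using this
    have h4 : U' ⊔ Ideal.span {v i} = U ⊔ Ideal.span (v '' (insert i S : Finset ι)) := by
      rw [Finset.coe_insert, Set.image_insert_eq, Ideal.span_insert, sup_assoc, sup_comm (Ideal.span _)]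
    rw [h4] at h2
    rw [Finset.card_insert_of_notMem hi, succ_nsmul, add_assoc]
    calc _ ≤ S.card • lq q + (lq (col U' (v i)) + _) := by gcongr; exact lq_anti h3
      _ = _ := by rw [← h2]
      _ ≤ _ := h1

lemma lq_upper {ι : Type*} [DecidableEq ι] (v : ι → R) (S : Finset ι) (U q : Ideal R)
    (h : ∀ i ∈ S, ∀ y ∈ q, v i * y ∈ U) :
    lq U ≤ S.card • lq q + lq (U ⊔ Ideal.span (v '' S)) := by
  induction S using Finset.induction_on with
  | empty => simp
  | insert i S hi ih =>
    have h1 := ih (fun i hi => h i (Finset.mem_insert_of_mem hi))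
    set U' := U ⊔ Ideal.span (v '' S)
    have h2 := lq_col U' (v i)
    have h3 : q ≤ col U' (v i) := fun y hy => le_sup_left (a := U) (h i (Finset.mem_insert_self _ _) y hy)
    have h4 : U' ⊔ Ideal.span {v i} = U ⊔ Ideal.span (v '' (insert i S : Finset ι)) := by
      rw [Finset.coe_insert, Set.image_insert_eq, Ideal.span_insert, sup_assoc, sup_comm (Ideal.span _)]
    rw [h4] at h2
    rw [Finset.card_insert_of_notMem hi, succ_nsmul, add_assoc]
    calc _ ≤ _ := h1
      _ = S.card • lq q + (lq (col U' (v i)) + _) := by rw [← h2]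
      _ ≤ _ := by gcongr; exact lq_anti h3

lemma eq_of_lq {K I : Ideal R} (h : K ≤ I) (h1 : lq K ≤ lq I) (h2 : lq K ≠ ⊤) : K = I := by
  refine le_antisymm h fun a ha => ?_
  by_contra hK
  have h3 := lq_col K a
  have h4 : K ⊔ Ideal.span {a} ≤ I := sup_le h ((Ideal.span_singleton_le_iff_mem _).mpr ha)
  have h5 := lq_anti h4
  have h6 : 0 < lq (col K a) := by
    rw [pos_iff_ne_zero, lq, Ne, Module.length_eq_zero_iff, Ideal.Quotient.subsingleton_iff,
      Ideal.eq_top_iff_one, mem_col, mul_one]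
    exact hK
  have h7 : lq (K ⊔ Ideal.span {a}) ≠ ⊤ := ne_top_of_le_ne_top h2 (lq_anti le_sup_left)
  have : lq K < lq K := by
    calc lq K ≤ lq I := h1
      _ ≤ _ := h5
      _ < lq (col K a) + lq (K ⊔ Ideal.span {a}) := by
        exact ENat.lt_add_left h7 h6
      _ = lq K := h3.symm
  exact lt_irrefl _ this

lemma lq_top : lq (⊤ : Ideal R) = 0 := by
  rw [lq, Module.length_eq_zero_iff]
  exact Ideal.Quotient.subsingleton_iff.mpr rfl

lemma lq_max [IsLocalRing R] : lq (maximalIdeal R) = 1 := by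
  rw [lq, Module.length_eq_one_iff, isSimpleModule_iff_isCoatom, ← Ideal.isMaximal_def]
  infer_instance

lemma lq_ne_top [IsLocalRing R] [IsNoetherianRing R] {I : Ideal R} (N : ℕ) (h : maximalIdeal R ^ N ≤ I) : lq I ≠ ⊤ := by
  by_cases hI : I = ⊤
  · rw [hI, lq_top]; simp
  have : Nontrivial (R ⧸ I) := Ideal.Quotient.nontrivial_iff.mpr hI
  have : IsLocalRing (R ⧸ I) := IsLocalRing.of_surjective' (Ideal.Quotient.mk I) Ideal.Quotient.mk_surjective
  have : IsArtinianRing (R ⧸ I) := by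
    rw [isArtinianRing_iff_isNilpotent_maximalIdeal]
    refine ⟨N, ?_⟩
    rw [← (IsLocalRing.eq_maximalIdeal (Ideal.IsMaximal.map_of_surjective_of_ker_le (m := maximalIdeal R) (f := Ideal.Quotient.mk I) Ideal.Quotient.mk_surjective (by rw [Ideal.mk_ker]; exact le_maximalIdeal hI))), ← Ideal.map_pow, Ideal.zero_eq_bot,
      Ideal.map_eq_bot_iff_le_ker, Ideal.mk_ker]
    exact h
  have : IsArtinian R (R ⧸ I) := isArtinian_of_surjective_algebraMap (R := R ⧸ I) (S := R) (M := R ⧸ I) (Ideal.Quotient.mk_surjective (I := I))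
  exact Module.length_ne_top

/-- Hilbert function of a polynomial ring -/
def HF (d n : ℕ) : ℕ := (finsuppAntidiag (Finset.univ : Finset (Fin d)) n).card

lemma mono_span {d : ℕ} (x : Fin d → R) (n : ℕ) :
    Ideal.span ((fun m : Fin d →₀ ℕ => ∏ i, x i ^ m i) '' (finsuppAntidiag (Finset.univ : Finset (Fin d)) n)) = gen x ^ n := by
  apply le_antisymm
  · rw [Ideal.span_le]
    rintro _ ⟨m, hm, rfl⟩
    simp only [Finset.mem_coe, mem_finsuppAntidiag] at hm
    have := eval_mem_pow x n (MvPolynomial.monomial m 1) (by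
      apply MvPolynomial.isHomogeneous_monomial
      rw [← hm.1]
      simp [Finsupp.degree_eq_sum])
    simpa [MvPolynomial.eval_monomial, Finsupp.prod_fintype] using this
  · intro y hy
    obtain ⟨F, hF, rfl⟩ := (Ideal.mem_span_pow_iff_exists_isHomogeneous x y).mp hy
    rw [MvPolynomial.eval_eq']
    refine Ideal.sum_mem _ fun m hm => Ideal.mul_mem_left _ _ (Ideal.subset_span ⟨m, ?_, rfl⟩)
    simp only [Finset.mem_coe, mem_finsuppAntidiag]
    refine ⟨?_, by simp⟩
    have := hF (MvPolynomial.mem_support_iff.mp hm)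
    rw [wt_one, Finsupp.degree_eq_sum] at this
    exact this

/-- monomials of degree `n` -/
abbrev Mo (d n : ℕ) : Finset (Fin d →₀ ℕ) := finsuppAntidiag (Finset.univ : Finset (Fin d)) n

lemma mem_Mo {d n : ℕ} (m : Fin d →₀ ℕ) : m ∈ Mo d n ↔ m.degree = n := by
  rw [mem_finsuppAntidiag, Finsupp.degree_eq_sum]; simp

/-- homogeneous polynomial with given coefficients -/
noncomputable def hp {d : ℕ} (n : ℕ) (c : (Fin d →₀ ℕ) → R) : MvPolynomial (Fin d) R :=
  ∑ m ∈ Mo d n, MvPolynomial.monomial m (c m)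

lemma hp_hom {d : ℕ} (n : ℕ) (c : (Fin d →₀ ℕ) → R) : (hp n c).IsHomogeneous n :=
  MvPolynomial.IsHomogeneous.sum _ _ _ fun m hm =>
    MvPolynomial.isHomogeneous_monomial _ ((mem_Mo m).mp hm)

lemma hp_coeff {d : ℕ} (n : ℕ) (c : (Fin d →₀ ℕ) → R) (m) (hm : m ∈ Mo d n) : (hp n c).coeff m = c m := by
  rw [hp, MvPolynomial.coeff_sum, Finset.sum_eq_single m]
  · simp
  · intro b _ hb; simp [MvPolynomial.coeff_monomial, hb]
  · intro h; exact absurd hm h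

lemma hp_eval {d : ℕ} (x : Fin d → R) (n : ℕ) (c : (Fin d →₀ ℕ) → R) :
    MvPolynomial.eval x (hp n c) = ∑ m ∈ Mo d n, c m * ∏ i, x i ^ m i := by
  rw [hp, map_sum]
  refine Finset.sum_congr rfl fun m _ => ?_
  simp [MvPolynomial.eval_monomial, Finsupp.prod_fintype]

lemma lq_pow {d : ℕ} (x : Fin d → R) (hq : QR x) (n : ℕ) :
    lq (gen x ^ (n+1)) = HF d n • lq (gen x) + lq (gen x ^ n) := by
  classical
  have h := mono_span x n
  have h' : gen x ^ (n+1) ⊔ gen x ^ n = gen x ^ n := sup_eq_right.mpr (Ideal.pow_le_pow_right (Nat.le_succ n))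
  apply le_antisymm
  · have := lq_upper (fun m : Fin d →₀ ℕ => ∏ i, x i ^ m i) (Mo d n) (gen x ^ (n+1)) (gen x) (by
      intro m hm y hy
      rw [pow_succ]
      refine Ideal.mul_mem_mul ?_ hy
      rw [← h]
      exact Ideal.subset_span ⟨m, hm, rfl⟩)
    rw [h, h'] at this
    exact this
  · have := lq_lower (fun m : Fin d →₀ ℕ => ∏ i, x i ^ m i) (Mo d n) (gen x ^ (n+1)) (gen x) (by
      intro c hc m hm
      rw [← hp_eval] at hc
      rw [← hp_coeff n c m hm]
      exact hq n _ (hp_hom n c) hc m)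
    rw [h, h'] at this
    exact this

lemma HF_succ (d n : ℕ) : HF (d+1) n = (n + d).choose d := by
  rw [HF, card_finsuppAntidiag_nat_eq_choose]
  simp only [Finset.card_univ, Fintype.card_fin]
  rw [show d + 1 + n - 1 = n + d by omega, Nat.choose_symm_add]

lemma sum_HF (d n : ℕ) : ∑ j ∈ range n, HF (d+1) j = (n + d).choose (d+1) := by
  induction n with
  | zero => simp
  | succ n ih => 
    rw [Finset.sum_range_succ, ih, HF_succ, show n + 1 + d = (n + d) + 1 by ring, Nat.choose_succ_succ, add_comm]

lemma HF_mono (d : ℕ) {a b : ℕ} (h : a ≤ b) : HF (d+1) a ≤ HF (d+1) b := by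
  rw [HF_succ, HF_succ]; exact Nat.choose_le_choose _ (by omega)

lemma lq_pow_eq {d : ℕ} (x : Fin d → R) (hq : QR x) (n : ℕ) :
    lq (gen x ^ n) = (∑ j ∈ range n, HF d j) • lq (gen x) := by
  induction n with
  | zero => simp [Ideal.one_eq_top, lq_top]
  | succ n ih => rw [lq_pow x hq, ih, Finset.sum_range_succ, add_nsmul, add_comm]

end LI2

namespace LI2

open AdicCompletion in
theorem noeth_completion (R : Type*) [CommRing R] [IsLocalRing R] [IsNoetherianRing R] :
    IsNoetherianRing (AdicCompletion (maximalIdeal R) R) := by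
  set S := AdicCompletion (maximalIdeal R) R
  obtain ⟨r, a, ha⟩ := Submodule.fg_iff_exists_fin_generating_family.mp (maximalIdeal R).fg_of_isNoetherianRing
  let P := MvPolynomial (Fin r) R
  let V : Ideal P := MvPolynomial.idealOfVars (Fin r) R
  have hV : V.FG := MvPolynomial.idealOfVars_fg _ _
  let B := AdicCompletion V P
  have hB : IsNoetherianRing B := 
    isNoetherianRing_of_ringEquiv (MvPowerSeries (Fin r) R) (MvPowerSeries.toAdicCompletionAlgEquiv (Fin r) R).toRingEquiv
  let g : P →+* S := (MvPolynomial.aeval (fun i => algebraMap R S (a i)) : P →ₐ[R] S).toRingHom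
  have hgV : V.map g = maximalIdeal S := by
    have h1 : maximalIdeal S = (Ideal.span (Set.range a)).map (algebraMap R S) := by
      rw [AdicCompletion.maximalIdeal_eq_map]; exact congrArg _ ha.symm
    rw [h1]
    change Ideal.map g (Ideal.span _) = _
    rw [Ideal.map_span, Ideal.map_span, ← Set.range_comp, ← Set.range_comp]
    congr 2
    funext i
    exact MvPolynomial.aeval_X _ i
  let f : (n : ℕ) → B →+* S ⧸ (maximalIdeal S) ^ n := fun n =>
    (Ideal.quotientMap ((maximalIdeal S)^n) g (by
      rw [← Ideal.map_le_iff_le_comap, Ideal.map_pow, hgV])).comp (evalₐ V n : B →+* P ⧸ V ^ n)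
  have hf : ∀ {m n : ℕ} (hle : m ≤ n), (Ideal.Quotient.factorPow _ hle).comp (f n) = f m := by
    intro m n hle
    ext b
    have h1 : evalₐ V m b = Ideal.Quotient.factorPow V hle (evalₐ V n b) := by
      induction b using AdicCompletion.induction_on with
      | _ x =>
        rw [evalₐ_mk, evalₐ_mk]
        refine (Ideal.Quotient.eq.mpr ?_ : Ideal.Quotient.mk (V^m) (x.1 m) = Ideal.Quotient.mk (V^m) (x.1 n))
        have := x.2 hle
        rw [SModEq.sub_mem, smul_eq_mul, Ideal.mul_top] at this
        exact this
    obtain ⟨p, hp⟩ := Ideal.Quotient.mk_surjective (evalₐ V n b)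
    rw [← hp] at h1
    simp only [f, RingHom.comp_apply, RingHom.coe_coe]
    rw [h1, ← hp]
    simp
  let F : B →+* S := IsAdicComplete.liftRingHom (maximalIdeal S) f hf
  have hFg : F.comp (algebraMap P B) = g := by
    refine RingHom.ext fun p => ?_
    refine IsHausdorff.eq_iff_smodEq (I := maximalIdeal S) |>.mpr fun n => ?_
    rw [SModEq.sub_mem, smul_eq_mul, Ideal.mul_top, ← Ideal.Quotient.eq]
    rw [RingHom.comp_apply, IsAdicComplete.mk_liftRingHom]
    simp only [f, RingHom.comp_apply, RingHom.coe_coe]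
    have h2 : evalₐ V n (algebraMap P B p) = Ideal.Quotient.mk _ p := by
      rw [AdicCompletion.algebraMap_apply]; exact evalₐ_of V n p
    rw [h2]
    simp
  have hmap : (V.map (algebraMap P B)).map F = maximalIdeal S := by
    rw [Ideal.map_map, hFg, hgV]
  have : IsAdicComplete (V.map (algebraMap P B)) B := AdicCompletion.isAdicComplete_self _ hV
  have : IsHausdorff ((V.map (algebraMap P B)).map F) S := by rw [hmap]; infer_instance
  have hsurj : Function.Surjective F := by
    refine surjective_of_mk_map_comp_surjective (I := V.map (algebraMap P B)) F ?_
    intro y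
    obtain ⟨y, rfl⟩ := Ideal.Quotient.mk_surjective y
    obtain ⟨z, hz⟩ := (AdicCompletion.residueField_map_bijective R).2 (residue S y)
    obtain ⟨z, rfl⟩ := residue_surjective z
    refine ⟨algebraMap P B (MvPolynomial.C z), ?_⟩
    rw [RingHom.comp_apply, ← RingHom.comp_apply F, hFg, Ideal.Quotient.eq, hmap]
    rw [IsLocalRing.ResidueField.map_residue] at hz
    have := (Ideal.Quotient.eq (I := maximalIdeal S)).mp hz
    have h3 : g (MvPolynomial.C z) = algebraMap R S z := MvPolynomial.aeval_C _ z
    rw [h3]; exact this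
  exact isNoetherianRing_of_surjective B S F hsurj

end LI2

namespace LI2
open RingTheory.Sequence
variable [CommRing R] [IsLocalRing R] [IsNoetherianRing R]

lemma exists_unit_elem {d : ℕ} (x : Fin (d+1) → R) (hq : QR x) (hJ : gen x ≤ maximalIdeal R) (N0 : ℕ)
    (hN0 : maximalIdeal R ^ N0 ≤ gen x) (b : R) (hb : IsSMulRegular R b) :
    ∃ (N : ℕ) (Ω : MvPolynomial (Fin (d+1)) R), Ω.IsHomogeneous N ∧ (∃ m, IsUnit (Ω.coeff m)) ∧
      MvPolynomial.eval x Ω ∈ Ideal.span {b} := by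
  classical
  by_contra hcon
  push Not at hcon
  have hc : ∀ N (Ω : MvPolynomial (Fin (d+1)) R), Ω.IsHomogeneous N → MvPolynomial.eval x Ω ∈ Ideal.span {b} →
      ∀ m, Ω.coeff m ∈ maximalIdeal R := by
    intro N Ω h1 h2 m
    by_contra h3
    exact hcon N Ω h1 ⟨m, by simpa using h3⟩ h2
  have low : ∀ n, ((∑ j ∈ range n, HF (d+1) j : ℕ) : ℕ∞) ≤ lq (Ideal.span {b} ⊔ gen x ^ n) := by
    intro n
    induction n with
    | zero => simp
    | succ n ih =>
      have h := lq_lower (fun m : Fin (d+1) →₀ ℕ => ∏ i, x i ^ m i) (Mo (d+1) n) (Ideal.span {b} ⊔ gen x ^ (n+1)) (maximalIdeal R) (by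
        intro c hcs m hm
        rw [← hp_eval] at hcs
        obtain ⟨z, hz, y, hy, hzy⟩ := Submodule.mem_sup.mp hcs
        rw [pow_succ'] at hy
        obtain ⟨F, hF, hFc, rfl⟩ := mem_mul_pow x _ n y hy
        have := hc n (hp n c - F) ((hp_hom n c).sub hF) (by rw [map_sub, ← hzy]; simpa using hz) m
        rw [MvPolynomial.coeff_sub, hp_coeff n c m hm] at this
        have := Ideal.add_mem _ this (hJ (hFc m))
        simpa using this)
      rw [lq_max, mono_span, sup_assoc, sup_eq_right.mpr (Ideal.pow_le_pow_right (Nat.le_succ n) : gen x ^ (n+1) ≤ gen x ^ n)] at h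
      refine le_trans ?_ h
      rw [Finset.sum_range_succ, Nat.cast_add, add_comm]
      refine add_le_add ?_ ih
      simp [HF]
  obtain ⟨k, hk⟩ := Ideal.exists_pow_inf_eq_pow_smul (gen x) (Ideal.span {b})
  have hcol : ∀ n ≥ k, col (gen x ^ n) b ≤ gen x ^ (n - k) := by
    intro n hn y hy
    have h1 : b * y ∈ (gen x ^ n • ⊤ ⊓ Ideal.span {b} : Ideal R) :=
      ⟨by simpa [mem_col] using hy, Ideal.mul_mem_right _ _ (Ideal.mem_span_singleton_self b)⟩
    rw [hk n hn] at h1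
    have h2 : b * y ∈ gen x ^ (n - k) * Ideal.span {b} :=
      Submodule.smul_mono le_rfl inf_le_right h1
    rw [mul_comm, Ideal.mem_span_singleton_mul] at h2
    obtain ⟨z, hz, hzy⟩ := h2
    have : z = y := hb (by simpa using hzy)
    rwa [← this]
  obtain ⟨L, hL⟩ := ENat.ne_top_iff_exists.mp (lq_ne_top N0 hN0)
  have hfin : ∀ n, lq (gen x ^ n) = ((∑ j ∈ range n, HF (d+1) j) * L : ℕ) := by
    intro n; rw [lq_pow_eq x hq, ← hL]; simp
  have main : ∀ n ≥ k, (∑ j ∈ range (n - k), HF (d+1) j) * L + ∑ j ∈ range n, HF (d+1) j ≤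
      (∑ j ∈ range n, HF (d+1) j) * L := by
    intro n hn
    have h1 := lq_col (gen x ^ n) b
    have h2 := lq_anti (hcol n hn)
    have h3 := low n
    rw [sup_comm] at h3
    rw [hfin] at h1 h2
    have : (((∑ j ∈ range (n - k), HF (d+1) j) * L : ℕ) : ℕ∞) + (∑ j ∈ range n, HF (d+1) j : ℕ) ≤ ((∑ j ∈ range n, HF (d+1) j) * L : ℕ) := by
      rw [h1]; exact add_le_add h2 h3
    exact_mod_cast this
  set n := k + L * k * (d+1) + 1 with hn
  have h1 := main n (by omega)
  have h2 : ∑ j ∈ range n, HF (d+1) j ≤ ∑ j ∈ range (n - k), HF (d+1) j + k * HF (d+1) n := by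
    have : n = (n - k) + k := by omega
    conv_lhs => rw [this, Finset.sum_range_add]
    gcongr
    calc _ ≤ ∑ j ∈ range k, HF (d+1) n := Finset.sum_le_sum fun j hj => HF_mono d (by have := mem_range.mp hj; omega)
      _ = _ := by simp
  have h3 : ∑ j ∈ range n, HF (d+1) j ≤ L * k * HF (d+1) n := by nlinarith
  have h4 : (∑ j ∈ range n, HF (d+1) j) * (d+1) = HF (d+1) n * n := by
    rw [sum_HF, HF_succ, Nat.choose_succ_right_eq]; simp
  have h5 : HF (d+1) n * n ≤ HF (d+1) n * (L * k * (d+1)) := by nlinarith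
  have h6 : 0 < HF (d+1) n := by rw [HF_succ]; exact Nat.choose_pos (by omega)
  have := Nat.le_of_mul_le_mul_left h5 h6
  omega

lemma exists_nzd [IsReduced R] (y : R) : ∃ b a u : R, IsSMulRegular R b ∧ b = a * y + u ∧ u * y = 0 := by
  set K : Ideal R := Ideal.span {y} ⊔ col ⊥ y with hK
  have : ∃ b ∈ K, IsSMulRegular R b := by
    by_contra hcon
    push Not at hcon
    have h1 : (K : Set R) ⊆ ⋃ p ∈ associatedPrimes R R, p := by
      rw [biUnion_associatedPrimes_eq_compl_regular R R]
      exact fun r hr => hcon r hr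
    have hfin := associatedPrimes.finite R R
    have h2 := (Ideal.subset_union_prime (s := hfin.toFinset) (f := id) ⊥ ⊥ (I := K) (by
      intro i hi _ _
      exact IsAssociatedPrime.isPrime (M := R) ((hfin.mem_toFinset).mp hi))).mp (by simpa using h1)
    obtain ⟨p, hp, hKp⟩ := h2
    obtain ⟨hpp, z, hz⟩ : IsAssociatedPrime p R := (hfin.mem_toFinset).mp hp
    have hmem : ∀ r : R, r * z = 0 → r ∈ p := by
      intro r hr
      rw [hz]
      refine Ideal.le_radical ?_
      rw [Submodule.mem_colon_singleton]; simpa using hr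
    have hrad : ∀ r ∈ p, r * z = 0 := by
      intro r hr
      rw [hz] at hr
      obtain ⟨n, hn⟩ := hr
      rw [Submodule.mem_colon_singleton] at hn
      have hn : r ^ n * z = 0 := by simpa using hn
      have : IsNilpotent (r * z) := ⟨n + 1, by rw [mul_pow, pow_succ, pow_succ, show r^n * r * (z^n*z) = r ^ n * z * (r * z ^ n) by ring, hn, zero_mul]⟩
      exact this.eq_zero
    have hy : y * z = 0 := hrad y (hKp (Ideal.mem_sup_left (Ideal.mem_span_singleton_self y)))
    have hzp : z ∈ p := hKp (Ideal.mem_sup_right (by rw [mem_col]; exact hy))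
    have hz0 : z * z = 0 := hrad z hzp
    have : z = 0 := (IsReduced.eq_zero z ⟨2, by rw [pow_two, hz0]⟩)
    exact hpp.ne_top ((Ideal.eq_top_iff_one _).mpr (hmem 1 (by simp [this])))
  obtain ⟨b, hb, hreg⟩ := this
  obtain ⟨w, hw, u, hu, rfl⟩ := Submodule.mem_sup.mp hb
  obtain ⟨a, rfl⟩ := Ideal.mem_span_singleton'.mp hw
  exact ⟨_, a, u, hreg, rfl, by rw [mul_comm]; exact hu⟩

lemma Fr_inter_zero [IsReduced R] {d : ℕ} (x : Fin (d+1) → R) (hq : QR x) (hJ : gen x ≤ maximalIdeal R) (N0 : ℕ)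
    (hN0 : maximalIdeal R ^ N0 ≤ gen x) (y : R) (hy : ∀ n : ℕ, y ∈ Fr (gen x) n) : y = 0 := by
  obtain ⟨b, a, u, hb, hbe, hu⟩ := exists_nzd y
  obtain ⟨N, Ω, hΩ, ⟨m, hm⟩, h⟩ := exists_unit_elem x hq hJ N0 hN0 b hb
  obtain ⟨c', hc'⟩ := Ideal.mem_span_singleton'.mp h
  obtain ⟨c, hc0, hc⟩ := mem_pow_of_mem_Fr (hy (N+1))
  have key : ∀ n, y ∈ gen x ^ n := by
    intro n
    set q := n + ⌈c⌉₊ with hqd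
    refine q1_pow x hq N Ω hΩ m hm q n y ?_
    have hby : ∀ q, b ^ q * y = a ^ q * y ^ (q+1) := by
      intro q
      induction q with
      | zero => simp
      | succ q ih =>
        rw [pow_succ', mul_assoc, ih, hbe]
        have : (a * y + u) * (a ^ q * y ^ (q+1)) = a ^ (q+1) * y ^ (q+1+1) + (u * y) * (a ^ q * y ^ q) := by ring
        rw [this, hu]; ring
    rw [← hc', mul_pow, mul_assoc, hby]
    refine Ideal.mul_mem_left _ _ (Ideal.mul_mem_left _ _ (hc (q+1) _ ?_))
    have := Nat.le_ceil c
    have hqr : (q : ℝ) = n + ⌈c⌉₊ := by rw [hqd]; push_cast; ring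
    push_cast
    nlinarith [(Nat.cast_nonneg N : (0:ℝ) ≤ N)]
  have : y ∈ (⨅ i, maximalIdeal R ^ i : Ideal R) := by
    rw [Ideal.mem_iInf]; exact fun i => Ideal.pow_right_mono hJ i (key i)
  rwa [Ideal.iInf_pow_eq_bot_of_isLocalRing _ (Ideal.IsPrime.ne_top inferInstance), Ideal.mem_bot] at this

lemma stab (G : ℕ → Ideal R) (hG : Antitone G) (U : Ideal R) (hU : lq U ≠ ⊤) (h : ∀ n, U ≤ G n) :
    ∃ n0, ∀ n ≥ n0, G n = G n0 := by
  obtain ⟨B, hB⟩ := ENat.ne_top_iff_exists.mp hU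
  have hfin : ∀ n, lq (G n) ≠ ⊤ := fun n => ne_top_of_le_ne_top hU (lq_anti (h n))
  choose f hf using fun n => ENat.ne_top_iff_exists.mp (hfin n)
  have hbd : ∀ n, f n ≤ B := fun n => by
    have := lq_anti (h n)
    rw [← hB, ← hf] at this
    exact_mod_cast this
  have hmem := Nat.sSup_mem (s := Set.range f) ⟨_, 0, rfl⟩ ⟨B, by rintro _ ⟨n, rfl⟩; exact hbd n⟩
  obtain ⟨n0, hn0⟩ := hmem
  refine ⟨n0, fun n hn => eq_of_lq (hG hn) ?_ (hfin n)⟩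
  rw [← hf, ← hf]
  have : f n ≤ f n0 := by rw [hn0]; exact le_csSup ⟨B, by rintro _ ⟨n, rfl⟩; exact hbd n⟩ ⟨n, rfl⟩
  exact_mod_cast this

end LI2

namespace LI2
open RingTheory.Sequence

lemma isRegular_ofFn_map {R S : Type*} [CommRing R] [CommRing S] [Algebra R S] [Module.FaithfullyFlat R S] {d : ℕ} (x : Fin d → R)
    (h : IsRegular R (List.ofFn x)) : IsRegular S (List.ofFn (algebraMap R S ∘ x)) := by
  have := h.of_faithfullyFlat (S := S)
  rwa [List.map_ofFn] at this

theorem condC {R : Type*} [CommRing R] [IsLocalRing R] [IsNoetherianRing R]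
    (hred : IsReduced (AdicCompletion (maximalIdeal R) R)) {d : ℕ} (x : Fin (d+1) → R)
    (hreg : IsRegular R (List.ofFn x)) (hJ : gen x ≤ maximalIdeal R) (N0 : ℕ)
    (hN0 : maximalIdeal R ^ N0 ≤ gen x) (M : ℕ) : ∃ n : ℕ, Fr (gen x) n ≤ maximalIdeal R ^ M := by
  classical
  by_contra hcon
  push Not at hcon
  set m := maximalIdeal R with hm
  have hst : ∀ k, ∃ n0 : ℕ, ∀ n ≥ n0, Fr (gen x) n ⊔ m ^ k = Fr (gen x) n0 ⊔ m ^ k := by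
    intro k
    exact stab (fun n => Fr (gen x) n ⊔ m ^ k) (fun a b h => sup_le_sup_right (Fr_anti (by exact_mod_cast h)) _)
      (m ^ k) (lq_ne_top k le_rfl) (fun n => le_sup_right)
  choose ν hν using hst
  set T : ℕ → Ideal R := fun k => Fr (gen x) (ν k) ⊔ m ^ k with hT
  have hT1 : ∀ k n : ℕ, T k ≤ Fr (gen x) n ⊔ m ^ k := by
    intro k n
    rw [hT]; simp only
    rw [← hν k (max n (ν k)) (le_max_right _ _)]
    exact sup_le_sup_right (Fr_anti (by exact_mod_cast le_max_left _ _)) _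
  have hT2 : ∀ k, ∀ y ∈ T k, ∃ y' ∈ T (k+1), y' - y ∈ m ^ k := by
    intro k y hy
    obtain ⟨a, ha, b, hb, rfl⟩ := Submodule.mem_sup.mp (hT1 k (ν (k+1)) hy)
    exact ⟨a, Ideal.mem_sup_left ha, by simpa using hb⟩
  have hstart : ∃ y ∈ T M, y ∉ m ^ M := by
    obtain ⟨y, hy, hy'⟩ := Set.not_subset.mp (hcon (ν M))
    exact ⟨y, Ideal.mem_sup_left hy, hy'⟩
  obtain ⟨y0, hy0, hy0'⟩ := hstart
  choose g hg1 hg2 using hT2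
  let z : (j : ℕ) → {y : R // y ∈ T (M + j)} := fun j => Nat.rec ⟨y0, hy0⟩ (fun j w => ⟨g (M+j) w.1 w.2, hg1 (M+j) w.1 w.2⟩) j
  have hz : ∀ j, (z (j+1)).1 - (z j).1 ∈ m ^ (M + j) := fun j => hg2 (M+j) (z j).1 (z j).2
  have hz0 : ∀ j, (z j).1 - y0 ∈ m ^ M := by
    intro j
    induction j with
    | zero => simp [z]
    | succ j ih =>
      have := Ideal.add_mem _ (Ideal.pow_le_pow_right (Nat.le_add_right M j) (hz j)) ih
      simpa using this
  set S := AdicCompletion m R with hS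
  let y : S := AdicCompletion.mk m R (AdicCompletion.AdicCauchySequence.mk m R (fun j => (z j).1) (by
    intro n
    rw [SModEq.sub_mem, smul_eq_mul, Ideal.mul_top]
    rw [← Ideal.neg_mem_iff, neg_sub]
    exact Ideal.pow_le_pow_right (Nat.le_add_left n M) (hz n)))
  have hmS : maximalIdeal S = m.map (algebraMap R S) := AdicCompletion.maximalIdeal_eq_map ..
  have hyz : ∀ n, y - algebraMap R S (z n).1 ∈ maximalIdeal S ^ n := by
    intro n
    rw [hmS, ← Ideal.map_pow, ← Submodule.restrictScalars_mem R, ← Ideal.smul_top_eq_map,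
      AdicCompletion.pow_smul_top_eq_ker_eval m.fg_of_isNoetherianRing, LinearMap.mem_ker, map_sub, sub_eq_zero]
    rfl
  haveI : IsNoetherianRing S := noeth_completion R
  haveI : Module.Flat R S := AdicCompletion.flat_of_isNoetherian ..
  haveI : Module.FaithfullyFlat R S := Module.FaithfullyFlat.of_flat_of_isLocalHom
  have hregS := isRegular_ofFn_map (S := S) x hreg
  have hgm := gen_map (algebraMap R S) x
  have hJS : gen (algebraMap R S ∘ x) ≤ maximalIdeal S := by
    rw [← hgm, hmS]; exact Ideal.map_mono hJ
  have hN0S : maximalIdeal S ^ N0 ≤ gen (algebraMap R S ∘ x) := by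
    rw [← hgm, hmS, ← Ideal.map_pow]; exact Ideal.map_mono hN0
  have hy : y = 0 := by
    haveI : IsReduced S := hred
    refine Fr_inter_zero (algebraMap R S ∘ x) (qr_of_regular _ hregS) hJS N0 hN0S y fun n => ?_
    have h1 := hyz (N0 * n)
    have h2 : maximalIdeal S ^ (N0 * n) ≤ Fr (gen (algebraMap R S ∘ x)) n := by
      rw [pow_mul]; exact (Ideal.pow_right_mono hN0S n).trans (pow_le_Fr n)
    have h3 : algebraMap R S (z (N0 * n)).1 ∈ Fr (gen (algebraMap R S ∘ x)) n := by
      obtain ⟨a, ha, b, hb, hab⟩ := Submodule.mem_sup.mp (hT1 _ n (z (N0 * n)).2)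
      rw [← hab, map_add]
      refine Ideal.add_mem _ ?_ (h2 ?_)
      · rw [← hgm]; exact Fr_map _ _ ha
      · rw [hmS, ← Ideal.map_pow]
        exact Ideal.mem_map_of_mem _ (Ideal.pow_le_pow_right (Nat.le_add_left _ M) hb)
    simpa using Ideal.add_mem _ (h2 h1) h3
  apply hy0'
  have h1 : AdicCompletion.eval m R M y = 0 := by rw [hy, map_zero]
  have h2 : (Submodule.mkQ (m ^ M • ⊤ : Submodule R R)) (z M).1 = 0 := h1
  rw [Submodule.mkQ_apply, Submodule.Quotient.mk_eq_zero, smul_eq_mul, Ideal.mul_top] at h2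
  have := Ideal.sub_mem _ h2 (hz0 M)
  simpa using this

end LI2

namespace LI2

/-- the twisted Frobenius map is finite -/
lemma finite_twist {k k0 : Type*} [Field k] [Field k0] (d q : ℕ) (hq : 0 < q) (φ : k →+* k0) (hφ : φ.Finite) :
    (MvPolynomial.eval₂Hom (MvPolynomial.C.comp φ) (fun i : Fin d => (MvPolynomial.X i : MvPolynomial (Fin d) k0) ^ q)
      : MvPolynomial (Fin d) k →+* MvPolynomial (Fin d) k0).Finite := by
  set Φ := (MvPolynomial.eval₂Hom (MvPolynomial.C.comp φ) (fun i : Fin d => (MvPolynomial.X i : MvPolynomial (Fin d) k0) ^ q)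
      : MvPolynomial (Fin d) k →+* MvPolynomial (Fin d) k0) with hΦ
  letI := Φ.toAlgebra
  letI := φ.toAlgebra
  haveI : Module.Finite k k0 := hφ
  have hC : ∀ c, algebraMap (MvPolynomial (Fin d) k) (MvPolynomial (Fin d) k0) (MvPolynomial.C c) = MvPolynomial.C (φ c) := by
    intro c
    simp [RingHom.algebraMap_toAlgebra, hΦ]
  have hX : ∀ i, algebraMap (MvPolynomial (Fin d) k) (MvPolynomial (Fin d) k0) (MvPolynomial.X i) = MvPolynomial.X i ^ q := by
    intro c
    simp [RingHom.algebraMap_toAlgebra, hΦ]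
  obtain ⟨s, hs⟩ := (Module.Finite.fg_top : (⊤ : Submodule k k0).FG)
  have hfin : Module.Finite (MvPolynomial (Fin d) k) (MvPolynomial (Fin d) k0) := by
    set S : Set (MvPolynomial (Fin d) k0) := (MvPolynomial.C '' (s : Set k0)) ∪ Set.range MvPolynomial.X with hS
    have hSf : S.Finite := (s.finite_toSet.image _).union (Set.finite_range _)
    have hSi : ∀ z ∈ S, IsIntegral (MvPolynomial (Fin d) k) z := by
      rintro z (⟨c, hc, rfl⟩ | ⟨i, rfl⟩)
      · have h1 : IsIntegral k c := Algebra.IsIntegral.isIntegral c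
        exact h1.map_of_comp_eq (MvPolynomial.C : k →+* MvPolynomial (Fin d) k) (MvPolynomial.C : k0 →+* MvPolynomial (Fin d) k0) (RingHom.ext fun c => hC c)
      · refine IsIntegral.of_pow hq ?_
        rw [← hX]
        exact isIntegral_algebraMap
    have htop : Algebra.adjoin (MvPolynomial (Fin d) k) S = ⊤ := by
      rw [eq_top_iff]
      rintro z -
      have hCm : ∀ c : k0, (MvPolynomial.C c : MvPolynomial (Fin d) k0) ∈ Algebra.adjoin (MvPolynomial (Fin d) k) S := by
        intro c
        have : c ∈ Submodule.span k (s : Set k0) := by rw [hs]; trivial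
        induction this using Submodule.span_induction with
        | mem y hy => exact Algebra.subset_adjoin (Or.inl ⟨y, hy, rfl⟩)
        | zero => simp
        | add a b _ _ ha hb => rw [map_add]; exact add_mem ha hb
        | smul a b _ hb =>
          rw [Algebra.smul_def, map_mul]
          refine mul_mem ?_ hb
          have := Subalgebra.algebraMap_mem (Algebra.adjoin (MvPolynomial (Fin d) k) S) (MvPolynomial.C a)
          rwa [hC] at this
      induction z using MvPolynomial.induction_on with
      | C c => exact hCm c
      | add a b ha hb => exact add_mem ha hb
      | mul_X a i ha => exact mul_mem ha (Algebra.subset_adjoin (Or.inr ⟨i, rfl⟩))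
    have := Algebra.finite_adjoin_of_finite_of_isIntegral hSf hSi
    rw [htop] at this
    exact Module.Finite.equiv Subalgebra.topEquiv.toLinearEquiv
  exact hfin

lemma exists_sep_poly {A Q K : Type*} [CommRing A] [IsDomain A] [Field Q] [Field K] [Algebra A Q] [IsFractionRing A Q]
    [Algebra A K] [Algebra Q K] [IsScalarTower A Q K] (x : K) (hx : IsSeparable Q x) :
    ∃ f : A[X], (f.map (algebraMap A Q)).Separable ∧ aeval x f = 0 := by
  obtain ⟨b, hb⟩ := IsLocalization.integerNormalization_map_to_map (nonZeroDivisors A) (minpoly Q x)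
  refine ⟨IsLocalization.integerNormalization (nonZeroDivisors A) (minpoly Q x), ?_, ?_⟩
  · rw [hb]
    have hb0 : IsUnit (algebraMap A Q b) := IsUnit.mk0 _ (by
      simpa using (nonZeroDivisors.ne_zero b.2))
    have : ((b : A) • minpoly Q x) = C (algebraMap A Q b) * minpoly Q x := by
      rw [← Polynomial.smul_eq_C_mul, algebraMap_smul]
    rw [this]
    exact Polynomial.Separable.unit_mul (hb0.map C) hx
  · exact IsLocalization.integerNormalization_aeval_eq_zero _ _ (minpoly.aeval _ _)

end LI2

namespace LI2

lemma exists_pow_sep (p : ℕ) {Q K : Type*} [Field Q] [Field K] [Algebra Q K] [ExpChar Q p] [FiniteDimensional Q K] (ι : Type*) [Fintype ι]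
   (ω : ι → K) : ∃ m : ℕ, ∀ i, IsSeparable Q (ω i ^ (p^m)) := by
  have h1 : ∀ i, ∃ m : ℕ, IsSeparable Q (ω i ^ (p^m)) := by
    intro i
    haveI : ExpChar (separableClosure Q K) p := expChar_of_injective_algebraMap (algebraMap Q (separableClosure Q K)).injective p
    obtain ⟨m, y, hy⟩ := IsPurelyInseparable.pow_mem (separableClosure Q K) p (ω i)
    refine ⟨m, ?_⟩
    rw [← hy]
    exact mem_separableClosure_iff.mp y.2
  choose m hm using h1
  refine ⟨∑ i, m i, fun i => ?_⟩
  obtain ⟨c, hc⟩ := Nat.exists_eq_add_of_le (Finset.single_le_sum (fun j _ => Nat.zero_le (m j)) (Finset.mem_univ i))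
  rw [hc, pow_add, pow_mul]
  have := (mem_separableClosure_iff (F := Q)).mpr (hm i)
  exact (mem_separableClosure_iff (F := Q)).mp (pow_mem this _)

lemma exists_lift {k : Type*} [Field k] (p m d : ℕ) [ExpChar k p] {ι : Type*} [Fintype ι] (f : ι → (MvPolynomial (Fin d) k)[X]) :
    ∃ (k0 : Subfield k) (φ : k →+* k0), φ.Finite ∧ (∀ c, ((φ c : k0) : k) = c ^ (p^m)) ∧
      ∀ i, ∃ g : (MvPolynomial (Fin d) k0)[X], g.map (MvPolynomial.map k0.subtype) = f i := by
  classical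
  set k1 : Subfield k := (iterateFrobenius k p m).fieldRange with hk1
  set S : Set k := ⋃ i, ⋃ j ∈ (f i).support, (((f i).coeff j).support.image (fun a => ((f i).coeff j).coeff a) : Finset k) with hS
  have hSf : S.Finite := by
    refine Set.finite_iUnion fun i => Set.Finite.biUnion (Finset.finite_toSet _) fun j _ => Finset.finite_toSet _
  have hInt0 : ∀ c : k, IsIntegral k1 c := by
    intro c
    refine IsIntegral.of_pow (n := p^m) (pow_pos (expChar_pos k p) m) ?_
    have : c ^ p^m = algebraMap k1 k ⟨c ^ p^m, ⟨c, by simp [iterateFrobenius_def]⟩⟩ := rfl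
    rw [this]
    exact isIntegral_algebraMap
  set E : IntermediateField k1 k := IntermediateField.adjoin k1 S with hE
  haveI : Finite S := hSf
  haveI hEf : FiniteDimensional k1 E := IntermediateField.finiteDimensional_adjoin (fun c _ => hInt0 c)
  let φ : k →+* E := (algebraMap k1 E).comp (iterateFrobenius k p m).rangeRestrictField
  refine ⟨E.toSubfield, φ, ?_, ?_, ?_⟩
  · refine RingHom.Finite.comp (g := algebraMap k1 E) ?_ (RingHom.Finite.of_surjective _ ?_)
    · exact hEf
    · rintro ⟨_, c, rfl⟩; exact ⟨c, rfl⟩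
  · intro c; simp [φ]; rfl
  · intro i
    have : f i ∈ Polynomial.lifts (MvPolynomial.map (E.toSubfield.subtype) : MvPolynomial (Fin d) E.toSubfield →+* _) := by
      rw [Polynomial.lifts_iff_coeff_lifts]
      intro j
      have hm := (MvPolynomial.mem_range_map_iff_coeffs_subset (f := E.toSubfield.subtype) (x := (f i).coeff j)).mpr ?_
      · exact hm
      · intro c hc
        rw [Finset.mem_coe, MvPolynomial.mem_coeffs_iff] at hc
        obtain ⟨a, ha, rfl⟩ := hc
        have hj : j ∈ (f i).support := by
          rw [Polynomial.mem_support_iff]; intro h; simp [h] at ha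
        refine ⟨⟨_, IntermediateField.subset_adjoin k1 S ?_⟩, rfl⟩
        simp only [hS, Set.mem_iUnion]
        refine ⟨i, j, hj, ?_⟩
        simp only [Finset.coe_image, Set.mem_image]
        exact ⟨a, ha, rfl⟩
    obtain ⟨g, hg⟩ := (Polynomial.mem_lifts _).mp this
    exact ⟨g, hg⟩

end LI2

namespace LI2

lemma frac_lift {A L : Type*} [CommRing A] [IsDomain A] [Field L] (g : A →+* L) (hg : Function.Injective g) :
    ∃ l : FractionRing A →+* L, l.comp (algebraMap A (FractionRing A)) = g :=
  ⟨IsFractionRing.lift hg, RingHom.ext fun a => by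
    rw [RingHom.comp_apply]; exact IsFractionRing.lift_algebraMap hg a⟩

lemma n2_field {k Q K : Type*} [Field k] (d : ℕ) [Field Q] [Field K] [Algebra (MvPolynomial (Fin d) k) Q]
    [IsFractionRing (MvPolynomial (Fin d) k) Q] [Algebra (MvPolynomial (Fin d) k) K] [Algebra Q K]
    [IsScalarTower (MvPolynomial (Fin d) k) Q K] [FiniteDimensional Q K] :
    IsNoetherian (MvPolynomial (Fin d) k) (integralClosure (MvPolynomial (Fin d) k) K) := by
  classical
  obtain ⟨p, hp⟩ := ExpChar.exists k
  set A := MvPolynomial (Fin d) k with hA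
  haveI : ExpChar A p := expChar_of_injective_algebraMap (R := k) (A := A) (MvPolynomial.C_injective _ _) p
  haveI : ExpChar Q p := expChar_of_injective_algebraMap (R := A) (A := Q) (IsFractionRing.injective A Q) p
  haveI : ExpChar K p := expChar_of_injective_algebraMap (R := Q) (A := K) (algebraMap Q K).injective p
  let ω := Module.finBasis Q K
  obtain ⟨m, hm⟩ := exists_pow_sep p (Q := Q) _ ω
  have h1 := fun i => exists_sep_poly (A := A) (ω i ^ p^m) (hm i)
  choose f hf1 hf2 using h1
  obtain ⟨k0, φ, hφf, hφ, hg⟩ := exists_lift p m d f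
  choose g hg using hg
  set q := p^m with hq
  have hq0 : 0 < q := pow_pos (expChar_pos k p) m
  set A0 := MvPolynomial (Fin d) k0 with hA0
  let Φ : A →+* A0 := MvPolynomial.eval₂Hom (MvPolynomial.C.comp φ) (fun i : Fin d => (MvPolynomial.X i : A0) ^ q)
  have hΦ : Φ.Finite := finite_twist d q hq0 φ hφf
  let j : A0 →+* A := MvPolynomial.map k0.subtype
  have hj : Function.Injective j := MvPolynomial.map_injective _ k0.subtype_injective
  have hAK : Function.Injective (algebraMap A K) := by
    rw [IsScalarTower.algebraMap_eq A Q K]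
    exact (algebraMap Q K).injective.comp (IsFractionRing.injective A Q)
  let ι0 : A0 →+* K := (algebraMap A K).comp j
  have hι0 : Function.Injective ι0 := hAK.comp hj
  letI : Algebra A0 K := ι0.toAlgebra
  haveI : FaithfulSMul A0 K := (faithfulSMul_iff_algebraMap_injective A0 K).mpr hι0
  let Q0 := FractionRing A0
  obtain ⟨lK, hlK⟩ := frac_lift ι0 hι0
  letI : Algebra Q0 K := lK.toAlgebra
  haveI : IsScalarTower A0 Q0 K := IsScalarTower.of_algebraMap_eq fun a => (RingHom.congr_fun hlK a).symm
  have hιQ : Function.Injective ((algebraMap A Q).comp j) := (IsFractionRing.injective A Q).comp hj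
  obtain ⟨l, hl⟩ := frac_lift ((algebraMap A Q).comp j) hιQ
  have hsep : ∀ i, IsSeparable Q0 (ω i ^ q) := by
    intro i
    have hs : ((g i).map (algebraMap A0 Q0)).Separable := by
      rw [← Polynomial.separable_map l, Polynomial.map_map, hl, ← Polynomial.map_map, hg]
      exact hf1 i
    refine hs.of_dvd (minpoly.dvd _ _ ?_)
    rw [Polynomial.aeval_map_algebraMap]
    have := hf2 i
    rw [← hg i, Polynomial.aeval_def, Polynomial.eval₂_map] at this
    exact this
  let K0 : IntermediateField Q0 K := IntermediateField.adjoin Q0 (Set.range fun i => ω i ^ q)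
  haveI : Algebra.IsSeparable Q0 K0 := by
    rw [IntermediateField.isSeparable_adjoin_iff_isSeparable]
    rintro _ ⟨i, rfl⟩; exact hsep i
  haveI : FiniteDimensional Q0 K0 := IntermediateField.finiteDimensional_adjoin (by
    rintro _ ⟨i, rfl⟩; exact (hsep i).isIntegral)
  haveI : IsScalarTower A0 K0 K := IsScalarTower.of_algebraMap_eq fun a => by first | rfl | (trace_state; exact (by infer_instance : IsScalarTower A0 K0 K).algebraMap_apply a)
  let B0 := integralClosure A0 K0
  haveI hB0 : IsNoetherian A0 B0 := IsIntegralClosure.isNoetherian A0 Q0 K0 B0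
  let F : K →+* K := iterateFrobenius K p m
  have hF : ∀ z, F z = z ^ q := fun z => by simp [F, iterateFrobenius_def, hq]
  have hcomp : ι0.comp Φ = F.comp (algebraMap A K) := by
    apply MvPolynomial.ringHom_ext
    · intro c
      have e1 : Φ (MvPolynomial.C c) = MvPolynomial.C (φ c) := MvPolynomial.eval₂_C _ _ _
      have e2 : j (MvPolynomial.C (φ c)) = MvPolynomial.C (c ^ q) := by
        rw [← hφ c]; exact MvPolynomial.map_C _ _
      show algebraMap A K (j (Φ (MvPolynomial.C c))) = F (algebraMap A K (MvPolynomial.C c))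
      rw [e1, e2, hF, ← map_pow, ← map_pow]
    · intro i
      have e1 : Φ (MvPolynomial.X i) = (MvPolynomial.X i) ^ q := MvPolynomial.eval₂_X _ _ _
      have e2 : j (MvPolynomial.X i) = MvPolynomial.X i := MvPolynomial.map_X _ _
      show algebraMap A K (j (Φ (MvPolynomial.X i))) = F (algebraMap A K (MvPolynomial.X i))
      rw [e1, hF, map_pow, map_pow, e2]
  have hK0A : ∀ a : A, (algebraMap A K a) ^ q ∈ K0 := by
    intro a
    have : (algebraMap A K a) ^ q = algebraMap Q0 K (algebraMap A0 Q0 (Φ a)) := by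
      rw [← IsScalarTower.algebraMap_apply A0 Q0 K, ← hF]
      exact (RingHom.congr_fun hcomp a).symm
    rw [this]; exact K0.algebraMap_mem _
  have hK0Q : ∀ c : Q, (algebraMap Q K c) ^ q ∈ K0 := by
    intro c
    obtain ⟨a, s, hs, rfl⟩ := IsFractionRing.div_surjective (A := A) c
    rw [map_div₀, ← IsScalarTower.algebraMap_apply, ← IsScalarTower.algebraMap_apply, div_pow]
    exact div_mem (hK0A a) (hK0A s)
  have hK0 : ∀ b : K, F b ∈ K0 := by
    intro b
    rw [← ω.sum_repr b, map_sum]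
    refine sum_mem fun i _ => ?_
    rw [hF, Algebra.smul_def, mul_pow]
    exact mul_mem (hK0Q _) (IntermediateField.subset_adjoin _ _ ⟨i, rfl⟩)
  have hInt0 : ∀ b : integralClosure A K, (⟨F b, hK0 b⟩ : K0) ∈ B0 := by
    intro b
    have h2 : IsIntegral A0 (F b) := IsIntegral.map_of_comp_eq Φ F (by rw [← hcomp]; rfl) b.2
    exact (isIntegral_algebraMap_iff (R := A0) (A := K0) (B := K) (algebraMap K0 K).injective).mp h2
  letI : Algebra A A0 := Φ.toAlgebra
  letI : Module A B0 := Module.compHom B0 Φ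
  haveI : IsScalarTower A A0 B0 := ⟨fun a b c => by
    show (Φ a * b) • c = Φ a • (b • c)
    rw [mul_smul]⟩
  haveI : Module.Finite A A0 := hΦ
  haveI : Module.Finite A0 B0 := inferInstance
  haveI : Module.Finite A B0 := Module.Finite.trans A0 B0
  haveI : IsNoetherian A B0 := isNoetherian_of_isNoetherianRing_of_finite A B0
  let ψ : integralClosure A K →ₗ[A] B0 :=
    { toFun := fun b => ⟨⟨F b, hK0 b⟩, hInt0 b⟩
      map_add' := fun b c => by
        apply Subtype.ext; apply Subtype.ext
        simp [map_add]
      map_smul' := fun a b => by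
        apply Subtype.ext; apply Subtype.ext
        show F (a • (b : K)) = ((((Φ a) • (⟨⟨F b, hK0 b⟩, hInt0 b⟩ : B0) : B0) : K0) : K)
        rw [Algebra.smul_def, map_mul]
        have : F (algebraMap A K a) = algebraMap A0 K (Φ a) := (RingHom.congr_fun hcomp a).symm
        rw [this, ← Algebra.smul_def]
        rfl }
  refine isNoetherian_of_injective ψ ?_
  intro b c hbc
  have : F b = F c := congrArg (fun z : B0 => ((z : K0) : K)) hbc
  exact Subtype.ext (F.injective this)

end LI2

namespace LI2

lemma fd_of_homog {A Q H HQ : Type*} [CommRing A] [IsDomain A] [Field Q] [CommRing H] [CommRing HQ] [Algebra A Q] [IsFractionRing A Q]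
    [Algebra A H] [Algebra A HQ] [Algebra H HQ] [Algebra Q HQ] [IsScalarTower A H HQ] [IsScalarTower A Q HQ]
    (hinj : Function.Injective (algebraMap H HQ)) (hsur : ∀ z : HQ, ∃ (a : A) (h : H), a ≠ 0 ∧ algebraMap A HQ a * z = algebraMap H HQ h)
    (T : Set H) (hT : Submodule.span A T = ⊤) (L : ℕ)
    (hL : ∀ s : Finset H, ↑s ⊆ T → LinearIndepOn A id (s : Set H) → s.card ≤ L) : FiniteDimensional Q HQ := by
  classical
  let f : H →ₗ[A] HQ := (IsScalarTower.toAlgHom A H HQ).toLinearMap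
  have hf : ∀ h, f h = algebraMap H HQ h := fun h => rfl
  have hspan : Submodule.span Q (f '' T) = ⊤ := by
    rw [eq_top_iff]
    intro z _
    obtain ⟨a, h, ha, hz⟩ := hsur z
    have h1 : f h ∈ Submodule.span Q (f '' T) := by
      have : h ∈ Submodule.span A T := by rw [hT]; trivial
      have h2 : f h ∈ Submodule.map f (Submodule.span A T) := Submodule.mem_map_of_mem this
      rw [Submodule.map_span] at h2
      exact Submodule.span_le_restrictScalars A Q _ h2
    have ha' : algebraMap A Q a ≠ 0 := by
      simpa using ha
    have : z = (algebraMap A Q a)⁻¹ • f h := by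
      rw [hf, ← hz, ← Algebra.smul_def a, ← IsScalarTower.algebraMap_smul Q a z, smul_smul,
        inv_mul_cancel₀ ha', one_smul]
    rw [this]
    exact Submodule.smul_mem _ _ h1
  obtain ⟨b, hb, hbs, hbl⟩ := exists_linearIndependent Q (f '' T)
  have hbf : b.Finite := by
    by_contra hinf
    obtain ⟨s, hs, hcard⟩ := Set.Infinite.exists_subset_card_eq (show b.Infinite from hinf) (L+1)
    obtain ⟨t, ht, hts⟩ := Finset.subset_set_image_iff.mp (hs.trans hb : (s : Set HQ) ⊆ f '' T)
    have hli : LinearIndepOn Q id (s : Set HQ) := LinearIndepOn.mono (show LinearIndepOn Q id b from hbl) hs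
    have hli' : LinearIndepOn A id (s : Set HQ) := by
      have := LinearIndependent.restrict_scalars' (R := A) (hli : LinearIndependent Q _)
      exact this
    have hli2 : LinearIndepOn A id (t : Set H) := by
      rw [← hts, Finset.coe_image] at hli'
      have h3 : LinearIndepOn A f (t : Set H) := by
        exact (linearIndepOn_iff_image (f := f) (hinj.injOn)).mpr hli'
      exact LinearIndependent.of_comp f h3
    have h4 := hL t ht hli2
    have h5 : s.card = t.card := by rw [← hts]; exact Finset.card_image_of_injective _ hinj
    omega
  refine ⟨⟨hbf.toFinset, ?_⟩⟩
  rw [Set.Finite.coe_toFinset, hbs, hspan]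

lemma n2_alg {k H : Type*} [Field k] (d : ℕ) [CommRing H] [IsReduced H] [Algebra (MvPolynomial (Fin d) k) H]
    (htf : ∀ (a : MvPolynomial (Fin d) k) (h : H), a ≠ 0 → algebraMap _ H a * h = 0 → h = 0)
    (hInt0 : Algebra.IsIntegral (MvPolynomial (Fin d) k) H)
    (T : Set H) (hT : Submodule.span (MvPolynomial (Fin d) k) T = ⊤) (L : ℕ)
    (hL : ∀ s : Finset H, ↑s ⊆ T → LinearIndepOn (MvPolynomial (Fin d) k) id (s : Set H) → s.card ≤ L) :
    Module.Finite (MvPolynomial (Fin d) k) H := by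
  classical
  let A := MvPolynomial (Fin d) k
  let S := Algebra.algebraMapSubmonoid H (nonZeroDivisors A)
  let Q := FractionRing A
  let HQ := Localization S
  have hS : S ≤ nonZeroDivisors H := by
    rintro _ ⟨a, ha, rfl⟩
    rw [mem_nonZeroDivisors_iff_right]
    intro h hh
    exact htf a h (nonZeroDivisors.ne_zero ha) (by rw [mul_comm]; exact hh)
  have hinj : Function.Injective (algebraMap H HQ) := IsLocalization.injective HQ hS
  haveI : FiniteDimensional Q HQ := by
    refine fd_of_homog (A := A) hinj ?_ T hT L hL
    intro z
    obtain ⟨⟨h, ⟨_, a, ha, rfl⟩⟩, hz⟩ := IsLocalization.surj S z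
    refine ⟨a, h, nonZeroDivisors.ne_zero ha, ?_⟩
    rw [IsScalarTower.algebraMap_apply A H HQ, mul_comm]
    exact hz
  haveI : IsArtinianRing HQ := IsArtinianRing.of_finite Q HQ
  have hN : ∀ M : MaximalSpectrum HQ, IsNoetherian A (integralClosure A (HQ ⧸ M.asIdeal)) := by
    intro M
    letI := Ideal.Quotient.field M.asIdeal
    exact n2_field (Q := Q) d
  let f : H →ₗ[A] ((M : MaximalSpectrum HQ) → integralClosure A (HQ ⧸ M.asIdeal)) :=
    LinearMap.pi fun M => LinearMap.codRestrict (Subalgebra.toSubmodule (integralClosure A (HQ ⧸ M.asIdeal)))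
      (((Ideal.Quotient.mkₐ A M.asIdeal).comp (IsScalarTower.toAlgHom A H HQ)).toLinearMap) (fun h => by
        exact (hInt0.isIntegral h).map ((Ideal.Quotient.mkₐ A M.asIdeal).comp (IsScalarTower.toAlgHom A H HQ)))
  haveI : IsNoetherian A H := by
    refine isNoetherian_of_injective f ?_
    intro x y hxy
    apply hinj
    apply (IsArtinianRing.equivPi HQ).injective
    funext M
    have := congrFun hxy M
    exact congrArg Subtype.val this
  exact inferInstanceAs (Module.Finite A H)

end LI2

namespace LI2

section KF
variable [CommRing R]

/-- left-continuous version of `Fr`. -/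
def Kf (J : Ideal R) (r : ℝ) : Ideal R := ⨅ ε : {e : ℝ // 0 < e}, Fr J (r - ε)

/-- right limit of `Fr`. -/
def Kg (J : Ideal R) (r : ℝ) : Ideal R where
  carrier := {y | ∃ ε > 0, y ∈ Fr J (r + ε)}
  zero_mem' := ⟨1, one_pos, zero_mem _⟩
  add_mem' := by
    rintro y z ⟨a, ha, hy⟩ ⟨b, hb, hz⟩
    refine ⟨min a b, lt_min ha hb, add_mem (Fr_anti (by have := min_le_left a b; linarith) hy)
      (Fr_anti (by have := min_le_right a b; linarith) hz)⟩
  smul_mem' := by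
    rintro a y ⟨b, hb, hy⟩
    exact ⟨b, hb, Ideal.mul_mem_left _ _ hy⟩

variable {J : Ideal R}

lemma mem_Kf {r : ℝ} {y : R} : y ∈ Kf J r ↔ ∀ ε > 0, y ∈ Fr J (r - ε) := by
  simp [Kf, Ideal.mem_iInf]

lemma mem_Kg {r : ℝ} {y : R} : y ∈ Kg J r ↔ ∃ ε > 0, y ∈ Fr J (r + ε) := Iff.rfl

lemma Fr_le_Kf (r : ℝ) : Fr J r ≤ Kf J r := fun y hy =>
  mem_Kf.mpr fun ε hε => Fr_anti (by linarith) hy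

lemma Kg_le_Fr (r : ℝ) : Kg J r ≤ Fr J r := by
  rintro y ⟨ε, hε, hy⟩
  exact Fr_anti (by linarith) hy

lemma Kf_le_Kg {r s : ℝ} (h : r < s) : Kf J s ≤ Kg J r := fun y hy =>
  ⟨(s - r)/2, by linarith, Fr_anti (by linarith) (mem_Kf.mp hy ((s-r)/2) (by linarith))⟩

lemma Kf_anti {r s : ℝ} (h : r ≤ s) : Kf J s ≤ Kf J r := fun y hy =>
  mem_Kf.mpr fun ε hε => Fr_anti (by linarith) (mem_Kf.mp hy ε hε)

lemma Kf_mul {r s : ℝ} {y z : R} (hy : y ∈ Kf J r) (hz : z ∈ Kf J s) : y * z ∈ Kf J (r + s) := by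
  rw [mem_Kf] at *
  intro ε hε
  have := Fr_mul (hy (ε/2) (by linarith)) (hz (ε/2) (by linarith))
  convert this using 1; ring_nf

lemma KfKg_mul {r s : ℝ} {y z : R} (hy : y ∈ Kf J r) (hz : z ∈ Kg J s) : y * z ∈ Kg J (r + s) := by
  obtain ⟨ε, hε, hz⟩ := hz
  refine ⟨ε/2, by linarith, ?_⟩
  have := Fr_mul (mem_Kf.mp hy (ε/2) (by linarith)) hz
  convert this using 1; ring_nf

lemma Fr_root {a : ℝ} (ha : 0 ≤ a) (n : ℕ) (hn : 0 < n) {y : R} (hy : y ^ n ∈ Fr J (n * a)) : y ∈ Fr J a := by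
  obtain ⟨c, hc0, hc⟩ := mem_pow_of_mem_Fr hy
  refine mem_Fr_of_lb (c + n * a) fun s t ht => ?_
  have h1 : n * (s / n) + s % n = s := Nat.div_add_mod s n
  have h2 : s % n < n := Nat.mod_lt _ hn
  rw [← h1, pow_add, pow_mul]
  refine Ideal.mul_mem_right _ _ (hc _ _ ?_)
  have h3 : ((n * (s/n) + s % n : ℕ) : ℝ) = s := by exact_mod_cast h1
  have h4 : ((s % n : ℕ) : ℝ) ≤ n := by exact_mod_cast h2.le
  push_cast at h3
  nlinarith

lemma Kg_root {a : ℝ} (ha : 0 ≤ a) (n : ℕ) (hn : 0 < n) {y : R} (hy : y ^ n ∈ Kg J (n * a)) : y ∈ Kg J a := by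
  obtain ⟨ε, hε, hy⟩ := hy
  have hn' : (0:ℝ) < n := by exact_mod_cast hn
  refine ⟨ε / n, by positivity, Fr_root (by positivity) n hn ?_⟩
  convert hy using 2
  field_simp

lemma Kf_nonpos {r : ℝ} (h : r ≤ 0) : Kf J r = ⊤ := by
  rw [eq_top_iff, ← Fr_nonpos (J := J) h]; exact Fr_le_Kf r

lemma Kg_neg {r : ℝ} (h : r < 0) : Kg J r = ⊤ := by
  rw [eq_top_iff, ← Kf_nonpos (J := J) (le_refl 0)]; exact Kf_le_Kg h

lemma pow_le_Kf (n : ℕ) : J ^ n ≤ Kf J n := (pow_le_Fr n).trans (Fr_le_Kf _)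

lemma le_Kg_zero [IsLocalRing R] (N : ℕ) (hN : maximalIdeal R ^ N ≤ J) : maximalIdeal R ≤ Kg J 0 := by
  intro y hy
  have h : y ^ (N+1) ∈ Fr J 1 := le_Fr_one (hN (Ideal.pow_le_pow_right (Nat.le_succ N) (Ideal.pow_mem_pow hy _)))
  have h2 : y ∈ Fr J (1/(N+1:ℝ)) := by
    refine Fr_root (by positivity) (N+1) (Nat.succ_pos _) ?_
    convert h using 2
    push_cast; field_simp
  exact ⟨1/(N+1:ℝ), by positivity, by simpa using h2⟩

lemma one_notMem_Kg (hJ : J ≠ ⊤) : (1:R) ∉ Kg J 0 := by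
  rintro ⟨ε, hε, h⟩
  obtain ⟨c, _, hc⟩ := mem_pow_of_mem_Fr h
  obtain ⟨s, hs⟩ := exists_nat_gt ((1 + c)/ε)
  have := hc s 1 (by
    rw [div_lt_iff₀ hε] at hs
    push_cast; nlinarith)
  rw [one_pow, pow_one] at this
  exact hJ ((Ideal.eq_top_iff_one _).mpr this)

lemma Kg_colon {d : ℕ} (x : Fin d → R) (hq : QR x) (e : ℕ) (Ω : MvPolynomial (Fin d) R) (hΩ : Ω.IsHomogeneous e)
    (m : Fin d →₀ ℕ) (hm : IsUnit (Ω.coeff m)) (r : ℝ) (y : R)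
    (hy : MvPolynomial.eval x Ω * y ∈ Kg (gen x) (e + r)) : y ∈ Kg (gen x) r := by
  obtain ⟨ε, hε, hy⟩ := hy
  exact ⟨ε, hε, Fr_colon x hq e Ω hΩ m hm _ y (by convert hy using 2; ring)⟩

/-- the abstract properties of the pair of filtrations. -/
structure GF [IsLocalRing R] {d : ℕ} (x : Fin d → R) (K K' : ℝ → Ideal R) : Prop where
  mul : ∀ {r s : ℝ} {y z : R}, y ∈ K r → z ∈ K s → y * z ∈ K (r + s)
  mul' : ∀ {r s : ℝ} {y z : R}, y ∈ K r → z ∈ K' s → y * z ∈ K' (r + s)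
  le : ∀ r, K' r ≤ K r
  lt : ∀ {r s : ℝ}, r < s → K s ≤ K' r
  sq : ∀ (r : ℝ) (y : R), y * y ∈ K' (r + r) → y ∈ K' r
  neg : ∀ r < 0, K' r = ⊤
  zero : K 0 = ⊤
  max : maximalIdeal R ≤ K' 0
  one : (1:R) ∉ K' 0
  pow : ∀ n : ℕ, gen x ^ n ≤ K n
  colon : ∀ (e : ℕ) (Ω : MvPolynomial (Fin d) R), Ω.IsHomogeneous e → ∀ m : Fin d →₀ ℕ, IsUnit (Ω.coeff m) →
    ∀ (r : ℝ) (y : R), MvPolynomial.eval x Ω * y ∈ K' (e + r) → y ∈ K' r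

lemma gf_fr [IsLocalRing R] {d : ℕ} (x : Fin d → R) (hq : QR x) (hJ : gen x ≤ maximalIdeal R) (N : ℕ) (hN : maximalIdeal R ^ N ≤ gen x) :
    GF x (Kf (gen x)) (Kg (gen x)) where
  mul := Kf_mul
  mul' := KfKg_mul
  le := fun r => (Kg_le_Fr r).trans (Fr_le_Kf r)
  lt := Kf_le_Kg
  sq := fun r y h => by
    rcases lt_or_ge r 0 with hr | hr
    · rw [Kg_neg hr]; trivial
    · refine Kg_root hr 2 two_pos ?_
      rw [pow_two]; convert h using 2; push_cast; ring
  neg := fun r hr => Kg_neg hr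
  zero := Kf_nonpos le_rfl
  max := le_Kg_zero N hN
  one := one_notMem_Kg (fun h => Ideal.IsPrime.ne_top (IsLocalRing.maximalIdeal.isMaximal R).isPrime (top_le_iff.mp (h ▸ hJ)))
  pow := pow_le_Kf
  colon := fun e Ω hΩ m hm r y h => Kg_colon x hq e Ω hΩ m hm r y h

end KF
end LI2

namespace LI2

section HR
variable [CommRing R] [IsLocalRing R] {d : ℕ} {x : Fin d → R} {K K' : ℝ → Ideal R}

lemma coeff_mul_sum (p q : AddMonoidAlgebra R ℝ) (t : ℝ) :
    (p * q).coeff t = ∑ r ∈ p.coeff.support, p.coeff r * q.coeff (-r + t) := by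
  rw [AddMonoidAlgebra.coeff_mul_apply_left]; rfl

/-- the extended Rees-like ring -/
def Gs (h : GF x K K') : Subring (AddMonoidAlgebra R ℝ) where
  carrier := {p | ∀ r, p.coeff r ∈ K r}
  mul_mem' := by
    intro p q hp hq t
    rw [coeff_mul_sum]
    refine sum_mem fun r _ => ?_
    have := h.mul (hp r) (hq (-r + t))
    rwa [show r + (-r + t) = t by ring] at this
  one_mem' := by
    intro r
    rw [AddMonoidAlgebra.one_def, AddMonoidAlgebra.coeff_single]
    by_cases hr : r = 0
    · subst hr; rw [h.zero]; trivial
    · rw [Finsupp.single_apply, if_neg (Ne.symm hr)]; exact zero_mem _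
  add_mem' := fun hp hq r => add_mem (hp r) (hq r)
  zero_mem' := fun r => zero_mem _
  neg_mem' := fun {p} hp r => by
    have : (-p).coeff r = -(p.coeff r) := rfl
    rw [this]
    exact neg_mem (hp r)

/-- the ideal of elements vanishing in the associated graded ring -/
def Ng (h : GF x K K') : Ideal (Gs h) where
  carrier := {p | ∀ r, (p : AddMonoidAlgebra R ℝ).coeff r ∈ K' r}
  add_mem' := fun hp hq r => add_mem (hp r) (hq r)
  zero_mem' := fun r => zero_mem _
  smul_mem' := by
    intro p q hq t
    show ((p : AddMonoidAlgebra R ℝ) * (q : AddMonoidAlgebra R ℝ)).coeff t ∈ K' t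
    rw [coeff_mul_sum]
    refine sum_mem fun r _ => ?_
    have := h.mul' (p.2 r) (hq (-r + t))
    rwa [show r + (-r + t) = t by ring] at this

/-- the associated graded ring -/
abbrev Hr (h : GF x K K') := Gs h ⧸ Ng h

lemma single_mem (h : GF x K K') {r : ℝ} {y : R} (hy : y ∈ K r) : AddMonoidAlgebra.single r y ∈ Gs h := by
  intro s
  rw [AddMonoidAlgebra.coeff_single, Finsupp.single_apply]
  split_ifs with hs
  · exact hs ▸ hy
  · exact zero_mem _

/-- homogeneous elements -/
noncomputable def el (h : GF x K K') (r : ℝ) (y : R) (hy : y ∈ K r) : Hr h := Ideal.Quotient.mk _ ⟨AddMonoidAlgebra.single r y, single_mem h hy⟩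

lemma mk_eq_zero (h : GF x K K') (p : Gs h) : (Ideal.Quotient.mk (Ng h) p) = 0 ↔ ∀ r, (p : AddMonoidAlgebra R ℝ).coeff r ∈ K' r := by
  rw [Ideal.Quotient.eq_zero_iff_mem]; rfl

lemma el_eq_zero (h : GF x K K') (r : ℝ) (y : R) (hy : y ∈ K r) : el h r y hy = 0 ↔ y ∈ K' r := by
  rw [el, mk_eq_zero]
  constructor
  · intro H; simpa using H r
  · intro H s
    simp only [AddMonoidAlgebra.coeff_single, Finsupp.single_apply]
    split_ifs with hs
    · exact hs ▸ H
    · exact zero_mem _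

lemma el_mul (h : GF x K K') (r s : ℝ) (y z : R) (hy : y ∈ K r) (hz : z ∈ K s) :
    el h r y hy * el h s z hz = el h (r + s) (y * z) (h.mul hy hz) := by
  rw [el, el, el, ← map_mul]
  congr 1
  apply Subtype.ext
  exact AddMonoidAlgebra.single_mul_single ..

lemma el_add (h : GF x K K') (r : ℝ) (y z : R) (hy : y ∈ K r) (hz : z ∈ K r) :
    el h r y hy + el h r z hz = el h r (y + z) (add_mem hy hz) := by
  rw [el, el, el, ← map_add]
  congr 1
  apply Subtype.ext
  exact (AddMonoidAlgebra.single_add ..).symm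

lemma el_congr (h : GF x K K') {r s : ℝ} {y z : R} (hrs : r = s) (hyz : y = z) (hy : y ∈ K r) (hz : z ∈ K s) :
    el h r y hy = el h s z hz := by subst hrs; subst hyz; rfl

lemma pow_mem_K (h : GF x K K') {r : ℝ} {y : R} (hy : y ∈ K r) (n : ℕ) : y ^ n ∈ K (n * r) := by
  induction n with
  | zero => simp [h.zero]
  | succ n ih =>
    have := h.mul ih hy
    rw [pow_succ]; convert this using 2; push_cast; ring

lemma el_pow (h : GF x K K') (r : ℝ) (y : R) (hy : y ∈ K r) (n : ℕ) :
    el h r y hy ^ n = el h (n * r) (y ^ n) (pow_mem_K h hy n) := by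
  rw [el, el, ← map_pow]
  congr 1
  apply Subtype.ext
  have := AddMonoidAlgebra.single_pow (R := R) (m := r) (r := y) n
  rw [nsmul_eq_mul] at this
  exact this

/-- constants -/
noncomputable def cst (h : GF x K K') : R →+* Gs h :=
  (AddMonoidAlgebra.singleZeroRingHom (R := R) (M := ℝ)).codRestrict (Gs h) (fun c => single_mem h (by rw [h.zero]; trivial))

/-- lifted structure map -/
noncomputable def bet (h : GF x K K') : MvPolynomial (Fin d) R →+* Gs h :=
  MvPolynomial.eval₂Hom (cst h) (fun i => ⟨AddMonoidAlgebra.single 1 (x i), single_mem h (by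
    have := h.pow 1 (by rw [pow_one]; exact x_mem x i); simpa using this)⟩)

noncomputable def resH (h : GF x K K') : ResidueField R →+* Hr h :=
  Ideal.Quotient.lift (maximalIdeal R) ((Ideal.Quotient.mk (Ng h)).comp (cst h)) (by
    intro c hc
    exact (el_eq_zero h 0 c (by rw [h.zero]; trivial)).mpr (h.max hc))

noncomputable def alg (h : GF x K K') : MvPolynomial (Fin d) (ResidueField R) →+* Hr h :=
  MvPolynomial.eval₂Hom (resH h) (fun i => Ideal.Quotient.mk (Ng h) (bet h (MvPolynomial.X i)))

lemma alg_map (h : GF x K K') (Ω : MvPolynomial (Fin d) R) :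
    alg h (MvPolynomial.map (residue R) Ω) = Ideal.Quotient.mk (Ng h) (bet h Ω) := by
  have : (alg h).comp (MvPolynomial.map (residue R)) = (Ideal.Quotient.mk (Ng h)).comp (bet h) := by
    apply MvPolynomial.ringHom_ext
    · intro c
      simp only [RingHom.comp_apply, MvPolynomial.map_C, alg, bet, MvPolynomial.coe_eval₂Hom, MvPolynomial.eval₂_C]
      exact Ideal.Quotient.lift_mk _ _ _
    · intro i
      simp only [RingHom.comp_apply, MvPolynomial.map_X, alg, MvPolynomial.coe_eval₂Hom, MvPolynomial.eval₂_X]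
  exact RingHom.congr_fun this Ω

lemma bet_monomial (h : GF x K K') (m : Fin d →₀ ℕ) (c : R) :
    (bet h (MvPolynomial.monomial m c) : AddMonoidAlgebra R ℝ) = AddMonoidAlgebra.single (m.degree : ℝ) (c * ∏ i, x i ^ m i) := by
  have h1 : ∀ (s : Finset (Fin d)), (∏ i ∈ s, (AddMonoidAlgebra.single (1:ℝ) (x i)) ^ m i : AddMonoidAlgebra R ℝ)
      = AddMonoidAlgebra.single ((∑ i ∈ s, m i : ℕ) : ℝ) (∏ i ∈ s, x i ^ m i) := by
    classical
    intro s
    induction s using Finset.induction_on with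
    | empty => simp [AddMonoidAlgebra.one_def]
    | insert i s hi ih =>
      rw [Finset.prod_insert hi, ih, AddMonoidAlgebra.single_pow, AddMonoidAlgebra.single_mul_single, Finset.prod_insert hi,
        Finset.sum_insert hi]
      simp
  rw [bet, MvPolynomial.coe_eval₂Hom, MvPolynomial.eval₂_monomial, Finsupp.prod_fintype _ _ (by simp)]
  push_cast
  rw [h1]
  have h2 : ((cst h c : Gs h) : AddMonoidAlgebra R ℝ) = AddMonoidAlgebra.single 0 c := rfl
  rw [h2, AddMonoidAlgebra.single_mul_single, zero_add, Finsupp.degree_eq_sum]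

lemma bet_eq (h : GF x K K') (Ω : MvPolynomial (Fin d) R) :
    (bet h Ω : AddMonoidAlgebra R ℝ) = ∑ m ∈ Ω.support, AddMonoidAlgebra.single (m.degree : ℝ) (Ω.coeff m * ∏ i, x i ^ m i) := by
  conv_lhs => rw [Ω.as_sum, map_sum]
  push_cast
  exact Finset.sum_congr rfl fun m _ => bet_monomial h m _

lemma bet_coeff (h : GF x K K') (Ω : MvPolynomial (Fin d) R) (e : ℕ) :
    (bet h Ω : AddMonoidAlgebra R ℝ).coeff (e:ℝ) = MvPolynomial.eval x (MvPolynomial.homogeneousComponent e Ω) := by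
  classical
  rw [bet_eq, AddMonoidAlgebra.coeff_sum, Finsupp.finset_sum_apply, MvPolynomial.homogeneousComponent_apply, map_sum, Finset.sum_filter]
  refine Finset.sum_congr rfl fun m _ => ?_
  rw [AddMonoidAlgebra.coeff_single, Finsupp.single_apply]
  simp only [Nat.cast_inj]
  split_ifs with hm
  · simp [MvPolynomial.eval_monomial, Finsupp.prod_fintype]
  · rfl

lemma bet_coeff_zero (h : GF x K K') (Ω : MvPolynomial (Fin d) R) (s : ℝ) (hs : ∀ e : ℕ, (e:ℝ) ≠ s) :
    (bet h Ω : AddMonoidAlgebra R ℝ).coeff s = 0 := by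
  classical
  rw [bet_eq, AddMonoidAlgebra.coeff_sum, Finsupp.finset_sum_apply]
  refine Finset.sum_eq_zero fun m _ => ?_
  rw [AddMonoidAlgebra.coeff_single, Finsupp.single_apply, if_neg (hs _)]

lemma alg_hom (h : GF x K K') (Ω : MvPolynomial (Fin d) R) (e : ℕ) (hΩ : Ω.IsHomogeneous e) :
    alg h (MvPolynomial.map (residue R) Ω) = el h e (MvPolynomial.eval x Ω) (h.pow e (eval_mem_pow x e Ω hΩ)) := by
  rw [alg_map, el]
  congr 1
  apply Subtype.ext
  apply AddMonoidAlgebra.coeff_injective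
  ext s
  rw [AddMonoidAlgebra.coeff_single, Finsupp.single_apply]
  split_ifs with hs
  · rw [← hs, bet_coeff, MvPolynomial.homogeneousComponent_of_mem ((MvPolynomial.mem_homogeneousSubmodule _ _).mpr hΩ), if_pos rfl]
  · by_cases he : ∃ e' : ℕ, (e':ℝ) = s
    · obtain ⟨e', rfl⟩ := he
      rw [bet_coeff, MvPolynomial.homogeneousComponent_of_mem ((MvPolynomial.mem_homogeneousSubmodule _ _).mpr hΩ), if_neg, map_zero]
      rintro rfl; exact hs rfl
    · exact bet_coeff_zero h Ω s (by simpa using he)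

/-- top coefficients multiply -/
lemma top_mul (h : GF x K K') (p q : AddMonoidAlgebra R ℝ) (hp : p ∈ Gs h) (hq : q ∈ Gs h) (r0 s0 : ℝ)
    (hp' : ∀ r, r0 < r → p.coeff r ∈ K' r) (hq' : ∀ s, s0 < s → q.coeff s ∈ K' s) :
    (p * q).coeff (r0 + s0) - p.coeff r0 * q.coeff s0 ∈ K' (r0 + s0) := by
  classical
  have key : ∀ r, r ≠ r0 → p.coeff r * q.coeff (-r + (r0 + s0)) ∈ K' (r0 + s0) := by
    intro r hr
    rcases lt_or_gt_of_ne hr with hr | hr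
    · have := h.mul' (hp r) (hq' (-r + (r0 + s0)) (by linarith))
      rwa [show r + (-r + (r0 + s0)) = r0 + s0 by ring] at this
    · have := h.mul' (hq (-r + (r0 + s0))) (hp' r hr)
      rwa [show (-r + (r0 + s0)) + r = r0 + s0 by ring, mul_comm] at this
  rw [coeff_mul_sum]
  by_cases h0 : r0 ∈ p.coeff.support
  · rw [← Finset.add_sum_erase _ _ h0, show -r0 + (r0 + s0) = s0 by ring, add_sub_cancel_left]
    exact sum_mem fun r hr => key r (Finset.ne_of_mem_erase hr)
  · have : p.coeff r0 = 0 := by simpa using h0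
    rw [this, zero_mul, sub_zero]
    exact sum_mem fun r hr => key r (fun hr0 => h0 (hr0 ▸ hr))

lemma exists_top (h : GF x K K') (p : Gs h) (hp : Ideal.Quotient.mk (Ng h) p ≠ 0) :
    ∃ r0, (p : AddMonoidAlgebra R ℝ).coeff r0 ∉ K' r0 ∧ ∀ r, r0 < r → (p : AddMonoidAlgebra R ℝ).coeff r ∈ K' r := by
  classical
  rw [Ne, mk_eq_zero] at hp
  push Not at hp
  obtain ⟨r1, hr1⟩ := hp
  set S := (p : AddMonoidAlgebra R ℝ).coeff.support.filter (fun r => (p : AddMonoidAlgebra R ℝ).coeff r ∉ K' r) with hS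
  have hmem : ∀ r, (p : AddMonoidAlgebra R ℝ).coeff r ∉ K' r → r ∈ S := by
    intro r hr
    rw [hS, Finset.mem_filter, Finsupp.mem_support_iff]
    exact ⟨fun h0 => hr (h0 ▸ zero_mem _), hr⟩
  have hne : S.Nonempty := ⟨r1, hmem r1 hr1⟩
  refine ⟨S.max' hne, (Finset.mem_filter.mp (S.max'_mem hne)).2, fun r hr => ?_⟩
  by_contra hc
  exact absurd (S.le_max' r (hmem r hc)) (not_le.mpr hr)

lemma Hr_reduced (h : GF x K K') : IsReduced (Hr h) := by
  rw [isReduced_iff_pow_one_lt 2 one_lt_two]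
  intro z hz
  obtain ⟨p, rfl⟩ := Ideal.Quotient.mk_surjective z
  by_contra hne
  obtain ⟨r0, h1, h2⟩ := exists_top h p hne
  have h3 := top_mul h p p p.2 p.2 r0 r0 h2 h2
  rw [pow_two, ← map_mul, mk_eq_zero] at hz
  have h4 : ((p : AddMonoidAlgebra R ℝ) * (p : AddMonoidAlgebra R ℝ)).coeff (r0 + r0) ∈ K' (r0 + r0) := hz (r0 + r0)
  apply h1
  apply h.sq
  have := sub_mem h4 h3
  rwa [sub_sub_cancel] at this

lemma map_comp_hom (Ω : MvPolynomial (Fin d) R) (e : ℕ) :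
    MvPolynomial.map (residue R) (MvPolynomial.homogeneousComponent e Ω) = MvPolynomial.homogeneousComponent e (MvPolynomial.map (residue R) Ω) := by
  classical
  ext m
  rw [MvPolynomial.coeff_map, MvPolynomial.coeff_homogeneousComponent, MvPolynomial.coeff_homogeneousComponent, MvPolynomial.coeff_map]
  split_ifs
  · rfl
  · simp

lemma exists_lift_mv (a : MvPolynomial (Fin d) (ResidueField R)) : ∃ Ω : MvPolynomial (Fin d) R, MvPolynomial.map (residue R) Ω = a :=
  MvPolynomial.map_surjective _ residue_surjective a

lemma isUnit_of_res {c : R} (hc : residue R c ≠ 0) : IsUnit c := by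
  by_contra h
  exact hc ((residue_eq_zero_iff c).mpr ((mem_maximalIdeal c).mpr h))

/-- coefficients of `bet` at degrees where the residue component vanishes -/
lemma bet_coeff_mem (h : GF x K K') (Ω : MvPolynomial (Fin d) R) (e : ℕ)
    (h0 : MvPolynomial.homogeneousComponent e (MvPolynomial.map (residue R) Ω) = 0) :
    (bet h Ω : AddMonoidAlgebra R ℝ).coeff (e:ℝ) ∈ K' e := by
  rw [bet_coeff]
  have h1 := alg_hom h (MvPolynomial.homogeneousComponent e Ω) e (MvPolynomial.homogeneousComponent_isHomogeneous _ _)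
  rw [map_comp_hom, h0, map_zero] at h1
  exact (el_eq_zero h _ _ _).mp h1.symm

lemma Hr_tf (h : GF x K K') (a : MvPolynomial (Fin d) (ResidueField R)) (z : Hr h) (ha : a ≠ 0) (haz : alg h a * z = 0) : z = 0 := by
  classical
  obtain ⟨p, rfl⟩ := Ideal.Quotient.mk_surjective z
  obtain ⟨Ω, rfl⟩ := exists_lift_mv a
  by_contra hne
  obtain ⟨r0, h1, h2⟩ := exists_top h p hne
  set a := MvPolynomial.map (residue R) Ω with ha'
  set e := a.totalDegree with he
  have hbig : ∀ s, (e:ℝ) < s → (bet h Ω : AddMonoidAlgebra R ℝ).coeff s ∈ K' s := by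
    intro s hs
    by_cases hs' : ∃ e' : ℕ, (e':ℝ) = s
    · obtain ⟨e', rfl⟩ := hs'
      apply bet_coeff_mem
      exact MvPolynomial.homogeneousComponent_eq_zero _ _ (by exact_mod_cast hs)
    · rw [bet_coeff_zero h Ω s (by simpa using hs')]; exact zero_mem _
  have h3 := top_mul h (bet h Ω) p (bet h Ω).2 p.2 e r0 hbig h2
  rw [alg_map, ← map_mul, mk_eq_zero] at haz
  have h4 : ((bet h Ω : AddMonoidAlgebra R ℝ) * (p : AddMonoidAlgebra R ℝ)).coeff (e + r0) ∈ K' (e + r0) := haz (e + r0)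
  have h5 := sub_mem h4 h3
  rw [sub_sub_cancel, bet_coeff] at h5
  obtain ⟨m, hm, hme⟩ : ∃ m ∈ a.support, m.degree = e := by
    have hs : a.support.Nonempty := MvPolynomial.support_nonempty.mpr ha
    obtain ⟨m, hm, hme⟩ := Finset.exists_mem_eq_sup a.support hs (fun m => m.degree)
    exact ⟨m, hm, by rw [he, MvPolynomial.totalDegree_eq]; rw [← hme]; simp [Finsupp.card_toMultiset, Finsupp.degree_eq_sum, Finsupp.sum_fintype]⟩
  refine h1 (h.colon e (MvPolynomial.homogeneousComponent e Ω) (MvPolynomial.homogeneousComponent_isHomogeneous _ _) m ?_ r0 _ h5)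
  rw [MvPolynomial.coeff_homogeneousComponent, if_pos hme]
  apply isUnit_of_res
  rw [← MvPolynomial.coeff_map]
  exact MvPolynomial.mem_support_iff.mp hm

end HR
end LI2

namespace LI2

lemma asymp (d D m L : ℕ) (h : ∀ n : ℕ, m * (n + d).choose (d+1) ≤ L * (n + D + d).choose (d+1)) : m ≤ L := by
  have h1 : ∀ n : ℕ, m * n^(d+1) ≤ L * (n + D + d)^(d+1) := by
    intro n
    have a1 : n^(d+1) ≤ (n+d).descFactorial (d+1) := by
      have := Nat.pow_sub_le_descFactorial (n+d) (d+1)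
      rwa [show n + d + 1 - (d+1) = n by omega] at this
    have a2 : (n+D+d).descFactorial (d+1) ≤ (n+D+d)^(d+1) := Nat.descFactorial_le_pow _ _
    rw [Nat.descFactorial_eq_factorial_mul_choose] at a1 a2
    calc m * n^(d+1) ≤ m * ((d+1).factorial * (n+d).choose (d+1)) := Nat.mul_le_mul_left _ a1
      _ = (d+1).factorial * (m * (n+d).choose (d+1)) := by ring
      _ ≤ (d+1).factorial * (L * (n + D + d).choose (d+1)) := Nat.mul_le_mul_left _ (h n)
      _ = L * ((d+1).factorial * (n + D + d).choose (d+1)) := by ring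
      _ ≤ _ := Nat.mul_le_mul_left _ a2
  have h2 : Filter.Tendsto (fun n : ℕ => (L:ℝ) * (1 + ((D + d : ℕ) : ℝ) / n)^(d+1)) Filter.atTop (nhds (L * (1 + 0)^(d+1))) := by
    refine Filter.Tendsto.const_mul _ (Filter.Tendsto.pow (Filter.Tendsto.const_add _ ?_) _)
    exact tendsto_const_div_atTop_nhds_zero_nat _
  have h3 : (m:ℝ) ≤ L * (1 + 0)^(d+1) := by
    refine ge_of_tendsto h2 ?_
    filter_upwards [Filter.eventually_gt_atTop 0] with n hn
    have hn' : (0:ℝ) < n := by exact_mod_cast hn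
    have h4 : (m:ℝ) * n^(d+1) ≤ L * (n + D + d)^(d+1) := by exact_mod_cast h1 n
    have h5 : (1 + ((D + d : ℕ) : ℝ) / n) = (n + D + d) / n := by push_cast; field_simp; ring
    rw [h5, div_pow, ← mul_div_assoc, le_div_iff₀ (by positivity)]
    exact h4
  simpa using h3

section HR
variable [CommRing R] [IsLocalRing R] {d : ℕ} {x : Fin d → R} {K K' : ℝ → Ideal R}

noncomputable instance HrAlg (h : GF x K K') : Algebra (MvPolynomial (Fin d) (ResidueField R)) (Hr h) := (alg h).toAlgebra

lemma algebraMap_Hr (h : GF x K K') : algebraMap (MvPolynomial (Fin d) (ResidueField R)) (Hr h) = alg h := rfl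

lemma el_sum (h : GF x K K') {ι : Type*} (s : Finset ι) (t : ℝ) (f : ι → R) (hf : ∀ i ∈ s, f i ∈ K t) :
    ∑ i ∈ s.attach, el h t (f i) (hf i i.2) = el h t (∑ i ∈ s, f i) (sum_mem hf) := by
  simp only [el]
  rw [← map_sum]
  congr 1
  apply Subtype.ext
  push_cast
  apply AddMonoidAlgebra.coeff_injective
  rw [AddMonoidAlgebra.coeff_sum]
  simp only [AddMonoidAlgebra.coeff_single]
  rw [← Finset.sum_attach s, Finsupp.single_finsetSum]

/-- the set of homogeneous elements -/
def homT (h : GF x K K') : Set (Hr h) := {z | ∃ (r : ℝ) (y : R) (hy : y ∈ K r), z = el h r y hy}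

lemma homT_span (h : GF x K K') : Submodule.span (MvPolynomial (Fin d) (ResidueField R)) (homT h) = ⊤ := by
  classical
  rw [eq_top_iff]
  intro z _
  obtain ⟨p, rfl⟩ := Ideal.Quotient.mk_surjective z
  have : p = ∑ r ∈ (p : AddMonoidAlgebra R ℝ).coeff.support, ⟨AddMonoidAlgebra.single r ((p : AddMonoidAlgebra R ℝ).coeff r), single_mem h (p.2 r)⟩ := by
    apply Subtype.ext
    push_cast
    apply AddMonoidAlgebra.coeff_injective
    rw [AddMonoidAlgebra.coeff_sum]
    simp only [AddMonoidAlgebra.coeff_single]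
    exact (Finsupp.sum_single _).symm
  rw [this, map_sum]
  exact Submodule.sum_mem _ fun r _ => Submodule.subset_span ⟨r, _, p.2 r, rfl⟩

lemma extract (h : GF x K K') {ι : Type*} (s : Finset ι) (Ω : ι → MvPolynomial (Fin d) R) (r : ι → ℝ) (y : ι → R)
    (hy : ∀ i, y i ∈ K (r i)) (t : ℝ) (w : R) (hw : w ∈ K t)
    (H : ∑ i ∈ s, alg h (MvPolynomial.map (residue R) (Ω i)) * el h (r i) (y i) (hy i) = el h t w hw) :
    w - ∑ i ∈ s, (bet h (Ω i) : AddMonoidAlgebra R ℝ).coeff (t - r i) * y i ∈ K' t := by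
  simp only [alg_map, el] at H
  simp only [← map_mul] at H
  rw [← map_sum, eq_comm, ← sub_eq_zero, ← map_sub, mk_eq_zero] at H
  have := H t
  push_cast at this
  convert this using 1
  rw [AddMonoidAlgebra.coeff_sub, Finsupp.sub_apply, AddMonoidAlgebra.coeff_single, Finsupp.single_eq_same,
    AddMonoidAlgebra.coeff_sum, Finsupp.finset_sum_apply]
  congr 1
  refine Finset.sum_congr rfl fun i _ => ?_
  rw [AddMonoidAlgebra.coeff_mul_single_apply, sub_eq_add_neg]

lemma GF.anti (h : GF x K K') {r s : ℝ} (hrs : r ≤ s) : K s ≤ K r := by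
  rcases hrs.eq_or_lt with rfl | hlt
  · exact le_rfl
  · exact (h.lt hlt).trans (h.le r)

/-- independence gives independence of the lifted monomial multiples -/
lemma indep_lift (h : GF x K K') {m : ℕ} (r : Fin m → ℝ) (y : Fin m → R) (hy : ∀ i, y i ∈ K (r i))
    (hli : LinearIndependent (MvPolynomial (Fin d) (ResidueField R)) (fun j => el h (r j) (y j) (hy j)))
    (t : ℝ) (S : Finset (Fin m × (Fin d →₀ ℕ))) (hS : ∀ p ∈ S, r p.1 + (p.2.degree : ℝ) = t)
    (c : Fin m × (Fin d →₀ ℕ) → R) (hc : ∑ p ∈ S, c p * ((∏ i, x i ^ p.2 i) * y p.1) ∈ K' t) :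
    ∀ p ∈ S, c p ∈ maximalIdeal R := by
  classical
  let Ω : Fin m → MvPolynomial (Fin d) R := fun j => ∑ p ∈ S, if p.1 = j then MvPolynomial.monomial p.2 (c p) else 0
  have hterm : ∀ p : Fin m × (Fin d →₀ ℕ), ∃ hm : (c p * ∏ i, x i ^ p.2 i) * y p.1 ∈ K ((p.2.degree : ℝ) + r p.1), alg h (MvPolynomial.map (residue R) (MvPolynomial.monomial p.2 (c p))) * el h (r p.1) (y p.1) (hy p.1)
      = el h _ _ hm := by
    intro p
    have h1 := alg_hom h (MvPolynomial.monomial p.2 (c p)) p.2.degree (MvPolynomial.isHomogeneous_monomial _ rfl)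
    have h2 : MvPolynomial.eval x (MvPolynomial.monomial p.2 (c p)) = c p * ∏ i, x i ^ p.2 i := by
      simp [MvPolynomial.eval_monomial, Finsupp.prod_fintype]
    have h3 : c p * ∏ i, x i ^ p.2 i ∈ K (p.2.degree : ℝ) := by
      rw [← h2]; exact h.pow _ (eval_mem_pow x _ _ (MvPolynomial.isHomogeneous_monomial _ rfl))
    refine ⟨h.mul h3 (hy p.1), ?_⟩
    rw [h1, ← el_mul h _ _ _ _ h3 (hy p.1)]
    congr 1
    exact el_congr h rfl h2 _ _
  have hmemt : ∀ p ∈ S, c p * ((∏ i, x i ^ p.2 i) * y p.1) ∈ K t := by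
    intro p hp
    obtain ⟨hm, _⟩ := hterm p
    rw [← hS p hp, add_comm (r p.1), ← mul_assoc]; exact hm
  have hsum : ∑ j, alg h (MvPolynomial.map (residue R) (Ω j)) * el h (r j) (y j) (hy j) = 0 := by
    have e1 : ∀ j, alg h (MvPolynomial.map (residue R) (Ω j)) * el h (r j) (y j) (hy j)
        = ∑ p ∈ S, if p.1 = j then alg h (MvPolynomial.map (residue R) (MvPolynomial.monomial p.2 (c p))) * el h (r p.1) (y p.1) (hy p.1) else 0 := by
      intro j
      simp only [Ω]
      rw [map_sum, map_sum, Finset.sum_mul]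
      refine Finset.sum_congr rfl fun p _ => ?_
      split_ifs with hj
      · subst hj; rfl
      · simp
    rw [Finset.sum_congr rfl (fun j _ => e1 j), Finset.sum_comm]
    refine Eq.trans ?_ ((el_eq_zero h t _ (sum_mem hmemt)).mpr hc)
    rw [← el_sum h S t _ hmemt, ← Finset.sum_attach S]
    refine Finset.sum_congr rfl fun p _ => ?_
    rw [Finset.sum_ite_eq, if_pos (Finset.mem_univ _)]
    obtain ⟨hm, he⟩ := hterm p.1
    rw [he]
    exact el_congr h (by rw [← hS p.1 p.2, add_comm]) (mul_assoc _ _ _) _ _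
  rw [Fintype.linearIndependent_iff] at hli
  intro p hp
  have h0 := hli (fun j => MvPolynomial.map (residue R) (Ω j)) hsum p.1
  have h1 : (Ω p.1).coeff p.2 = c p := by
    simp only [Ω]
    rw [MvPolynomial.coeff_sum, Finset.sum_eq_single p]
    · rw [if_pos rfl, MvPolynomial.coeff_monomial, if_pos rfl]
    · intro p' _ hne
      split_ifs with hj
      · rw [MvPolynomial.coeff_monomial, if_neg]
        intro h2; exact hne (Prod.ext hj h2)
      · simp
    · intro hn; exact absurd hp hn
  have h2 := congrArg (MvPolynomial.coeff p.2) h0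
  simp only [MvPolynomial.coeff_map, h1] at h2
  exact (residue_eq_zero_iff _).mp (by simpa using h2)

lemma count1 (h : GF x K K') {m : ℕ} (r : Fin m → ℝ) (y : Fin m → R) (hy : ∀ i, y i ∈ K (r i))
    (hli : LinearIndependent (MvPolynomial (Fin d) (ResidueField R)) (fun j => el h (r j) (y j) (hy j)))
    (t : ℝ) (S : Finset (Fin m × (Fin d →₀ ℕ))) (hS : ∀ p ∈ S, r p.1 + (p.2.degree : ℝ) = t) :
    (S.card : ℕ∞) + lq (K t) ≤ lq (K' t) := by
  classical
  have h1 := lq_lower (fun p : Fin m × (Fin d →₀ ℕ) => (∏ i, x i ^ p.2 i) * y p.1) S (K' t) (maximalIdeal R)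
    (fun c hc => indep_lift h r y hy hli t S hS c hc)
  rw [lq_max, nsmul_one] at h1
  refine le_trans (add_le_add le_rfl (lq_anti ?_)) h1
  refine sup_le (h.le t) ?_
  rw [Ideal.span_le]
  rintro _ ⟨p, hp, rfl⟩
  have h3 : ∏ i, x i ^ p.2 i ∈ K (p.2.degree : ℝ) := by
    have := h.pow _ (eval_mem_pow x _ _ (MvPolynomial.isHomogeneous_monomial (R := R) (d := p.2) 1 rfl))
    simpa [MvPolynomial.eval_monomial, Finsupp.prod_fintype] using this
  have := h.mul h3 (hy p.1)
  rw [add_comm, hS p hp] at this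
  exact this

lemma count2 (h : GF x K K') {m : ℕ} (r : Fin m → ℝ) (y : Fin m → R) (hy : ∀ i, y i ∈ K (r i))
    (hli : LinearIndependent (MvPolynomial (Fin d) (ResidueField R)) (fun j => el h (r j) (y j) (hy j)))
    (S : Finset (Fin m × (Fin d →₀ ℕ))) (M : ℝ) (hS : ∀ p ∈ S, r p.1 + (p.2.degree : ℝ) < M) :
    (S.card : ℕ∞) ≤ lq (K M) := by
  classical
  let f : Fin m × (Fin d →₀ ℕ) → ℝ := fun p => r p.1 + (p.2.degree : ℝ)
  have key : ∀ (Θ : Finset ℝ) (M : ℝ), (∀ θ ∈ Θ, θ < M) → ((∑ θ ∈ Θ, (S.filter (fun p => f p = θ)).card : ℕ) : ℕ∞) ≤ lq (K M) := by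
    intro Θ
    induction Θ using Finset.induction_on_max with
    | empty => intro M _; simp
    | insert a Θ ha ih =>
      intro M hM
      rw [Finset.sum_insert (fun h => lt_irrefl _ (ha a h))]
      push_cast
      have h1 := ih a ha
      push_cast at h1
      calc _ ≤ ((S.filter (fun p => f p = a)).card : ℕ∞) + lq (K a) := add_le_add le_rfl h1
        _ ≤ lq (K' a) := count1 h r y hy hli a _ (fun p hp => (Finset.mem_filter.mp hp).2)
        _ ≤ lq (K M) := lq_anti (h.lt (hM a (Finset.mem_insert_self _ _)))
  have := key (S.image f) M (by
    intro θ hθ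
    obtain ⟨p, hp, rfl⟩ := Finset.mem_image.mp hθ
    exact hS p hp)
  rwa [← Finset.card_eq_sum_card_image] at this

end HR

section
variable [CommRing R] [IsLocalRing R] {d : ℕ} {x : Fin (d+1) → R} {K K' : ℝ → Ideal R}

lemma count (h : GF x K K') (hq : QR x) (L : ℕ) (hL : lq (gen x) = L) {m : ℕ} (r : Fin m → ℝ) (y : Fin m → R) (hy : ∀ i, y i ∈ K (r i))
    (hli : LinearIndependent (MvPolynomial (Fin (d+1)) (ResidueField R)) (fun j => el h (r j) (y j) (hy j))) : m ≤ L := by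
  classical
  obtain ⟨D, hD⟩ : ∃ D : ℕ, ∀ j, r j ≤ D := by
    obtain ⟨D, hD⟩ := exists_nat_ge (∑ j, |r j|)
    exact ⟨D, fun j => (le_abs_self _).trans ((Finset.single_le_sum (f := fun j => |r j|) (fun i _ => abs_nonneg _) (Finset.mem_univ j)).trans hD)⟩
  refine asymp d D m L fun n => ?_
  let S : Finset (Fin m × (Fin (d+1) →₀ ℕ)) := Finset.univ ×ˢ ((range n).biUnion (fun e => Mo (d+1) e))
  have hcard : S.card = m * (n + d).choose (d+1) := by
    rw [Finset.card_product, Finset.card_univ, Fintype.card_fin, Finset.card_biUnion, ← sum_HF]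
    · rfl
    · intro a _ b _ hab
      rw [Function.onFun, Finset.disjoint_left]
      intro α h1 h2
      exact hab (((mem_Mo α).mp h1).symm.trans ((mem_Mo α).mp h2))
  have h1 := count2 h r y hy hli S ((n + D : ℕ) : ℝ) (by
    intro p hp
    obtain ⟨_, h2⟩ := Finset.mem_product.mp hp
    obtain ⟨e, he, hpe⟩ := Finset.mem_biUnion.mp h2
    rw [(mem_Mo _).mp hpe]
    have : (e:ℝ) < n := by exact_mod_cast Finset.mem_range.mp he
    have := hD p.1
    push_cast; linarith)
  have h2 := h1.trans (lq_anti (h.pow (n + D)))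
  rw [lq_pow_eq x hq, hL, sum_HF, hcard, nsmul_eq_mul] at h2
  have h3 : m * (n + d).choose (d+1) ≤ (n + D + d).choose (d+1) * L := by exact_mod_cast h2
  rwa [mul_comm L]

end
end LI2

namespace LI2

section
variable [CommRing R]

/-- monomial ideals in the coefficients of an integral equation -/
def TT (n : ℕ) (g : ℕ → R) (N : ℕ) : Ideal R :=
  Ideal.span {v | ∃ k : ℕ → ℕ, N ≤ ∑ b ∈ range n, k b * (n - b) ∧ v = ∏ b ∈ range n, g b ^ k b}

lemma TT_zero (n : ℕ) (g : ℕ → R) : TT n g 0 = ⊤ := by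
  rw [Ideal.eq_top_iff_one]
  exact Ideal.subset_span ⟨fun _ => 0, by simp, by simp⟩

lemma TT_mul (n : ℕ) (g : ℕ → R) (N b : ℕ) (hb : b < n) (v : R) (hv : v ∈ TT n g N) : g b * v ∈ TT n g (N + (n - b)) := by
  classical
  refine Submodule.span_induction (p := fun v _ => g b * v ∈ TT n g (N + (n - b))) ?_ ?_ ?_ ?_ hv
  · rintro _ ⟨k, hk, rfl⟩
    refine Ideal.subset_span ⟨fun c => k c + if c = b then 1 else 0, ?_, ?_⟩
    · simp only [add_mul, Finset.sum_add_distrib, ite_mul, one_mul, zero_mul]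
      rw [Finset.sum_ite_eq' (range n) b, if_pos (Finset.mem_range.mpr hb)]
      omega
    · simp only [pow_add, Finset.prod_mul_distrib]
      rw [mul_comm]
      congr 1
      rw [Finset.prod_eq_single b]
      · simp
      · intro c _ hc; simp [hc]
      · intro hc; exact absurd (Finset.mem_range.mpr hb) hc
  · simp
  · intro u v _ _ hu hv; rw [mul_add]; exact add_mem hu hv
  · intro c v _ hv; rw [smul_eq_mul, mul_left_comm]; exact Ideal.mul_mem_left _ _ hv

lemma TT_anti (n : ℕ) (g : ℕ → R) {N M : ℕ} (h : N ≤ M) : TT n g M ≤ TT n g N :=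
  Ideal.span_mono (by rintro _ ⟨k, hk, rfl⟩; exact ⟨k, h.trans hk, rfl⟩)

lemma pow_mem_TT (n : ℕ) (g : ℕ → R) (z : R) (hz : z ^ n = ∑ b ∈ range n, g b * z ^ b) (s : ℕ) : z ^ s ∈ TT n g (s + 1 - n) := by
  induction s using Nat.strong_induction_on with
  | _ s ih =>
    rcases lt_or_ge s n with hs | hs
    · rw [show s + 1 - n = 0 by omega, TT_zero]; trivial
    · obtain ⟨u, rfl⟩ := Nat.exists_eq_add_of_le hs
      rw [pow_add, hz, Finset.sum_mul]
      refine sum_mem fun b hb => ?_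
      have hb' := Finset.mem_range.mp hb
      have := TT_mul n g _ b hb' _ (ih (b + u) (by omega))
      rw [mul_assoc, ← pow_add]
      exact TT_anti n g (by omega) this

lemma Fr_integral {J : Ideal R} {a : ℝ} (ha : 0 ≤ a) (n : ℕ) (g : ℕ → R) (z : R) (hz : z ^ n = ∑ b ∈ range n, g b * z ^ b)
    (hg : ∀ b < n, g b ∈ Fr J (((n:ℝ) - b) * a)) : z ∈ Fr J a := by
  classical
  have h1 : ∀ b, ∃ c : ℝ, 0 ≤ c ∧ (b < n → ∀ s m : ℕ, (m:ℝ) + c ≤ ((n:ℝ) - b) * a * s → g b ^ s ∈ J ^ m) := by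
    intro b
    by_cases hb : b < n
    · obtain ⟨c, hc, h⟩ := mem_pow_of_mem_Fr (hg b hb)
      exact ⟨c, hc, fun _ => h⟩
    · exact ⟨0, le_rfl, fun h => absurd h hb⟩
  choose c hc0 hc using h1
  refine mem_Fr_of_lb (n * a + ∑ b ∈ range n, (c b + 1)) fun s m hm => ?_
  refine (show TT n g (s + 1 - n) ≤ J ^ m from ?_) (pow_mem_TT n g z hz s)
  rw [TT, Ideal.span_le]
  rintro _ ⟨k, hk, rfl⟩
  let e : ℕ → ℕ := fun b => ⌊((n:ℝ) - b) * a * k b - c b⌋₊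
  have h2 : ∏ b ∈ range n, g b ^ k b ∈ J ^ (∑ b ∈ range n, e b) := by
    rw [← Finset.prod_pow_eq_pow_sum]
    refine Ideal.prod_mem_prod fun b hb => ?_
    by_cases h0 : 0 ≤ ((n:ℝ) - b) * a * k b - c b
    · refine hc b (Finset.mem_range.mp hb) _ _ ?_
      have := Nat.floor_le h0
      linarith
    · have : e b = 0 := Nat.floor_of_nonpos (by linarith)
      rw [this, pow_zero, Ideal.one_eq_top]; trivial
  refine Ideal.pow_le_pow_right ?_ h2
  have h3 : ∑ b ∈ range n, (((n:ℝ) - b) * a * k b - c b - 1) ≤ ∑ b ∈ range n, (e b : ℝ) := by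
    refine Finset.sum_le_sum fun b _ => ?_
    have := Nat.lt_floor_add_one (((n:ℝ) - b) * a * k b - c b)
    simp only [e]; linarith
  have h4 : ((s:ℝ) + 1 - n) ≤ ∑ b ∈ range n, (k b : ℝ) * ((n:ℝ) - b) := by
    have h5 : ((s + 1 : ℕ):ℝ) ≤ ((∑ b ∈ range n, k b * (n - b) + n : ℕ) : ℝ) := by
      exact_mod_cast (by omega : s + 1 ≤ ∑ b ∈ range n, k b * (n - b) + n)
    push_cast at h5
    have h6 : ∑ b ∈ range n, (k b : ℝ) * ((n:ℝ) - b) = ∑ b ∈ range n, (k b : ℝ) * ((n - b : ℕ) : ℝ) := by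
      refine Finset.sum_congr rfl fun b hb => ?_
      rw [Nat.cast_sub (Finset.mem_range.mp hb).le]
    rw [h6]; linarith
  have h7 : ∑ b ∈ range n, (((n:ℝ) - b) * a * k b - c b - 1) = a * (∑ b ∈ range n, (k b : ℝ) * ((n:ℝ) - b)) - ∑ b ∈ range n, (c b + 1) := by
    rw [Finset.mul_sum, ← Finset.sum_sub_distrib]
    exact Finset.sum_congr rfl fun b _ => by ring
  have h8 := mul_le_mul_of_nonneg_left h4 ha
  have : (m:ℝ) ≤ ((∑ b ∈ range n, e b : ℕ) : ℝ) := by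
    push_cast
    nlinarith
  exact_mod_cast this

end

section
variable [CommRing R] [IsLocalRing R] {d : ℕ} {x : Fin (d+1) → R} {K K' : ℝ → Ideal R}

lemma relation (h : GF x K K') (hq : QR x) (L : ℕ) (hL : lq (gen x) = L) (r : ℝ) (y : R) (hy : y ∈ K r) :
    ∃ (ρ : ℝ) (n : ℕ) (Ω : ℕ → MvPolynomial (Fin (d+1)) R) (e : ℕ → ℕ), 0 < n ∧
      (∀ b, (Ω b).IsHomogeneous (e b)) ∧ (∀ b, Ω b = 0 ∨ (e b : ℝ) = ρ - b * r) ∧ (∃ m, IsUnit ((Ω n).coeff m)) ∧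
      ∑ b ∈ range (n+1), MvPolynomial.eval x (Ω b) * y ^ b ∈ K' ρ := by
  classical
  have hnli : ¬ LinearIndependent (MvPolynomial (Fin (d+1)) (ResidueField R))
      (fun j : Fin (L+1) => el h ((j:ℕ) * r) (y ^ (j:ℕ)) (pow_mem_K h hy j)) := by
    intro hli
    have := count h hq L hL (fun j : Fin (L+1) => ((j:ℕ):ℝ) * r) (fun j => y ^ (j:ℕ)) _ hli
    omega
  rw [Fintype.linearIndependent_iff] at hnli
  push Not at hnli
  obtain ⟨g, hg, i, hi⟩ := hnli
  choose Ω0 hΩ0 using fun j => exists_lift_mv (g j)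
  obtain ⟨α, hα⟩ := MvPolynomial.ne_zero_iff.mp hi
  set ρ : ℝ := α.degree + (i:ℕ) * r with hρ
  have hex := extract h Finset.univ Ω0 (fun j : Fin (L+1) => ((j:ℕ):ℝ) * r) (fun j => y ^ (j:ℕ)) (fun j => pow_mem_K h hy j) ρ 0 (zero_mem _) (by
    rw [(el_eq_zero h ρ 0 (zero_mem _)).mpr (zero_mem _)]
    simp only [hΩ0]
    exact hg)
  have hΩ1 : ∀ j : ℕ, ∃ (Ω : MvPolynomial (Fin (d+1)) R) (e : ℕ), Ω.IsHomogeneous e ∧ (Ω = 0 ∨ (e:ℝ) = ρ - j * r) ∧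
      (∀ hj : j < L + 1, (bet h (Ω0 ⟨j, hj⟩) : AddMonoidAlgebra R ℝ).coeff (ρ - j * r) = MvPolynomial.eval x Ω) ∧
      (j = i → IsUnit (Ω.coeff α)) := by
    intro j
    by_cases hj : j < L + 1
    · by_cases he : ∃ e : ℕ, (e:ℝ) = ρ - j * r
      · obtain ⟨e, he⟩ := he
        refine ⟨MvPolynomial.homogeneousComponent e (Ω0 ⟨j, hj⟩), e, MvPolynomial.homogeneousComponent_isHomogeneous _ _, Or.inr he, fun _ => ?_, ?_⟩
        · rw [← he, bet_coeff]
        · rintro rfl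
          have : e = α.degree := by
            have : (e:ℝ) = α.degree := by rw [he, hρ]; ring
            exact_mod_cast this
          rw [MvPolynomial.coeff_homogeneousComponent, if_pos this.symm]
          apply isUnit_of_res
          rw [← MvPolynomial.coeff_map, Fin.eta, hΩ0]
          exact hα
      · push Not at he
        refine ⟨0, 0, MvPolynomial.isHomogeneous_zero _ _ _, Or.inl rfl, fun _ => ?_, ?_⟩
        · rw [bet_coeff_zero h _ _ he, map_zero]
        · rintro rfl
          exact absurd (by rw [hρ]; ring) (he α.degree)
    · exact ⟨0, 0, MvPolynomial.isHomogeneous_zero _ _ _, Or.inl rfl, fun h => absurd h hj, fun h => absurd (h ▸ i.2) hj⟩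
  choose Ω e hhom hdeg hbet hunit using hΩ1
  have hrel : ∑ b ∈ range (L+1), MvPolynomial.eval x (Ω b) * y ^ b ∈ K' ρ := by
    rw [zero_sub, neg_mem_iff, ← Fin.sum_univ_eq_sum_range (fun b => MvPolynomial.eval x (Ω b) * y ^ b)] at *
    convert hex using 2 with j
    rw [← hbet j j.2]
  let S := (range (L+1)).filter (fun b => ∃ m, IsUnit ((Ω b).coeff m))
  have hS : S.Nonempty := ⟨i, Finset.mem_filter.mpr ⟨Finset.mem_range.mpr i.2, α, hunit i rfl⟩⟩
  obtain ⟨hn1, hn2⟩ := Finset.mem_filter.mp (S.max'_mem hS)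
  set n := S.max' hS with hn
  have hrel2 : ∑ b ∈ range (n+1), MvPolynomial.eval x (Ω b) * y ^ b ∈ K' ρ := by
    have hsub : range (n+1) ⊆ range (L+1) := by
      intro a ha; have := Finset.mem_range.mp hn1; rw [Finset.mem_range] at *; omega
    rw [← Finset.sum_sdiff hsub] at hrel
    refine (add_mem_cancel_left (sum_mem fun b hb => ?_)).mp hrel
    rw [Finset.mem_sdiff] at hb
    have hbS : ¬ ∃ m, IsUnit ((Ω b).coeff m) := by
      intro hh
      have := S.le_max' b (Finset.mem_filter.mpr ⟨hb.1, hh⟩)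
      rw [← hn] at this
      exact hb.2 (Finset.mem_range.mpr (by omega))
    rcases hdeg b with h0 | h0
    · rw [h0]; simp
    · push Not at hbS
      have h1 : MvPolynomial.eval x (Ω b) ∈ maximalIdeal R * gen x ^ e b :=
        eval_mem_mul_pow x _ _ _ (hhom b) (fun m => (mem_maximalIdeal _).mpr (hbS m))
      have h2 : ∀ v ∈ maximalIdeal R * gen x ^ e b, v ∈ K' (e b : ℝ) := by
        intro v hv
        refine Submodule.mul_induction_on hv ?_ (fun _ _ => add_mem)
        intro u hu v hv
        have := h.mul' (h.pow _ hv) (h.max hu)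
        rwa [add_zero, mul_comm] at this
      have h3 := h.mul' (pow_mem_K h hy b) (h2 _ h1)
      rw [h0, show (b:ℝ) * r + (ρ - b * r) = ρ by ring, mul_comm] at h3
      exact h3
  refine ⟨ρ, n, Ω, e, ?_, hhom, hdeg, hn2, hrel2⟩
  rcases Nat.eq_zero_or_pos n with h0 | h0
  · exfalso
    rw [h0] at hrel2 hn2
    obtain ⟨m, hm⟩ := hn2
    simp only [zero_add, Finset.sum_range_one, pow_zero, mul_one] at hrel2
    rcases hdeg 0 with h1 | h1
    · rw [h1] at hm; simp at hm
    · refine h.one (h.colon (e 0) (Ω 0) (hhom 0) m hm 0 1 ?_)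
      rw [h1]; simpa using hrel2
  · exact h0

end
end LI2

namespace LI2

section
variable [CommRing R] [IsLocalRing R] {d : ℕ} {x : Fin (d+1) → R}

lemma Kf_eq_Fr (h : GF x (Kf (gen x)) (Kg (gen x))) (hq : QR x) (L : ℕ) (hL : lq (gen x) = L) (r : ℝ) :
    Kf (gen x) r = Fr (gen x) r := by
  classical
  refine le_antisymm (fun y hy => ?_) (Fr_le_Kf r)
  rcases le_or_gt r 0 with hr | hr
  · rw [Fr_nonpos hr]; trivial
  obtain ⟨ρ, n, Ω, e, hn, hhom, hdeg, ⟨m, hm⟩, hrel⟩ := relation h hq L hL r y hy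
  have hne : Ω n ≠ 0 := by intro h0; rw [h0] at hm; simp at hm
  have hen := (hdeg n).resolve_left hne
  set w := MvPolynomial.eval x (Ω n) with hw
  set η := ∑ b ∈ range (n+1), MvPolynomial.eval x (Ω b) * y ^ b with hη
  have hηF : η ∈ Fr (gen x) ρ := Kg_le_Fr ρ hrel
  have hwF : w ∈ Fr (gen x) (e n) := pow_le_Fr _ (eval_mem_pow x _ _ (hhom n))
  let g : ℕ → R := fun b => (if b = 0 then w ^ (n-1) * η else 0) - MvPolynomial.eval x (Ω b) * w ^ (n - 1 - b)
  have ha : (0:ℝ) ≤ e n + r := by positivity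
  have hz : w * y ∈ Fr (gen x) (e n + r) := by
    refine Fr_integral ha n g _ ?_ ?_
    · simp only [g, sub_mul, Finset.sum_sub_distrib, ite_mul, zero_mul]
      rw [Finset.sum_ite_eq' (range n) 0, if_pos (Finset.mem_range.mpr hn), pow_zero, mul_one, hη, Finset.sum_range_succ, mul_add,
        Finset.mul_sum, add_comm, add_sub_assoc, ← Finset.sum_sub_distrib, Finset.sum_eq_zero, add_zero, ← hw]
      · obtain ⟨n', rfl⟩ := Nat.exists_eq_succ_of_ne_zero hn.ne'
        simp only [Nat.succ_eq_add_one, Nat.add_sub_cancel]; ring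
      · intro b hb
        have hb' := Finset.mem_range.mp hb
        obtain ⟨c, hc⟩ := Nat.exists_eq_add_of_lt hb'
        rw [hc, show b + c + 1 - 1 = b + c by omega, show b + c - b = c by omega, pow_add]
        ring
    · intro b hb
      refine sub_mem ?_ ?_
      · split_ifs with h0
        · subst h0
          have := Fr_mul (Fr_pow hwF (n-1)) hηF
          convert this using 2
          rw [Nat.cast_sub hn, hen]; push_cast; ring
        · exact zero_mem _
      · rcases hdeg b with h0 | h0
        · rw [h0]; simp
        · have := Fr_mul (pow_le_Fr _ (eval_mem_pow x _ _ (hhom b))) (Fr_pow hwF (n-1-b))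
          convert this using 2
          rw [show n - 1 - b = n - (b + 1) by omega, Nat.cast_sub (by omega), h0, hen]; push_cast; ring
  refine Fr_colon x hq (e n) (Ω n) (hhom n) m hm r y ?_
  have h9 : (r + e n : ℝ) = e n + r := add_comm _ _
  rw [h9]; exact hz

/-- homogeneous elements of irrational degree vanish -/
lemma el_irr {K K' : ℝ → Ideal R} (h : GF x K K') (hq : QR x) (L : ℕ) (hL : lq (gen x) = L) (r : ℝ) (hr0 : 0 < r)
    (hr : ¬ ∃ a b : ℕ, 0 < b ∧ (b:ℝ) * r = a) (y : R) (hy : y ∈ K r) : el h r y hy = 0 := by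
  classical
  obtain ⟨ρ, n, Ω, e, hn, hhom, hdeg, ⟨m, hm⟩, hrel⟩ := relation h hq L hL r y hy
  have hne : Ω n ≠ 0 := by intro h0; rw [h0] at hm; simp at hm
  have hen := (hdeg n).resolve_left hne
  have hz : ∀ b ∈ range n, MvPolynomial.eval x (Ω b) * y ^ b = 0 := by
    intro b hb
    have hb' := Finset.mem_range.mp hb
    rcases hdeg b with h0 | h0
    · rw [h0]; simp
    · exfalso
      have h1 : ((n - b : ℕ) : ℝ) * r = (e b : ℝ) - e n := by rw [Nat.cast_sub hb'.le, h0, hen]; ring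
      have h2 : (0:ℝ) < ((n - b : ℕ) : ℝ) * r := mul_pos (by exact_mod_cast (by omega)) hr0
      have h3 : e n ≤ e b := by
        have : (e n : ℝ) ≤ e b := by linarith
        exact_mod_cast this
      exact hr ⟨e b - e n, n - b, by omega, by rw [h1, Nat.cast_sub h3]⟩
  rw [Finset.sum_range_succ, Finset.sum_eq_zero hz, zero_add] at hrel
  have h4 := h.colon (e n) (Ω n) (hhom n) m hm (n * r) (y ^ n) (by
    rw [hen]; convert hrel using 2; ring)
  have h5 := (el_eq_zero h (n * r) (y^n) (pow_mem_K h hy n)).mpr h4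
  rw [← el_pow h r y hy n] at h5
  haveI := Hr_reduced h
  exact pow_eq_zero_iff hn.ne' |>.mp h5

lemma el_int [IsNoetherianRing R] (h : GF x (Kf (gen x)) (Kg (gen x))) (hq : QR x) (L : ℕ) (hL : lq (gen x) = L)
    (hreg : IsSMulRegular R (x 0)) (r : ℝ) (y : R) (hy : y ∈ Kf (gen x) r) :
    IsIntegral (MvPolynomial (Fin (d+1)) (ResidueField R)) (el h r y hy) := by
  classical
  rcases lt_trichotomy r 0 with hr | hr | hr
  · rw [(el_eq_zero h r y hy).mpr (by rw [h.neg r hr]; trivial)]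
    exact isIntegral_zero
  · subst hr
    have h1 := alg_hom h (MvPolynomial.C y) 0 (MvPolynomial.isHomogeneous_C _ _)
    have h2 : el h 0 y hy = alg h (MvPolynomial.map (residue R) (MvPolynomial.C y)) := by
      rw [h1]
      exact el_congr h (by simp) (by simp) _ _
    rw [h2, ← algebraMap_Hr]
    exact isIntegral_algebraMap
  · by_cases hrat : ∃ a b : ℕ, 0 < b ∧ (b:ℝ) * r = a
    · obtain ⟨a, b, hb, hab⟩ := hrat
      refine IsIntegral.of_pow hb ?_
      rw [el_pow]
      have hy' : y ^ b ∈ Fr (gen x) a := by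
        rw [← hab, ← Kf_eq_Fr h hq L hL]; exact pow_mem_K h hy b
      obtain ⟨n, hn, c, hc, heq⟩ := Fr_isInt (le_refl (gen x)) a (x 0) (x_mem x 0) hreg _ hy'
      rw [el_congr h hab rfl _ (Fr_le_Kf _ hy')]
      set u := y ^ b with hu
      have hF : ∀ i, ∃ F : MvPolynomial (Fin (d+1)) R, F.IsHomogeneous (a * i) ∧ (i ∈ Finset.Icc 1 n → MvPolynomial.eval x F = c i) := by
        intro i
        by_cases hi : i ∈ Finset.Icc 1 n
        · have := hc i hi
          rw [← pow_mul] at this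
          obtain ⟨F, hF, -, hFe⟩ := mem_mul_pow x ⊤ (a * i) (c i) (by rw [← Ideal.one_eq_top, one_mul]; exact this)
          exact ⟨F, hF, fun _ => hFe⟩
        · exact ⟨0, MvPolynomial.isHomogeneous_zero _ _ _, fun h => absurd h hi⟩
      choose F hFh hFe using hF
      let p : Polynomial (MvPolynomial (Fin (d+1)) (ResidueField R)) :=
        X ^ n + ∑ i ∈ Finset.Icc 1 n, C (MvPolynomial.map (residue R) (F i)) * X ^ (n - i)
      refine ⟨p, ?_, ?_⟩
      · refine Polynomial.monic_X_pow_add ?_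
        refine lt_of_le_of_lt (Polynomial.degree_sum_le _ _) ?_
        rw [Finset.sup_lt_iff (by exact WithBot.bot_lt_coe _)]
        intro i hi
        have hi' := Finset.mem_Icc.mp hi
        refine lt_of_le_of_lt (Polynomial.degree_C_mul_X_pow_le _ _) ?_
        exact_mod_cast (by omega)
      · simp only [p, Polynomial.eval₂_add, Polynomial.eval₂_pow, Polynomial.eval₂_X, Polynomial.eval₂_finset_sum, Polynomial.eval₂_mul, Polynomial.eval₂_C]
        rw [algebraMap_Hr]
        have hmem : ∀ i ∈ Finset.Icc 1 n, c i * u ^ (n - i) ∈ Kf (gen x) ((n:ℝ) * a) := by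
          intro i hi
          have hi' := Finset.mem_Icc.mp hi
          have := Kf_mul (pow_le_Kf (J := gen x) (a * i) (by rw [pow_mul]; exact hc i hi)) (pow_mem_K h (Fr_le_Kf _ hy') (n - i))
          convert this using 2
          rw [Nat.cast_sub hi'.2]; push_cast; ring
        have hs : ∑ i ∈ Finset.Icc 1 n, alg h (MvPolynomial.map (residue R) (F i)) * el h a u (Fr_le_Kf _ hy') ^ (n - i)
            = el h ((n:ℝ) * a) (∑ i ∈ Finset.Icc 1 n, c i * u ^ (n - i)) (sum_mem hmem) := by
          rw [← el_sum h (Finset.Icc 1 n) ((n:ℝ) * a) (fun i => c i * u ^ (n-i)) hmem, ← Finset.sum_attach (Finset.Icc 1 n)]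
          refine Finset.sum_congr rfl fun i _ => ?_
          have hi' := Finset.mem_Icc.mp i.2
          rw [alg_hom h (F i) _ (hFh i), el_pow, el_mul]
          refine el_congr h ?_ ?_ _ _
          · rw [Nat.cast_sub hi'.2]; push_cast; ring
          · rw [hFe i i.2]
        rw [hs, el_pow, el_add, el_eq_zero, heq]
        exact zero_mem _
    · rw [el_irr h hq L hL r hr hrat]
      exact isIntegral_zero

lemma Hr_finite [IsNoetherianRing R] (h : GF x (Kf (gen x)) (Kg (gen x))) (hq : QR x) (L : ℕ) (hL : lq (gen x) = L)
    (hreg : IsSMulRegular R (x 0)) : Module.Finite (MvPolynomial (Fin (d+1)) (ResidueField R)) (Hr h) := by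
  classical
  haveI := Hr_reduced h
  refine n2_alg (d+1) (fun a z ha haz => Hr_tf h a z ha haz) ⟨fun z => ?_⟩ (homT h) (homT_span h) L ?_
  · have hz : z ∈ Submodule.span (MvPolynomial (Fin (d+1)) (ResidueField R)) (homT h) := by rw [homT_span]; trivial
    refine Submodule.span_induction (p := fun z _ => IsIntegral (MvPolynomial (Fin (d+1)) (ResidueField R)) z) ?_ isIntegral_zero (fun _ _ _ _ => IsIntegral.add) (fun a z _ hz => hz.smul a) hz
    rintro _ ⟨r, y, hy, rfl⟩
    exact el_int h hq L hL hreg r y hy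
  · intro s hs hli
    let eq := s.equivFin
    have h1 : ∀ j : Fin s.card, ∃ (r : ℝ) (y : R) (hy : y ∈ Kf (gen x) r), ((eq.symm j : s) : Hr h) = el h r y hy :=
      fun j => hs (eq.symm j).2
    choose r y hy he using h1
    refine count h hq L hL r y hy ?_
    have h2 := hli.comp (eq.symm) eq.symm.injective
    have h3 : (fun j => el h (r j) (y j) (hy j)) = (fun x_1 : ((s : Set (Hr h))) => id (x_1 : Hr h)) ∘ eq.symm := by
      funext j
      exact (he j).symm
    rw [h3]
    exact h2

end
end LI2

namespace LI2

section
variable [CommRing R] [IsLocalRing R] {d : ℕ} {x : Fin (d+1) → R}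

lemma lq_Kf_ne_top [IsNoetherianRing R] (N : ℕ) (hN : maximalIdeal R ^ N ≤ gen x) (r : ℝ) : lq (Kf (gen x) r) ≠ ⊤ := by
  obtain ⟨n, hn⟩ := exists_nat_ge r
  refine lq_ne_top (N * n) ?_
  rw [pow_mul]
  exact (Ideal.pow_right_mono hN n).trans ((pow_le_Kf n).trans (Kf_anti hn))

lemma Kf_left [IsNoetherianRing R] (N : ℕ) (hN : maximalIdeal R ^ N ≤ gen x) (u : ℝ) :
    ∃ δ > 0, ∀ u', u - δ ≤ u' → u' ≤ u → Kf (gen x) u' = Kf (gen x) u := by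
  obtain ⟨n0, h0⟩ := stab (fun n : ℕ => Kf (gen x) (u - 1/((n:ℝ)+1))) (by
    intro a b hab
    refine Kf_anti ?_
    have : 1/((b:ℝ)+1) ≤ 1/((a:ℝ)+1) := by
      apply one_div_le_one_div_of_le (by positivity)
      have : (a:ℝ) ≤ b := by exact_mod_cast hab
      linarith
    linarith) (Kf (gen x) u) (lq_Kf_ne_top N hN u) (fun n => Kf_anti (by
      have : 0 < 1/((n:ℝ)+1) := by positivity
      linarith))
  refine ⟨1/((n0:ℝ)+1), by positivity, fun u' h1 h2 => le_antisymm ?_ (Kf_anti h2)⟩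
  intro y hy
  rw [mem_Kf]
  intro ε hε
  obtain ⟨n1, hn1⟩ := exists_nat_one_div_lt (half_pos hε)
  have hy1 : y ∈ Kf (gen x) (u - 1/((n0:ℝ)+1)) := Kf_anti h1 hy
  have h3 := h0 (max n0 n1) (le_max_left _ _)
  rw [← h3] at hy1
  have h4 := mem_Kf.mp hy1 (ε/2) (half_pos hε)
  refine Fr_anti ?_ h4
  have : 1/(((max n0 n1 : ℕ):ℝ)+1) ≤ 1/((n1:ℝ)+1) := by
    apply one_div_le_one_div_of_le (by positivity)
    have : (n1:ℝ) ≤ (max n0 n1 : ℕ) := by exact_mod_cast le_max_right _ _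
    linarith
  linarith

lemma Kg_eq_Kf [IsNoetherianRing R] (J : Ideal R) (u : ℝ) : ∃ s > u, Kg J u ≤ Kf J s := by
  have hfg : (Kg J u).FG := IsNoetherian.noetherian _
  obtain ⟨S, hS⟩ := hfg
  have h1 : ∀ y : S, ∃ ε > 0, (y:R) ∈ Fr J (u + ε) := fun y => mem_Kg.mp (hS ▸ Submodule.subset_span y.2)
  choose ε hε hy using h1
  have h2 : ∃ δ > 0, ∀ y : S, δ ≤ ε y := by
    by_cases hne : Nonempty S
    · obtain ⟨y0, h0⟩ := Finite.exists_min ε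
      exact ⟨ε y0, hε y0, h0⟩
    · exact ⟨1, one_pos, fun y => absurd ⟨y⟩ hne⟩
  obtain ⟨δ, hδ, hδ'⟩ := h2
  refine ⟨u + δ, by linarith, ?_⟩
  rw [← hS, Submodule.span_le]
  intro y hyS
  exact Fr_le_Kf _ (Fr_anti (by have := hδ' ⟨y, hyS⟩; linarith) (hy ⟨y, hyS⟩))

lemma step_D (h : GF x (Kf (gen x)) (Kg (gen x))) (hfin : Module.Finite (MvPolynomial (Fin (d+1)) (ResidueField R)) (Hr h)) :
    ∃ D : ℝ, ∀ r > D, Kf (gen x) r ≤ gen x * Kf (gen x) (r - 1) ⊔ Kg (gen x) r := by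
  classical
  have h1 : (Submodule.span (MvPolynomial (Fin (d+1)) (ResidueField R)) (homT h)).FG := by
    rw [homT_span]; exact hfin.fg_top
  obtain ⟨T, hT, hTs⟩ := (Submodule.fg_span_iff_fg_span_finset_subset _).mp h1
  have h2 : ∀ j : T, ∃ (r : ℝ) (y : R) (hy : y ∈ Kf (gen x) r), (j : Hr h) = el h r y hy := fun j => hT j.2
  choose r y hy he using h2
  refine ⟨∑ j, |r j|, fun t ht w hw => ?_⟩
  have hrt : ∀ j, r j < t := fun j => lt_of_le_of_lt ((le_abs_self _).trans (Finset.single_le_sum (f := fun j => |r j|) (fun i _ => abs_nonneg _) (Finset.mem_univ j))) ht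
  have h3 : el h t w hw ∈ Submodule.span (MvPolynomial (Fin (d+1)) (ResidueField R)) (T : Set (Hr h)) := by
    rw [← hTs, homT_span]; trivial
  obtain ⟨f, -, hf⟩ := Submodule.mem_span_finset.mp h3
  choose Ω hΩ using fun j => exists_lift_mv (f j)
  have h4 := extract h Finset.univ (fun j : T => Ω j) r y hy t w hw (by
    rw [← hf, ← Finset.sum_attach T, ← Finset.univ_eq_attach]
    refine Finset.sum_congr rfl fun j _ => ?_
    rw [hΩ, ← he]; rfl)
  rw [← add_sub_cancel (∑ j : T, (bet h (Ω j) : AddMonoidAlgebra R ℝ).coeff (t - r j) * y j) w]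
  refine Submodule.add_mem_sup (sum_mem fun j _ => ?_) h4
  by_cases hex : ∃ e : ℕ, (e:ℝ) = t - r j
  · obtain ⟨e, hee⟩ := hex
    rw [← hee, bet_coeff]
    have he0 : e ≠ 0 := by
      rintro rfl
      have := hrt j; push_cast at hee; linarith
    obtain ⟨e', rfl⟩ := Nat.exists_eq_succ_of_ne_zero he0
    have h5 := eval_mem_pow x _ _ (MvPolynomial.homogeneousComponent_isHomogeneous (e'+1) (Ω j))
    have h6 := Ideal.mul_mem_mul h5 (hy j)
    rw [pow_succ', mul_assoc] at h6
    refine Ideal.mul_mono le_rfl ?_ h6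
    rw [Ideal.mul_le]
    intro a ha b hb
    have := Kf_mul (pow_le_Kf e' ha) hb
    convert this using 2
    push_cast at hee; linarith
  · push Not at hex
    rw [bet_coeff_zero h _ _ hex, zero_mul]; exact zero_mem _

lemma push_t [IsNoetherianRing R] (N : ℕ) (hN : maximalIdeal R ^ N ≤ gen x) (D : ℝ)
    (hD : ∀ r > D, Kf (gen x) r ≤ gen x * Kf (gen x) (r - 1) ⊔ Kg (gen x) r) (r t : ℝ) (hr : D < r) (hrt : r ≤ t) :
    Kf (gen x) r ≤ gen x * Kf (gen x) (r - 1) ⊔ Kf (gen x) t := by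
  set U := gen x * Kf (gen x) (r - 1) with hU
  let S : Set ℝ := {u | Kf (gen x) r ≤ U ⊔ Kf (gen x) u}
  have hanti : ∀ u u', u ≤ u' → u' ∈ S → u ∈ S := fun u u' huu h =>
    show Kf (gen x) r ≤ U ⊔ Kf (gen x) u from le_trans (show Kf (gen x) r ≤ U ⊔ Kf (gen x) u' from h) (sup_le_sup le_rfl (Kf_anti huu))
  have key : Set.Icc r t ⊆ S := by
    refine IsClosed.Icc_subset_of_forall_exists_gt ?_ (show Kf (gen x) r ≤ U ⊔ Kf (gen x) r from le_sup_right) ?_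
    · rw [← closure_subset_iff_isClosed]
      intro u hu
      have hu2 : u ∈ Set.Icc r t := by
        have := closure_mono (Set.inter_subset_right) hu
        rwa [isClosed_Icc.closure_eq] at this
      refine ⟨?_, hu2⟩
      obtain ⟨δ, hδ, hδ'⟩ := Kf_left N hN u
      obtain ⟨u', ⟨hu', _⟩, hdist⟩ := Metric.mem_closure_iff.mp hu δ hδ
      rw [Real.dist_eq, abs_lt] at hdist
      rcases le_total u u' with hle | hle
      · exact hanti _ _ hle hu'
      · show Kf (gen x) r ≤ U ⊔ Kf (gen x) u
        rw [← hδ' u' (by linarith) hle]; exact hu'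
    · rintro u ⟨huS, hu1, hu2⟩ v hv
      obtain ⟨s, hs, hsK⟩ := Kg_eq_Kf (gen x) u
      have hsS : s ∈ S := by
        show Kf (gen x) r ≤ U ⊔ Kf (gen x) s
        refine le_trans (show Kf (gen x) r ≤ U ⊔ Kf (gen x) u from huS) (sup_le le_sup_left ((hD u (by linarith)).trans (sup_le ?_ (hsK.trans le_sup_right))))
        exact (Ideal.mul_mono le_rfl (Kf_anti (by linarith))).trans le_sup_left
      exact ⟨min s v, hanti _ s (min_le_left _ _) hsS, lt_min hs hv, min_le_right _ _⟩
  exact key ⟨hrt, le_rfl⟩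

/-- the linear bound -/
def LBd {R : Type*} [CommRing R] (J : Ideal R) : Prop := ∃ c : ℕ, ∀ n : ℕ, Fr J ((n + c : ℕ) : ℝ) ≤ J ^ n

theorem LB [IsNoetherianRing R] (hred : IsReduced (AdicCompletion (maximalIdeal R) R))
    (hreg : RingTheory.Sequence.IsRegular R (List.ofFn x)) (hJ : gen x ≤ maximalIdeal R) (N : ℕ)
    (hN : maximalIdeal R ^ N ≤ gen x) : LBd (gen x) := by
  classical
  have hq := qr_of_regular x hreg
  have h := gf_fr x hq hJ N hN
  obtain ⟨L, hL⟩ := ENat.ne_top_iff_exists.mp (lq_ne_top N hN)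
  have hx0 : IsSMulRegular R (x 0) := by
    have := hreg.toIsWeaklyRegular
    rw [List.ofFn_succ, RingTheory.Sequence.isWeaklyRegular_cons_iff] at this
    exact this.1
  obtain ⟨D, hD⟩ := step_D h (Hr_finite h hq L hL.symm hx0)
  have hstep : ∀ r > D, Kf (gen x) r ≤ gen x * Kf (gen x) (r - 1) := by
    intro r hr
    obtain ⟨b, hb⟩ := exists_nat_ge (r - 1)
    obtain ⟨n, hn⟩ := condC hred x hreg hJ N hN (N * (b + 1))
    refine (push_t N hN D hD r (max r n) hr (le_max_left _ _)).trans (sup_le le_rfl ?_)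
    refine (Kf_anti (le_max_right _ _)).trans ?_
    rw [Kf_eq_Fr h hq L hL.symm]
    refine hn.trans ?_
    rw [pow_mul]
    refine (Ideal.pow_right_mono hN (b+1)).trans ?_
    rw [pow_succ']
    exact Ideal.mul_mono le_rfl ((pow_le_Kf b).trans (Kf_anti hb))
  obtain ⟨c, hc⟩ := exists_nat_gt D
  refine ⟨c, fun n => (Fr_le_Kf _).trans ?_⟩
  induction n with
  | zero => simp
  | succ n ih =>
    refine (hstep _ ?_).trans ?_
    · push_cast; linarith
    · rw [pow_succ']
      refine Ideal.mul_mono le_rfl ?_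
      convert ih using 2
      push_cast; ring

end
end LI2

namespace LI2

section
variable [CommRing R]

lemma Fr_left {J : Ideal R} (hLB : LBd J) (r : ℝ) (y : R) (hy : ∀ s < r, y ∈ Fr J s) : y ∈ Fr J r := by
  obtain ⟨c, hc⟩ := hLB
  refine mem_Fr_of_lb (c + 1) fun s n hn => ?_
  have h1 : y ∈ Fr J (r - 1/((s:ℝ)+1)) := hy _ (by
    have : 0 < 1/((s:ℝ)+1) := by positivity
    linarith)
  have h2 := Fr_pow h1 s
  refine hc n (Fr_anti ?_ h2)
  have h3 : (s:ℝ) * (1/((s:ℝ)+1)) ≤ 1 := by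
    rw [mul_one_div, div_le_one (by positivity)]; linarith
  push_cast
  nlinarith

variable {d : ℕ} {x : Fin d → R}

lemma pair_step (hq : QR x) (i j : Fin d) (hij : i ≠ j) (k : ℕ) (r : ℝ) (hr0 : 0 ≤ r) (hrk : r < k) (a b : R)
    (ha : a ∈ Fr (gen x) r) (hb : b ∈ Fr (gen x) r) (hab : x j ^ k * a - x i ^ k * b ∈ Fr (gen x) (2 * k)) :
    a ∈ Fr (gen x) (k^2 / (2 * k - r)) := by
  classical
  have hk : (0:ℝ) < k := lt_of_le_of_lt hr0 hrk
  have hden : (0:ℝ) < 2 * k - r := by linarith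
  set δ := x j ^ k * a - x i ^ k * b with hδ
  have hB : x i ^ k * b ∈ Fr (gen x) (k + r) := Fr_mul (pow_le_Fr k (Ideal.pow_mem_pow (x_mem x i) k)) hb
  set B := x i ^ k * b with hBd
  obtain ⟨c1, hc1, h1⟩ := mem_pow_of_mem_Fr hB
  obtain ⟨c2, hc2, h2⟩ := mem_pow_of_mem_Fr hab
  set τ : ℝ := (k - r) / (2 * k - r) with hτ
  have hτ0 : 0 ≤ τ := div_nonneg (by linarith) hden.le
  have hτ1 : τ ≤ 1 := by rw [hτ, div_le_one hden]; linarith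
  set r' : ℝ := k^2 / (2 * k - r) with hr'
  have e1 : k * (1 - τ) = r' := by rw [hτ, hr', eq_div_iff hden.ne', mul_assoc, sub_mul, div_mul_cancel₀ _ hden.ne']; ring
  have e2 : r + (k - r) * τ = r' := by rw [hτ, hr', eq_div_iff hden.ne', add_mul, mul_assoc, div_mul_cancel₀ _ hden.ne']; ring
  refine mem_Fr_of_lb (c1 + c2 + 2) fun s p hp => ?_
  set t := ⌈τ * s⌉₊ with ht
  have ht1 : τ * s ≤ t := Nat.le_ceil _
  have ht2 : (t:ℝ) < τ * s + 1 := Nat.ceil_lt_add_one (by positivity)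
  have hts : t ≤ s := by
    rw [ht, Nat.ceil_le]
    have : (0:ℝ) ≤ s := by positivity
    nlinarith
  set ℓ := s - t + 1 with hℓ
  have hexp : ∃ u, x j ^ (k * s) * a ^ s - x i ^ (k * ℓ) * u ∈ gen x ^ (p + k * s) := by
    have hA : x j ^ (k * s) * a ^ s = (B + δ) ^ s := by
      rw [pow_mul, ← mul_pow]; congr 1; rw [hδ]; ring
    rw [hA, add_pow]
    have : ∀ m ∈ range (s+1), ∃ u, B ^ m * δ ^ (s - m) * (s.choose m : R) - x i ^ (k * ℓ) * u ∈ gen x ^ (p + k * s) := by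
      intro m hm
      have hm' := Finset.mem_range.mp hm
      rcases le_or_gt ℓ m with hlm | hlm
      · obtain ⟨q, rfl⟩ := Nat.exists_eq_add_of_le hlm
        refine ⟨b ^ (ℓ + q) * x i ^ (k * q) * δ ^ (s - (ℓ + q)) * (s.choose (ℓ + q) : R), ?_⟩
        convert Ideal.zero_mem _ using 1
        rw [hBd, mul_pow, ← pow_mul, mul_add, pow_add]; ring
      · refine ⟨0, ?_⟩
        rw [mul_zero, sub_zero]
        refine Ideal.mul_mem_right _ _ ?_
        set m1 := ⌊((k:ℝ) + r) * m - c1⌋₊ with hm1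
        set m2 := ⌊(2 * (k:ℝ)) * ((s - m : ℕ):ℝ) - c2⌋₊ with hm2
        have hB1 : B ^ m ∈ gen x ^ m1 := by
          by_cases h0 : 0 ≤ ((k:ℝ) + r) * m - c1
          · refine h1 m m1 ?_
            have := Nat.floor_le h0
            linarith
          · have : m1 = 0 := Nat.floor_of_nonpos (by linarith)
            rw [this, pow_zero, Ideal.one_eq_top]; trivial
        have hB2 : δ ^ (s - m) ∈ gen x ^ m2 := by
          by_cases h0 : 0 ≤ (2 * (k:ℝ)) * ((s - m : ℕ):ℝ) - c2
          · refine h2 _ m2 ?_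
            have := Nat.floor_le h0
            linarith
          · have : m2 = 0 := Nat.floor_of_nonpos (by linarith)
            rw [this, pow_zero, Ideal.one_eq_top]; trivial
        have h3 := Ideal.mul_mem_mul hB1 hB2
        rw [← pow_add] at h3
        refine Ideal.pow_le_pow_right ?_ h3
        have f1 := Nat.lt_floor_add_one (((k:ℝ) + r) * m - c1)
        have f2 := Nat.lt_floor_add_one ((2 * (k:ℝ)) * ((s - m : ℕ):ℝ) - c2)
        rw [← hm1] at f1
        rw [← hm2, Nat.cast_sub (by omega)] at f2
        have hmt : (m:ℝ) ≤ s - t := by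
          have : m + t ≤ s := by omega
          have : ((m + t : ℕ):ℝ) ≤ s := by exact_mod_cast this
          push_cast at this; linarith
        have f3 : (k - r) * (m:ℝ) ≤ (k - r) * (s - t) := mul_le_mul_of_nonneg_left hmt (by linarith)
        have f4 : (k - r) * (τ * s) ≤ (k - r) * t := mul_le_mul_of_nonneg_left ht1 (by linarith)
        have f5 : r' * s = r * s + (k - r) * (τ * s) := by rw [← e2]; ring
        have : ((p + k * s : ℕ):ℝ) ≤ ((m1 + m2 : ℕ) : ℝ) := by
          push_cast
          nlinarith
        exact_mod_cast this
    choose! u hu using this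
    refine ⟨∑ m ∈ range (s+1), u m, ?_⟩
    rw [Finset.mul_sum, ← Finset.sum_sub_distrib]
    exact sum_mem hu
  obtain ⟨v, hv⟩ := q1' x hq i j hij (k * s) (k * ℓ) p (a ^ s) hexp
  rw [← sub_add_cancel (a ^ s) (x i ^ (k * ℓ) * v)]
  refine add_mem hv (Ideal.mul_mem_right _ _ (Ideal.pow_le_pow_right ?_ (Ideal.pow_mem_pow (x_mem x i) (k * ℓ))))
  have : (p:ℝ) ≤ ((k * ℓ : ℕ):ℝ) := by
    rw [hℓ]; push_cast
    rw [Nat.cast_sub hts]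
    have f5 : r' * s = k * (s - τ * s) := by rw [← e1]; ring
    have f6 : (k:ℝ) * (s - τ * s) ≤ k * (s - t + 1) := mul_le_mul_of_nonneg_left (by linarith) hk.le
    linarith
  exact_mod_cast this

lemma pair_lemma (hq : QR x) (hLB : LBd (gen x)) (i j : Fin d) (hij : i ≠ j) (k : ℕ) (a b : R)
    (hab : x j ^ k * a - x i ^ k * b ∈ Fr (gen x) (2 * k)) : a ∈ Fr (gen x) k ∧ b ∈ Fr (gen x) k := by
  rcases Nat.eq_zero_or_pos k with rfl | hk
  · simp [Fr_nonpos]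
  have hk' : (0:ℝ) < k := by exact_mod_cast hk
  have key : ∀ m : ℕ, a ∈ Fr (gen x) (k * (m / (m + 1))) ∧ b ∈ Fr (gen x) (k * (m / (m + 1))) := by
    intro m
    induction m with
    | zero => simp [Fr_nonpos]
    | succ m ih =>
      have h1 : (0:ℝ) ≤ k * (m / (m + 1)) := by positivity
      have h2 : (k:ℝ) * (m / (m + 1)) < k := by
        have : (m:ℝ) / (m + 1) < 1 := by rw [div_lt_one (by positivity)]; linarith
        nlinarith
      have h3 : (k:ℝ)^2 / (2 * k - k * (m / (m+1))) = k * (((m+1 : ℕ):ℝ) / (((m+1:ℕ):ℝ) + 1)) := by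
        have e : (2 * (k:ℝ) - k * (m / (m+1))) = k * (m + 2) / (m + 1) := by field_simp; ring
        rw [e]; push_cast; field_simp; ring
      rw [← h3]
      refine ⟨pair_step hq i j hij k _ h1 h2 a b ih.1 ih.2 hab, pair_step hq j i hij.symm k _ h1 h2 b a ih.2 ih.1 ?_⟩
      rw [← neg_mem_iff, neg_sub]; exact hab
  have fin : ∀ s < (k:ℝ), ∃ m : ℕ, s ≤ k * (m / (m + 1)) := by
    intro s hs
    obtain ⟨m, hm⟩ := exists_nat_ge (k / (k - s))
    refine ⟨m, ?_⟩
    have h0 : 0 < k - s := by linarith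
    rw [div_le_iff₀ h0] at hm
    rw [← mul_div_assoc, le_div_iff₀ (by positivity)]
    nlinarith
  constructor
  · refine Fr_left hLB _ _ fun s hs => ?_
    obtain ⟨m, hm⟩ := fin s hs
    exact Fr_anti hm (key m).1
  · refine Fr_left hLB _ _ fun s hs => ?_
    obtain ⟨m, hm⟩ := fin s hs
    exact Fr_anti hm (key m).2

end
end LI2

namespace LI2

section
variable [CommRing R]

/-- multiplication between quotients -/
def mu (F G : Ideal R) (u : R) (h : ∀ a ∈ F, u * a ∈ G) : (R ⧸ F) →ₗ[R] (R ⧸ G) :=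
  Submodule.mapQ F G (LinearMap.mulLeft R u) h

lemma mu_mk (F G : Ideal R) (u : R) (h : ∀ a ∈ F, u * a ∈ G) (a : R) :
    mu F G u h (Ideal.Quotient.mk F a) = Ideal.Quotient.mk G (u * a) := rfl

lemma koszul (F1 F2 F3 : Ideal R) (u : Fin 3 → R) (h12 : ∀ i, ∀ a ∈ F1, u i * a ∈ F2) (h23 : ∀ i, ∀ a ∈ F2, u i * a ∈ F3)
    (hinj : ∀ i j, i ≠ j → ∀ a b, u j * a - u i * b ∈ F2 → a ∈ F1 ∧ b ∈ F1) :
    lq F3 + 3 * lq F1 ≤ 3 * lq F2 + lq (Ideal.span (Set.range u) ⊔ F3) := by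
  let m : Fin 3 → (R ⧸ F1) →ₗ[R] (R ⧸ F2) := fun i => mu F1 F2 (u i) (h12 i)
  let f : (Fin 3 → R ⧸ F1) →ₗ[R] (Fin 3 → R ⧸ F2) := LinearMap.pi
    ![(m 1).comp (LinearMap.proj 2) - (m 2).comp (LinearMap.proj 1), (m 2).comp (LinearMap.proj 0) - (m 0).comp (LinearMap.proj 2),
      (m 0).comp (LinearMap.proj 1) - (m 1).comp (LinearMap.proj 0)]
  let g : (Fin 3 → R ⧸ F2) →ₗ[R] (R ⧸ F3) := ∑ i, (mu F2 F3 (u i) (h23 i)).comp (LinearMap.proj i)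
  have hf : Function.Injective f := by
    rw [← LinearMap.ker_eq_bot, LinearMap.ker_eq_bot']
    intro a ha
    have hb : ∀ i, ∃ b, Ideal.Quotient.mk F1 b = a i := fun i => Ideal.Quotient.mk_surjective (a i)
    choose b hb using hb
    have h0 := congrFun ha 0
    have h1 := congrFun ha 1
    simp only [f, LinearMap.pi_apply, Matrix.cons_val_zero, Matrix.cons_val_one, LinearMap.sub_apply, LinearMap.comp_apply,
      LinearMap.proj_apply, Pi.zero_apply, m, ← hb, mu_mk, ← map_sub, Ideal.Quotient.eq_zero_iff_mem] at h0 h1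
    have c0 := hinj 2 1 (by decide) _ _ h0
    have c1 := hinj 0 2 (by decide) _ _ h1
    funext i
    rw [← hb, Pi.zero_apply, Ideal.Quotient.eq_zero_iff_mem]
    fin_cases i
    · exact c1.1
    · exact c0.2
    · exact c0.1
  have hfg : ∀ a, g (f a) = 0 := by
    intro a
    have hb : ∀ i, ∃ b, Ideal.Quotient.mk F1 b = a i := fun i => Ideal.Quotient.mk_surjective (a i)
    choose b hb using hb
    have q0 : f a 0 = Ideal.Quotient.mk F2 (u 1 * b 2 - u 2 * b 1) := by
      show mu F1 F2 (u 1) (h12 1) (a 2) - mu F1 F2 (u 2) (h12 2) (a 1) = _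
      rw [← hb, ← hb, mu_mk, mu_mk, map_sub]
    have q1 : f a 1 = Ideal.Quotient.mk F2 (u 2 * b 0 - u 0 * b 2) := by
      show mu F1 F2 (u 2) (h12 2) (a 0) - mu F1 F2 (u 0) (h12 0) (a 2) = _
      rw [← hb, ← hb, mu_mk, mu_mk, map_sub]
    have q2 : f a 2 = Ideal.Quotient.mk F2 (u 0 * b 1 - u 1 * b 0) := by
      show mu F1 F2 (u 0) (h12 0) (a 1) - mu F1 F2 (u 1) (h12 1) (a 0) = _
      rw [← hb, ← hb, mu_mk, mu_mk, map_sub]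
    simp only [g, LinearMap.sum_apply, Fin.sum_univ_three, LinearMap.comp_apply, LinearMap.proj_apply, LinearMap.add_apply]
    rw [q0, q1, q2, mu_mk, mu_mk, mu_mk, ← map_add, ← map_add, ← map_zero (Ideal.Quotient.mk F3)]
    congr 1
    ring
  have e1 : Module.length R (Fin 3 → R ⧸ F1) ≤ Module.length R (LinearMap.ker g) :=
    Module.length_le_of_injective (f.codRestrict (LinearMap.ker g) hfg) (fun a b h => hf (congrArg Subtype.val h))
  have e2 := Module.length_eq_add_of_exact (LinearMap.ker g).subtype g.rangeRestrict (Submodule.subtype_injective _) g.surjective_rangeRestrict (by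
    intro z
    simp [Subtype.ext_iff])
  have e3 := Module.length_eq_add_of_exact (LinearMap.range g).subtype (LinearMap.range g).mkQ (Submodule.subtype_injective _) (Submodule.mkQ_surjective _) (by
    intro z
    simp)
  have e4 : Module.length R ((R ⧸ F3) ⧸ LinearMap.range g) ≤ lq (Ideal.span (Set.range u) ⊔ F3) := by
    refine Module.length_le_of_surjective (Submodule.liftQ (Ideal.span (Set.range u) ⊔ F3) ((LinearMap.range g).mkQ.comp (Submodule.mkQ F3)) ?_) ?_
    · refine sup_le ?_ ?_
      · rw [Ideal.span_le]
        rintro _ ⟨i, rfl⟩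
        simp only [SetLike.mem_coe, LinearMap.mem_ker, LinearMap.comp_apply, Submodule.mkQ_apply, Submodule.Quotient.mk_eq_zero]
        refine ⟨Pi.single i 1, ?_⟩
        simp only [g, LinearMap.sum_apply, LinearMap.comp_apply, LinearMap.proj_apply]
        rw [Finset.sum_eq_single i]
        · rw [Pi.single_eq_same]
          exact (mu_mk F2 F3 (u i) (h23 i) 1).trans (by rw [mul_one]; rfl)
        · intro j _ hj; rw [Pi.single_eq_of_ne hj, map_zero]
        · intro h; exact absurd (Finset.mem_univ i) h
      · intro a ha
        simp only [LinearMap.mem_ker, LinearMap.comp_apply, Submodule.mkQ_apply]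
        rw [(Submodule.Quotient.mk_eq_zero F3).mpr ha]; rfl
    · intro z
      obtain ⟨y, rfl⟩ := Submodule.mkQ_surjective _ z
      obtain ⟨w, rfl⟩ := Submodule.mkQ_surjective _ y
      exact ⟨Submodule.Quotient.mk w, rfl⟩
  have e5 : ∀ F : Ideal R, Module.length R (Fin 3 → R ⧸ F) = 3 * lq F := by
    intro F
    rw [Module.length_pi]; simp [lq]
  rw [e5] at e1 e2
  calc lq F3 + 3 * lq F1 ≤ (Module.length R (LinearMap.range g) + lq (Ideal.span (Set.range u) ⊔ F3)) + Module.length R (LinearMap.ker g) :=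
        add_le_add (by rw [lq, e3]; exact add_le_add le_rfl e4) e1
    _ = 3 * lq F2 + lq (Ideal.span (Set.range u) ⊔ F3) := by rw [e2]; ring

lemma lq_mul_le (T : Ideal R) (a b : R) : lq (Ideal.span {a * b} ⊔ T) ≤ lq (Ideal.span {a} ⊔ T) + lq (Ideal.span {b} ⊔ T) := by
  rw [lq_col _ a, add_comm]
  refine add_le_add (lq_anti ?_) (lq_anti ?_)
  · refine sup_le le_sup_right (le_sup_right.trans le_sup_left)
  · refine sup_le ?_ ?_
    · rw [Ideal.span_singleton_le_iff_mem, mem_col]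
      exact Ideal.mem_sup_left (Ideal.mem_span_singleton_self _)
    · intro t ht
      rw [mem_col]
      exact Ideal.mem_sup_right (Ideal.mul_mem_left _ _ ht)

lemma lq_pow_le (T : Ideal R) (a : R) (k : ℕ) : lq (Ideal.span {a ^ k} ⊔ T) ≤ k * lq (Ideal.span {a} ⊔ T) := by
  induction k with
  | zero => simp [lq_top]
  | succ k ih =>
    rw [pow_succ]
    refine (lq_mul_le T _ _).trans ?_
    push_cast
    rw [add_mul, one_mul]
    exact add_le_add ih le_rfl

lemma colon_step (T : Ideal R) (z : R) (hz : ∀ y, z * y ∈ T → y ∈ T) (k : ℕ) (c : R) (h : c * z ^ k ∈ Ideal.span {z ^ (k+1)} ⊔ T) :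
    c ∈ Ideal.span {z} ⊔ T := by
  obtain ⟨y, hy, t, ht, he⟩ := Submodule.mem_sup.mp h
  obtain ⟨w, rfl⟩ := Ideal.mem_span_singleton'.mp hy
  have hz' : ∀ k y, z ^ k * y ∈ T → y ∈ T := by
    intro k
    induction k with
    | zero => intro y h; simpa using h
    | succ k ih => intro y h; rw [pow_succ, mul_assoc] at h; exact hz _ (ih _ h)
  have h1 : c - w * z ∈ T := by
    apply hz' k
    rw [show z ^ k * (c - w * z) = t by rw [mul_sub, mul_comm _ c, ← he]; ring]
    exact ht
  rw [← sub_add_cancel c (w * z)]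
  exact add_mem (Ideal.mem_sup_right h1) (Ideal.mem_sup_left (Ideal.mul_mem_left _ _ (Ideal.mem_span_singleton_self z)))

end
end LI2

namespace LI2

lemma cubic_absurd (A B C : ℤ) (N : ℕ) (h : ∀ n : ℕ, N ≤ n → (n:ℤ)^3 ≤ A * n^2 + B * n + C) : False := by
  have h1 := h (N + A.natAbs + B.natAbs + C.natAbs + 1) (by omega)
  generalize hn : N + A.natAbs + B.natAbs + C.natAbs + 1 = n at h1
  have hn' : |A| + |B| + |C| + 1 ≤ (n:ℤ) := by
    rw [← hn]; push_cast; have := Int.natCast_natAbs A; omega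
  have hA := le_abs_self A
  have hB := le_abs_self B
  have hC := le_abs_self C
  have hA' := abs_nonneg A
  have hB' := abs_nonneg B
  have hC' := abs_nonneg C
  have n1 : (1:ℤ) ≤ n := by linarith
  have t1 : A * (n:ℤ)^2 ≤ |A| * (n:ℤ)^2 := mul_le_mul_of_nonneg_right hA (by positivity)
  have t2 : B * (n:ℤ) ≤ |B| * (n:ℤ)^2 := by nlinarith [mul_nonneg hB' (by nlinarith : (0:ℤ) ≤ (n:ℤ)^2 - n), mul_le_mul_of_nonneg_right hB (by linarith : (0:ℤ) ≤ n)]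
  have t3 : C ≤ |C| * (n:ℤ)^2 := by nlinarith [mul_nonneg hC' (by nlinarith : (0:ℤ) ≤ (n:ℤ)^2 - 1)]
  have t4 : (|A| + |B| + |C| + 1) * (n:ℤ)^2 ≤ n * (n:ℤ)^2 := mul_le_mul_of_nonneg_right hn' (by positivity)
  nlinarith

lemma ch3 (n : ℕ) : 6 * (((n+2).choose 3 : ℕ) : ℤ) = n * (n+1) * (n+2) := by
  induction n with
  | zero => simp
  | succ n ih =>
    have h2 : ∀ n : ℕ, 2 * (((n+1).choose 2 : ℕ) : ℤ) = n * (n+1) := by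
      intro n
      induction n with
      | zero => simp
      | succ n ih => rw [Nat.choose_succ_succ' (n+1) 1]; push_cast; simp; linarith
    rw [Nat.choose_succ_succ' (n+2) 2]
    have := h2 (n+1)
    push_cast at *
    linarith

lemma ch2 (n : ℕ) : 2 * (((n+1).choose 2 : ℕ) : ℤ) = n * (n+1) := by
  induction n with
  | zero => simp
  | succ n ih => rw [Nat.choose_succ_succ' (n+1) 1]; push_cast; simp; linarith

section
variable [CommRing R]

/-- the normal Hilbert polynomial hypothesis -/
def Hil (d : ℕ) (x : Fin d → R) : Prop := ∃ (e : ℕ → ℤ) (N0 : ℕ), e 3 = 0 ∧ ∀ n ≥ N0, ∃ l : ℕ,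
  lq (Fr (gen x) ((n+1:ℕ):ℝ)) = l ∧ (l:ℤ) = ∑ i ∈ range (d+1), (-1:ℤ)^i * e i * ((n+d-i).choose (d-i) : ℤ)

lemma Hil_three {x : Fin 3 → R} (h : Hil 3 x) : ∃ (e0 e1 e2 : ℤ) (N0 : ℕ), ∀ n ≥ N0, ∃ l : ℕ,
    lq (Fr (gen x) (n:ℝ)) = l ∧ 6 * (l:ℤ) = e0 * (n * (n+1) * (n+2)) - 3 * e1 * (n * (n+1)) + 6 * e2 * n := by
  obtain ⟨e, N0, h3, h⟩ := h
  refine ⟨e 0, e 1, e 2, N0 + 1, fun n hn => ?_⟩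
  obtain ⟨k, rfl⟩ : ∃ k, n = k + 1 := ⟨n - 1, by omega⟩
  obtain ⟨l, h1, h2⟩ := h k (by omega)
  refine ⟨l, h1, ?_⟩
  have e1 := ch3 (k+1)
  have e2 := ch2 (k+1)
  simp only [Finset.sum_range_succ, Finset.sum_range_zero, h3] at h2
  rw [show k + 3 - 0 = k + 1 + 2 by omega, show k + 3 - 1 = k + 1 + 1 by omega, show k + 3 - 2 = k + 1 by omega] at h2
  norm_num at h2
  push_cast at *
  rw [h2]
  linear_combination (e 0) * e1 - 3 * (e 1) * e2

lemma reg_mod [IsLocalRing R] [IsNoetherianRing R] (x : Fin 3 → R) (hreg : RingTheory.Sequence.IsRegular R (List.ofFn x))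
    (hJ : gen x ≤ maximalIdeal R) (N : ℕ) (hN : maximalIdeal R ^ N ≤ gen x)
    (a b z : R) (ha : a ∈ maximalIdeal R) (hb : b ∈ maximalIdeal R) (hz : z ∈ maximalIdeal R)
    (hrad : ∀ i, x i ∈ (Ideal.span {a} ⊔ Ideal.span {b} ⊔ Ideal.span {z}).radical) :
    ∀ y, z * y ∈ Ideal.span {a} ⊔ Ideal.span {b} → y ∈ Ideal.span {a} ⊔ Ideal.span {b} := by
  have h1 : gen x ≤ (Ideal.span {a} ⊔ Ideal.span {b} ⊔ Ideal.span {z}).radical := by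
    rw [gen, Ideal.span_le]; rintro _ ⟨i, rfl⟩; exact hrad i
  obtain ⟨M, hM⟩ := Ideal.exists_pow_le_of_le_radical_of_fg h1 (IsNoetherian.noetherian _)
  have h2 : RingTheory.Sequence.IsRegular R [a, b, z] := by
    refine sop_regular 3 R (List.ofFn x) (by simp) ?_ hreg [a, b, z] (by simp) (by intro r hr; simp only [List.mem_cons, List.not_mem_nil, or_false] at hr; rcases hr with rfl | rfl | rfl <;> assumption) (N * M) ?_
    · intro r hr
      obtain ⟨i, rfl⟩ := (List.mem_ofFn' _ _).mp hr
      exact hJ (x_mem x i)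
    · refine le_trans ?_ le_sup_left
      rw [pow_mul]
      refine (Ideal.pow_right_mono hN M).trans (hM.trans ?_)
      simp only [Ideal.ofList_cons, Ideal.ofList_nil, sup_bot_eq, sup_assoc, le_refl]
  have h3 := h2.toIsWeaklyRegular.regular_mod_prev 2 (by simp)
  intro y hy
  have e : (Ideal.ofList (List.take 2 [a, b, z]) • (⊤ : Submodule R R)) = Ideal.span {a} ⊔ Ideal.span {b} := by
    simp [Ideal.ofList_cons, Ideal.ofList_nil]
  rw [e] at h3
  have := @h3 (Submodule.Quotient.mk y) 0 (by
    simp only [smul_zero, ← Submodule.Quotient.mk_smul]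
    rw [Submodule.Quotient.mk_eq_zero]; exact hy)
  exact (Submodule.Quotient.mk_eq_zero _).mp this

lemma dim_three [IsLocalRing R] [IsNoetherianRing R] (x : Fin 3 → R) (hreg : RingTheory.Sequence.IsRegular R (List.ofFn x))
    (hJ : gen x ≤ maximalIdeal R) (N : ℕ) (hN : maximalIdeal R ^ N ≤ gen x) (hLB : LBd (gen x)) (hH : Hil 3 x) :
    Fr (gen x) 3 ≤ gen x := by
  have hq := qr_of_regular x hreg
  obtain ⟨e0, e1, e2, N0, h⟩ := Hil_three hH
  obtain ⟨L, hL⟩ := ENat.ne_top_iff_exists.mp (lq_ne_top N hN)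
  have hfin : ∀ n : ℕ, lq (Fr (gen x) n) ≠ ⊤ := fun n => lq_ne_top (N * n) (by
    rw [pow_mul]; exact (Ideal.pow_right_mono hN n).trans (pow_le_Fr n))
  -- multiplicity
  have he0 : (L:ℤ) ≤ e0 := by
    obtain ⟨c, hc⟩ := hLB
    by_contra hlt
    refine cubic_absurd (3*c*e0-3*e1-3) (e0*(3*c^2+6*c)-3*e1*(2*c+1)+6*e2-2) (e0*(c^3+3*c^2+2*c)-3*e1*(c^2+c)+6*e2*c) N0 fun n hn => ?_
    obtain ⟨l, h1, h2⟩ := h (n + c) (by omega)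
    have h3 := lq_anti (hc n)
    rw [lq_pow_eq x hq, sum_HF, ← hL, h1, nsmul_eq_mul] at h3
    have h4 : (n+2).choose 3 * L ≤ l := by exact_mod_cast h3
    have h4' : (((n+2).choose 3 : ℕ) : ℤ) * L ≤ l := by exact_mod_cast h4
    have h5 := ch3 n
    have h6 : (e0 + 1) * ((n:ℤ) * (n+1) * (n+2)) ≤ L * ((n:ℤ) * (n+1) * (n+2)) :=
      mul_le_mul_of_nonneg_right (by omega) (by positivity)
    have h7 : L * ((n:ℤ) * (n+1) * (n+2)) = 6 * ((((n+2).choose 3 : ℕ) : ℤ) * L) := by rw [← h5]; ring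
    push_cast at h2
    nlinarith
  -- main inclusion
  obtain ⟨k, hk⟩ : ∃ k, k = N0 + 1 := ⟨_, rfl⟩
  have hincl : Fr (gen x) (3 * (k:ℝ)) ≤ Ideal.span (Set.range fun i => x i ^ k) := by
    have hxk : ∀ i, x i ^ k ∈ Fr (gen x) (k:ℝ) := fun i => pow_le_Fr k (Ideal.pow_mem_pow (x_mem x i) k)
    have hk1 := koszul (Fr (gen x) (k:ℝ)) (Fr (gen x) (2 * (k:ℝ))) (Fr (gen x) (3 * (k:ℝ))) (fun i => x i ^ k)
      (fun i a ha => by have := Fr_mul (hxk i) ha; rwa [← two_mul] at this)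
      (fun i a ha => by have := Fr_mul (hxk i) ha; rwa [show (k:ℝ) + 2 * k = 3 * k by ring] at this)
      (fun i j hij a b hab => pair_lemma hq hLB i j hij k a b hab)
    obtain ⟨l1, a1, b1⟩ := h k (by omega)
    obtain ⟨l2, a2, b2⟩ := h (2 * k) (by omega)
    obtain ⟨l3, a3, b3⟩ := h (3 * k) (by omega)
    push_cast at a2 a3
    rw [a1, a2, a3] at hk1
    have hQ : lq (Ideal.span (Set.range fun i => x i ^ k)) ≤ ((k ^ 3 * L : ℕ) : ℕ∞) := by
      have g1 : Ideal.span (Set.range fun i => x i ^ k) = Ideal.span {x 0 ^ k} ⊔ (Ideal.span {x 1 ^ k} ⊔ Ideal.span {x 2 ^ k}) := by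
        rw [← Ideal.span_union, ← Ideal.span_union]; congr 1; ext y; simp [Fin.exists_fin_succ, eq_comm]; tauto
      have g2 : gen x = Ideal.span {x 0} ⊔ (Ideal.span {x 1} ⊔ Ideal.span {x 2}) := by
        rw [gen, ← Ideal.span_union, ← Ideal.span_union]; congr 1; ext y; simp [Fin.exists_fin_succ, eq_comm]; tauto
      have s1 := lq_pow_le (Ideal.span {x 1 ^ k} ⊔ Ideal.span {x 2 ^ k}) (x 0) k
      have s2 := lq_pow_le (Ideal.span {x 0} ⊔ Ideal.span {x 2 ^ k}) (x 1) k
      have s3 := lq_pow_le (Ideal.span {x 0} ⊔ Ideal.span {x 1}) (x 2) k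
      rw [show Ideal.span {x 0} ⊔ (Ideal.span {x 1 ^ k} ⊔ Ideal.span {x 2 ^ k}) = Ideal.span {x 1 ^ k} ⊔ (Ideal.span {x 0} ⊔ Ideal.span {x 2 ^ k}) from sup_left_comm _ _ _] at s1
      rw [show Ideal.span {x 1} ⊔ (Ideal.span {x 0} ⊔ Ideal.span {x 2 ^ k}) = Ideal.span {x 2 ^ k} ⊔ (Ideal.span {x 0} ⊔ Ideal.span {x 1}) by ac_rfl] at s2
      rw [show Ideal.span {x 2} ⊔ (Ideal.span {x 0} ⊔ Ideal.span {x 1}) = gen x by rw [g2]; ac_rfl, ← hL] at s3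
      rw [g1]
      refine s1.trans ?_
      refine (mul_le_mul_right s2 _).trans ?_
      refine (mul_le_mul_right (mul_le_mul_right s3 _) _).trans (le_of_eq ?_)
      push_cast; ring
    obtain ⟨q, hqq⟩ := ENat.ne_top_iff_exists.mp (ne_top_of_le_ne_top (ENat.coe_ne_top _) hQ)
    have hle : lq (Ideal.span (Set.range fun i => x i ^ k) ⊔ Fr (gen x) (3 * (k:ℝ))) ≤ q := by
      rw [hqq]; exact lq_anti le_sup_left
    obtain ⟨q', hq'⟩ := ENat.ne_top_iff_exists.mp (ne_top_of_le_ne_top (ENat.coe_ne_top _) hle)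
    rw [← hq'] at hk1
    rw [← hqq] at hQ
    have k1 : l3 + 3 * l1 ≤ 3 * l2 + q' := by exact_mod_cast hk1
    have k2 : q ≤ k ^ 3 * L := by exact_mod_cast hQ
    have k1' : (l3:ℤ) + 3 * l1 ≤ 3 * l2 + q' := by exact_mod_cast k1
    have k2' : (q:ℤ) ≤ k ^ 3 * L := by exact_mod_cast k2
    have k3 : (k:ℤ) ^ 3 * L ≤ k ^ 3 * e0 := mul_le_mul_of_nonneg_left he0 (by positivity)
    have k4 : (q:ℤ) ≤ q' := by
      push_cast at b1 b2 b3
      nlinarith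
    have := eq_of_lq (K := Ideal.span (Set.range fun i => x i ^ k)) (I := Ideal.span (Set.range fun i => x i ^ k) ⊔ Fr (gen x) (3 * (k:ℝ)))
      le_sup_left (by rw [← hqq, ← hq']; exact_mod_cast k4) (by rw [← hqq]; exact ENat.coe_ne_top _)
    rw [this]; exact le_sup_right
  intro a ha
  have hxm : ∀ i, x i ∈ maximalIdeal R := fun i => hJ (x_mem x i)
  have hxmk : ∀ i, x i ^ k ∈ maximalIdeal R := fun i => Ideal.pow_mem_of_mem _ (hxm i) k (by omega)
  have m0 : a * (x 0 * x 1 * x 2) ^ N0 ∈ Fr (gen x) (3 * (k:ℝ)) := by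
    have t : (x 0 * x 1 * x 2) ^ N0 ∈ Fr (gen x) (((3 * N0 : ℕ):ℕ):ℝ) := by
      refine pow_le_Fr _ ?_
      rw [pow_mul]
      refine Ideal.pow_mem_pow ?_ _
      rw [pow_succ, pow_two]
      exact Ideal.mul_mem_mul (Ideal.mul_mem_mul (x_mem x 0) (x_mem x 1)) (x_mem x 2)
    have := Fr_mul ha t
    rwa [show (3:ℝ) + ((3 * N0 : ℕ):ℝ) = 3 * k by rw [hk]; push_cast; ring] at this
  have m1 := hincl m0
  have g1 : Ideal.span (Set.range fun i => x i ^ k) = Ideal.span {x 0 ^ k} ⊔ (Ideal.span {x 1 ^ k} ⊔ Ideal.span {x 2 ^ k}) := by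
    rw [← Ideal.span_union, ← Ideal.span_union]; congr 1; ext y; simp [Fin.exists_fin_succ, eq_comm]; tauto
  have g2 : gen x = Ideal.span {x 0} ⊔ (Ideal.span {x 1} ⊔ Ideal.span {x 2}) := by
    rw [gen, ← Ideal.span_union, ← Ideal.span_union]; congr 1; ext y; simp [Fin.exists_fin_succ, eq_comm]; tauto
  have hs : ∀ (T : Ideal R) (i : Fin 3), x i ∈ T → x i ∈ T.radical := fun T i h => Ideal.le_radical h
  have hs' : ∀ (T : Ideal R) (i : Fin 3), x i ^ k ∈ T → x i ∈ T.radical := fun T i h => ⟨k, h⟩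
  have l1 : ∀ (A B C : Ideal R) (y : R), y ∈ A → y ∈ A ⊔ B ⊔ C := fun A B C y h => Ideal.mem_sup_left (Ideal.mem_sup_left h)
  have l2 : ∀ (A B C : Ideal R) (y : R), y ∈ B → y ∈ A ⊔ B ⊔ C := fun A B C y h => Ideal.mem_sup_left (Ideal.mem_sup_right h)
  have l3 : ∀ (A B C : Ideal R) (y : R), y ∈ C → y ∈ A ⊔ B ⊔ C := fun A B C y h => Ideal.mem_sup_right h
  have r0 := reg_mod x hreg hJ N hN (x 1 ^ k) (x 2 ^ k) (x 0) (hxmk 1) (hxmk 2) (hxm 0) (by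
    intro i
    fin_cases i
    · exact hs _ _ (l3 _ _ _ _ (Ideal.mem_span_singleton_self _))
    · exact hs' _ 1 (l1 _ _ _ _ (Ideal.mem_span_singleton_self _))
    · exact hs' _ 2 (l2 _ _ _ _ (Ideal.mem_span_singleton_self _)))
  have r1 := reg_mod x hreg hJ N hN (x 0) (x 2 ^ k) (x 1) (hxm 0) (hxmk 2) (hxm 1) (by
    intro i
    fin_cases i
    · exact hs _ _ (l1 _ _ _ _ (Ideal.mem_span_singleton_self _))
    · exact hs _ 1 (l3 _ _ _ _ (Ideal.mem_span_singleton_self _))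
    · exact hs' _ 2 (l2 _ _ _ _ (Ideal.mem_span_singleton_self _)))
  have r2 := reg_mod x hreg hJ N hN (x 0) (x 1) (x 2) (hxm 0) (hxm 1) (hxm 2) (by
    intro i
    fin_cases i
    · exact hs _ _ (l1 _ _ _ _ (Ideal.mem_span_singleton_self _))
    · exact hs _ 1 (l2 _ _ _ _ (Ideal.mem_span_singleton_self _))
    · exact hs _ 2 (l3 _ _ _ _ (Ideal.mem_span_singleton_self _)))
  rw [g1, show a * (x 0 * x 1 * x 2) ^ N0 = (a * (x 1 * x 2) ^ N0) * x 0 ^ N0 by ring, hk] at m1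
  rw [hk] at r0 r1
  have m2 := colon_step _ _ r0 N0 _ m1
  rw [show Ideal.span {x 0} ⊔ (Ideal.span {x 1 ^ (N0+1)} ⊔ Ideal.span {x 2 ^ (N0+1)}) = Ideal.span {x 1 ^ (N0+1)} ⊔ (Ideal.span {x 0} ⊔ Ideal.span {x 2 ^ (N0+1)}) from sup_left_comm _ _ _,
    show a * (x 1 * x 2) ^ N0 = (a * x 2 ^ N0) * x 1 ^ N0 by ring] at m2
  have m3 := colon_step _ _ r1 N0 _ m2
  rw [show Ideal.span {x 1} ⊔ (Ideal.span {x 0} ⊔ Ideal.span {x 2 ^ (N0+1)}) = Ideal.span {x 2 ^ (N0+1)} ⊔ (Ideal.span {x 0} ⊔ Ideal.span {x 1}) by ac_rfl] at m3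
  have m4 := colon_step _ _ r2 N0 _ m3
  rw [show Ideal.span {x 2} ⊔ (Ideal.span {x 0} ⊔ Ideal.span {x 1}) = gen x by rw [g2]; ac_rfl] at m4
  exact m4

end
end LI2

namespace LI2
section
variable [CommRing R]

lemma Fr_poly_coeff {d : ℕ} (J : Ideal R) (r : ℝ) (g : MvPolynomial (Fin d) R)
    (hg : g ∈ Fr (J.map (MvPolynomial.C (σ := Fin d))) r) : g ∈ (Fr J r).map (MvPolynomial.C (σ := Fin d)) := by
  let o : MonomialOrder (Fin d) := MonomialOrder.lex
  obtain ⟨D, hD⟩ : ∃ D, D = o.toSyn (o.degree g) := ⟨_, rfl⟩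
  induction D using WellFoundedLT.induction generalizing g with
  | ind D ih =>
  have hlc : o.leadingCoeff g ∈ Fr J r := by
    obtain ⟨c, hc⟩ := hg
    refine ⟨c, fun s => ?_⟩
    have := hc s
    rw [← Ideal.map_pow, MvPolynomial.mem_map_C_iff] at this
    have := this (s • o.degree g)
    rwa [MonomialOrder.coeff_pow_nsmul_degree] at this
  have hlt : o.leadingTerm g ∈ (Fr J r).map (MvPolynomial.C (σ := Fin d)) := by
    rw [MvPolynomial.mem_map_C_iff]
    intro m
    rw [MonomialOrder.leadingTerm, MvPolynomial.coeff_monomial]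
    split_ifs
    · exact hlc
    · exact zero_mem _
  have hle : (Fr J r).map (MvPolynomial.C (σ := Fin d)) ≤ Fr (J.map (MvPolynomial.C (σ := Fin d))) r :=
    Ideal.map_le_iff_le_comap.mpr fun y hy => Fr_map _ r hy
  by_cases h0 : o.degree g = 0
  · have : g = o.leadingTerm g := by
      rw [MonomialOrder.leadingTerm, h0]
      exact MonomialOrder.eq_C_of_degree_eq_zero h0
    rw [this]; exact hlt
  · have h1 := MonomialOrder.degree_sub_leadingTerm_lt_degree (m := o) h0
    have h2 := ih _ (hD ▸ h1) (g - o.leadingTerm g) (sub_mem hg (hle hlt)) rfl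
    have := add_mem h2 hlt
    rwa [sub_add_cancel] at this

/-- the generic linear form -/
noncomputable def ell {d : ℕ} (x : Fin (d+1) → R) : MvPolynomial (Fin d) R :=
  MvPolynomial.C (x (Fin.last d)) - ∑ j, MvPolynomial.X j * MvPolynomial.C (x j.castSucc)

lemma ell_colon {d : ℕ} (x : Fin (d+1) → R) (hq : QR x) (r : ℝ) (ψ : MvPolynomial (Fin d) R)
    (h : ell x * ψ ∈ (Fr (gen x) (r + 1)).map (MvPolynomial.C (σ := Fin d))) :
    ψ ∈ (Fr (gen x) r).map (MvPolynomial.C (σ := Fin d)) := by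
  classical
  rw [MvPolynomial.mem_map_C_iff] at h ⊢
  intro m
  obtain ⟨k, hk⟩ : ∃ k, k = m.degree := ⟨_, rfl⟩
  induction k using Nat.strong_induction_on generalizing m with
  | _ k ih =>
  have h1 := h m
  rw [ell, sub_mul, MvPolynomial.coeff_sub, MvPolynomial.coeff_C_mul, Finset.sum_mul, MvPolynomial.coeff_sum] at h1
  have h2 : ∑ j, MvPolynomial.coeff m (MvPolynomial.X j * MvPolynomial.C (x j.castSucc) * ψ) ∈ Fr (gen x) (r + 1) := by
    refine sum_mem fun j _ => ?_
    rw [mul_assoc, MvPolynomial.coeff_X_mul']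
    split_ifs with hj
    · rw [MvPolynomial.coeff_C_mul, mul_comm]
      refine Fr_mul (ih _ ?_ _ rfl) (le_Fr_one (x_mem x _))
      have hj' : Finsupp.single j 1 ≤ m := by
        rw [Finsupp.single_le_iff]
        exact Nat.one_le_iff_ne_zero.mpr (Finsupp.mem_support_iff.mp hj)
      have : (m - Finsupp.single j 1).degree + (Finsupp.single j 1).degree = m.degree := by
        rw [← map_add, tsub_add_cancel_of_le hj']
      rw [Finsupp.degree_single] at this
      omega
    · exact zero_mem _
  have h3 := add_mem h1 h2
  rw [sub_add_cancel] at h3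
  exact Fr_colon_var x hq (Fin.last d) 1 r _ (by simpa using h3)

lemma omega_exists {d : ℕ} (x : Fin (d+1) → R) (i : Fin d) {S : Type*} [CommRing S] (ι θ : MvPolynomial (Fin d) R →+* S)
    (hC : ∀ a, θ (MvPolynomial.C a) = ι (MvPolynomial.C a)) (hX : ∀ j, j ≠ i → θ (MvPolynomial.X j) = ι (MvPolynomial.X j))
    (hXi : ι (MvPolynomial.C (x i.castSucc)) * θ (MvPolynomial.X i) = ι (MvPolynomial.C (x (Fin.last d)) -
      ∑ j ∈ univ.erase i, MvPolynomial.X j * MvPolynomial.C (x j.castSucc)))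
    (φ : MvPolynomial (Fin d) R) : ∃ D0, ∀ D ≥ D0, ∃ Ω : MvPolynomial (Fin (d+1)) (MvPolynomial (Fin d) R),
      Ω.IsHomogeneous D ∧ ι (MvPolynomial.eval (fun k => MvPolynomial.C (x k)) Ω) = ι (MvPolynomial.C (x i.castSucc)) ^ D * θ φ ∧
      MvPolynomial.eval (Fin.lastCases (MvPolynomial.X i) (fun j => if j = i then 1 else 0)) Ω = φ ∧
      MvPolynomial.eval (fun k => MvPolynomial.C (x k)) Ω - MvPolynomial.C (x i.castSucc) ^ D * φ ∈ Ideal.span {ell x} := by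
  classical
  induction φ using MvPolynomial.induction_on with
  | C a =>
    refine ⟨0, fun D _ => ⟨MvPolynomial.C (MvPolynomial.C a) * MvPolynomial.X i.castSucc ^ D, ?_, ?_, ?_, ?_⟩⟩
    · have := (MvPolynomial.isHomogeneous_C (Fin (d+1)) (MvPolynomial.C (σ := Fin d) a)).mul ((MvPolynomial.isHomogeneous_X (MvPolynomial (Fin d) R) i.castSucc).pow D)
      simpa using this
    · simp [hC, mul_comm]
    · simp
    · simp [mul_comm]
  | add p q hp hq =>
    obtain ⟨D1, h1⟩ := hp
    obtain ⟨D2, h2⟩ := hq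
    refine ⟨max D1 D2, fun D hD => ?_⟩
    obtain ⟨Ω1, a1, b1, c1, e1⟩ := h1 D (le_trans (le_max_left _ _) hD)
    obtain ⟨Ω2, a2, b2, c2, e2⟩ := h2 D (le_trans (le_max_right _ _) hD)
    refine ⟨Ω1 + Ω2, a1.add a2, ?_, ?_, ?_⟩
    · rw [map_add, map_add, b1, b2, map_add, mul_add]
    · rw [map_add, c1, c2]
    · rw [map_add, mul_add, add_sub_add_comm]; exact add_mem e1 e2
  | mul_X p j hp =>
    obtain ⟨D1, h1⟩ := hp
    by_cases hj : j = i
    · subst hj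
      refine ⟨D1 + 1, fun D hD => ?_⟩
      obtain ⟨E, rfl⟩ : ∃ E, D = E + 1 := ⟨D - 1, by omega⟩
      obtain ⟨Ω1, a1, b1, c1, e1⟩ := h1 E (by omega)
      have hev : MvPolynomial.eval (fun k => MvPolynomial.C (x k)) (MvPolynomial.X (Fin.last d) - ∑ k ∈ univ.erase j, MvPolynomial.C (MvPolynomial.X k) * MvPolynomial.X k.castSucc) =
          MvPolynomial.C (x (Fin.last d)) - ∑ k ∈ univ.erase j, MvPolynomial.X k * MvPolynomial.C (x k.castSucc) := by
        simp only [map_sub, map_sum, map_mul, MvPolynomial.eval_X, MvPolynomial.eval_C]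
      have hell : MvPolynomial.C (x (Fin.last d)) - ∑ k ∈ univ.erase j, MvPolynomial.X k * MvPolynomial.C (x k.castSucc) =
          ell x + MvPolynomial.X j * MvPolynomial.C (x j.castSucc) := by
        rw [ell, ← Finset.add_sum_erase univ _ (Finset.mem_univ j)]; ring
      refine ⟨Ω1 * (MvPolynomial.X (Fin.last d) - ∑ k ∈ univ.erase j, MvPolynomial.C (MvPolynomial.X k) * MvPolynomial.X k.castSucc), a1.mul ?_, ?_, ?_, ?_⟩
      · refine (MvPolynomial.isHomogeneous_X _ _).sub (MvPolynomial.IsHomogeneous.sum _ _ _ fun k _ => ?_)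
        have := (MvPolynomial.isHomogeneous_C (Fin (d+1)) (MvPolynomial.X (R := R) k)).mul (MvPolynomial.isHomogeneous_X (MvPolynomial (Fin d) R) k.castSucc)
        simpa using this
      · rw [map_mul, hev, map_mul, b1, ← hXi, map_mul]; ring
      · rw [map_mul, c1, map_sub, map_sum]
        simp only [map_mul, MvPolynomial.eval_X, MvPolynomial.eval_C, Fin.lastCases_last, Fin.lastCases_castSucc]
        rw [Finset.sum_eq_zero, sub_zero]
        intro k hk
        rw [if_neg (Finset.ne_of_mem_erase hk), mul_zero]
      · rw [map_mul, hev, hell]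
        obtain ⟨z, hz⟩ := Ideal.mem_span_singleton'.mp e1
        refine Ideal.mem_span_singleton'.mpr ⟨MvPolynomial.eval (fun k => MvPolynomial.C (x k)) Ω1 + z * (MvPolynomial.X j * MvPolynomial.C (x j.castSucc)), ?_⟩
        linear_combination (MvPolynomial.X j * MvPolynomial.C (x j.castSucc)) * hz
    · refine ⟨D1, fun D hD => ?_⟩
      obtain ⟨Ω1, a1, b1, c1, e1⟩ := h1 D hD
      refine ⟨Ω1 * MvPolynomial.C (MvPolynomial.X j), ?_, ?_, ?_, ?_⟩
      · simpa using a1.mul (MvPolynomial.isHomogeneous_C (Fin (d+1)) (MvPolynomial.X (R := R) j))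
      · rw [map_mul, map_mul, b1, map_mul, hX j hj, MvPolynomial.eval_C]; ring
      · rw [map_mul, c1, MvPolynomial.eval_C]
      · rw [map_mul, MvPolynomial.eval_C, ← mul_assoc, ← sub_mul]; exact Ideal.mul_mem_right _ _ e1

end
end LI2

namespace LI2
section
variable [CommRing R]

lemma theta_ell {d : ℕ} (x : Fin (d+1) → R) (i : Fin d) {S : Type*} [CommRing S] (ι θ : MvPolynomial (Fin d) R →+* S)
    (hC : ∀ a, θ (MvPolynomial.C a) = ι (MvPolynomial.C a)) (hX : ∀ j, j ≠ i → θ (MvPolynomial.X j) = ι (MvPolynomial.X j))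
    (hXi : ι (MvPolynomial.C (x i.castSucc)) * θ (MvPolynomial.X i) = ι (MvPolynomial.C (x (Fin.last d)) -
      ∑ j ∈ univ.erase i, MvPolynomial.X j * MvPolynomial.C (x j.castSucc))) : θ (ell x) = 0 := by
  have h1 : ∑ j ∈ univ.erase i, θ (MvPolynomial.X j * MvPolynomial.C (x j.castSucc)) =
      ∑ j ∈ univ.erase i, ι (MvPolynomial.X j * MvPolynomial.C (x j.castSucc)) :=
    Finset.sum_congr rfl (fun j hj => by rw [map_mul, hX j (Finset.ne_of_mem_erase hj), hC, ← map_mul])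
  rw [ell, map_sub, map_sum, ← Finset.add_sum_erase univ _ (Finset.mem_univ i), hC, h1, map_mul, hC, mul_comm, hXi, map_sub, map_sum]
  ring

lemma theta_exists {d : ℕ} (x : Fin (d+1) → R) (i : Fin d) (hnz : ∀ y, x i.castSucc * y = 0 → y = 0) :
    ∃ (ι θ : MvPolynomial (Fin d) R →+* Localization.Away (MvPolynomial.C (x i.castSucc) : MvPolynomial (Fin d) R)), Function.Injective ι ∧
    (∀ a, θ (MvPolynomial.C a) = ι (MvPolynomial.C a)) ∧ (∀ j, j ≠ i → θ (MvPolynomial.X j) = ι (MvPolynomial.X j)) ∧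
    (ι (MvPolynomial.C (x i.castSucc)) * θ (MvPolynomial.X i) = ι (MvPolynomial.C (x (Fin.last d)) -
      ∑ j ∈ univ.erase i, MvPolynomial.X j * MvPolynomial.C (x j.castSucc))) := by
  classical
  let S := Localization.Away (MvPolynomial.C (x i.castSucc) : MvPolynomial (Fin d) R)
  let ι : MvPolynomial (Fin d) R →+* S := algebraMap _ _
  let t : S := ι (MvPolynomial.C (x (Fin.last d)) - ∑ j ∈ univ.erase i, MvPolynomial.X j * MvPolynomial.C (x j.castSucc))
    * IsLocalization.Away.invSelf (MvPolynomial.C (x i.castSucc) : MvPolynomial (Fin d) R)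
  let θ : MvPolynomial (Fin d) R →+* S := MvPolynomial.eval₂Hom (ι.comp MvPolynomial.C) (fun j => if j = i then t else ι (MvPolynomial.X j))
  refine ⟨ι, θ, ?_, ?_, ?_, ?_⟩
  · refine IsLocalization.injective S (M := Submonoid.powers (MvPolynomial.C (x i.castSucc) : MvPolynomial (Fin d) R)) ?_
    rw [Submonoid.powers_le, mem_nonZeroDivisors_iff_right]
    intro g hg
    ext m
    have := congrArg (MvPolynomial.coeff m) hg
    rw [mul_comm, MvPolynomial.coeff_C_mul, MvPolynomial.coeff_zero] at this
    rw [MvPolynomial.coeff_zero]; exact hnz _ this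
  · intro a; simp [θ]
  · intro j hj; simp [θ, hj]
  · simp only [θ, MvPolynomial.coe_eval₂Hom, MvPolynomial.eval₂_X, if_true, t]
    rw [mul_left_comm]
    have : ι (MvPolynomial.C (x i.castSucc)) * IsLocalization.Away.invSelf (S := S) (MvPolynomial.C (x i.castSucc) : MvPolynomial (Fin d) R) = 1 :=
      IsLocalization.Away.mul_invSelf _
    rw [this, mul_one]

lemma evalC_mem {d : ℕ} (x : Fin (d+1) → R) (D : ℕ) (Ω : MvPolynomial (Fin (d+1)) (MvPolynomial (Fin d) R)) (h : Ω.IsHomogeneous D) :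
    MvPolynomial.eval (fun k => MvPolynomial.C (x k)) Ω ∈ (gen x ^ D).map (MvPolynomial.C (σ := Fin d)) := by
  have := eval_mem_pow (fun k => (MvPolynomial.C (x k) : MvPolynomial (Fin d) R)) D Ω h
  rw [Ideal.map_pow, gen_map]
  exact this

lemma j_exists {d : ℕ} (x : Fin (d+1) → R) (i : Fin d) {S : Type*} [CommRing S] (ι θ : MvPolynomial (Fin d) R →+* S)
    (hC : ∀ a, θ (MvPolynomial.C a) = ι (MvPolynomial.C a)) (hX : ∀ j, j ≠ i → θ (MvPolynomial.X j) = ι (MvPolynomial.X j))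
    (hXi : ι (MvPolynomial.C (x i.castSucc)) * θ (MvPolynomial.X i) = ι (MvPolynomial.C (x (Fin.last d)) -
      ∑ j ∈ univ.erase i, MvPolynomial.X j * MvPolynomial.C (x j.castSucc)))
    (N : ℕ) (j : MvPolynomial (Fin d) R) (hj : j ∈ (gen x ^ N).map (MvPolynomial.C (σ := Fin d))) :
    ∃ D0, ∀ D ≥ D0, ∃ z ∈ (gen x ^ (N + D)).map (MvPolynomial.C (σ := Fin d)), ι z = ι (MvPolynomial.C (x i.castSucc)) ^ D * θ j := by
  rw [Ideal.map] at hj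
  induction hj using Submodule.span_induction with
  | mem j hj =>
    obtain ⟨a, ha, rfl⟩ := hj
    refine ⟨0, fun D _ => ⟨MvPolynomial.C (a * x i.castSucc ^ D), Ideal.mem_map_of_mem _ ?_, ?_⟩⟩
    · rw [pow_add]; exact Ideal.mul_mem_mul ha (Ideal.pow_mem_pow (x_mem x _) _)
    · simp [hC, mul_comm]
  | zero => exact ⟨0, fun D _ => ⟨0, zero_mem _, by simp⟩⟩
  | add p q _ _ hp hq =>
    obtain ⟨D1, h1⟩ := hp
    obtain ⟨D2, h2⟩ := hq
    refine ⟨max D1 D2, fun D hD => ?_⟩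
    obtain ⟨z1, a1, b1⟩ := h1 D (le_trans (le_max_left _ _) hD)
    obtain ⟨z2, a2, b2⟩ := h2 D (le_trans (le_max_right _ _) hD)
    exact ⟨z1 + z2, add_mem a1 a2, by rw [map_add, b1, b2, map_add, mul_add]⟩
  | smul b p _ hp =>
    obtain ⟨D1, h1⟩ := hp
    obtain ⟨D2, h2⟩ := omega_exists x i ι θ hC hX hXi b
    refine ⟨D1 + D2, fun D hD => ?_⟩
    obtain ⟨z1, a1, b1⟩ := h1 (D - D2) (by omega)
    obtain ⟨Ω, a2, b2, -, -⟩ := h2 D2 le_rfl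
    refine ⟨z1 * MvPolynomial.eval (fun k => MvPolynomial.C (x k)) Ω, ?_, ?_⟩
    · have := Ideal.mul_mem_mul a1 (evalC_mem x D2 Ω a2)
      rwa [← Ideal.map_mul, ← pow_add, show N + (D - D2) + D2 = N + D by omega] at this
    · rw [map_mul, b1, b2, smul_eq_mul, map_mul]
      conv_rhs => rw [show D = (D - D2) + D2 by omega, pow_add]
      ring

/-- the extended maximal ideal -/
noncomputable abbrev PA (R : Type*) [CommRing R] [IsLocalRing R] (d : ℕ) : Ideal (MvPolynomial (Fin d) R) :=
  (maximalIdeal R).map (MvPolynomial.C (σ := Fin d))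

instance PA_prime [IsLocalRing R] (d : ℕ) : (PA R d).IsPrime := by
  have h := MvPolynomial.ker_map (σ := Fin d) (residue R)
  rw [ker_residue] at h
  show ((maximalIdeal R).map (MvPolynomial.C (σ := Fin d))).IsPrime
  rw [← h]
  exact RingHom.ker_isPrime _

/-- the generic extension -/
abbrev BB (R : Type*) [CommRing R] [IsLocalRing R] (d : ℕ) := Localization.AtPrime (PA R d)

variable [IsLocalRing R] [IsNoetherianRing R]

lemma BB_max (d : ℕ) : (maximalIdeal R).map (algebraMap R (BB R d)) = maximalIdeal (BB R d) := by
  rw [← Localization.AtPrime.map_eq_maximalIdeal, Ideal.map_map]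
  rfl

instance BB_flat (d : ℕ) : Module.Flat R (BB R d) := Module.Flat.trans R (MvPolynomial (Fin d) R) _

instance BB_localHom (d : ℕ) : IsLocalHom (algebraMap R (BB R d)) := by
  have := ((IsLocalRing.local_hom_TFAE (algebraMap R (BB R d))).out 2 0).mp (BB_max d).le
  exact this

instance BB_ff (d : ℕ) : Module.FaithfullyFlat R (BB R d) := Module.FaithfullyFlat.of_flat_of_isLocalHom

instance BB_noeth (d : ℕ) : IsNoetherianRing (BB R d) := IsLocalization.isNoetherianRing (PA R d).primeCompl _ inferInstance

/-- membership in extended ideals -/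
lemma mem_BB (d : ℕ) (K : Ideal (MvPolynomial (Fin d) R)) (φ : MvPolynomial (Fin d) R)
    (h : algebraMap _ (BB R d) φ ∈ K.map (algebraMap _ (BB R d))) : ∃ w ∉ PA R d, w * φ ∈ K := by
  rw [IsLocalization.mem_map_algebraMap_iff (PA R d).primeCompl] at h
  obtain ⟨⟨k, u⟩, hk⟩ := h
  rw [← map_mul] at hk
  obtain ⟨c, hc⟩ := (IsLocalization.eq_iff_exists (PA R d).primeCompl (BB R d)).mp hk
  refine ⟨c * u, (PA R d).primeCompl.mul_mem c.2 u.2, ?_⟩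
  have : (c:MvPolynomial (Fin d) R) * u * φ = c * k := by rw [← hc]; ring
  rw [this]; exact Ideal.mul_mem_left _ _ k.2

lemma not_mem_PA {d : ℕ} {w : MvPolynomial (Fin d) R} (hw : w ∉ PA R d) : ∃ m, IsUnit (w.coeff m) := by
  by_contra hcon
  push Not at hcon
  exact hw (MvPolynomial.mem_map_C_iff.mpr fun m => (mem_maximalIdeal _).mpr (hcon m))

lemma mc' {d : ℕ} (q : Ideal R) (w φ : MvPolynomial (Fin d) R) (hw : w ∉ PA R d) (h : w * φ ∈ q.map (MvPolynomial.C (σ := Fin d))) :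
    φ ∈ q.map (MvPolynomial.C (σ := Fin d)) := by
  obtain ⟨m, hm⟩ := not_mem_PA hw
  rw [MvPolynomial.mem_map_C_iff] at h ⊢
  exact mc q w φ m hm h

end
end LI2

namespace LI2
open RingTheory.Sequence
section
variable [CommRing R] [IsLocalRing R] [IsNoetherianRing R]

lemma nz_of_QR {d : ℕ} (x : Fin d → R) (hq : QR x) (hJ : gen x ≤ maximalIdeal R) (i : Fin d) (y : R) (h : x i * y = 0) : y = 0 := by
  have h1 : ∀ n, y ∈ maximalIdeal R ^ n := fun n => Ideal.pow_right_mono hJ n (q1_var x hq i 1 n y (by rw [pow_one, h]; exact zero_mem _))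
  have : y ∈ ⨅ n, maximalIdeal R ^ n := by rw [Ideal.mem_iInf]; exact h1
  rwa [Ideal.iInf_pow_eq_bot_of_isLocalRing _ (Ideal.IsPrime.ne_top inferInstance), Ideal.mem_bot] at this

lemma q1A {d : ℕ} (x : Fin (d+1) → R) (hreg : IsRegular R (List.ofFn x)) (e n : ℕ) (Ω : MvPolynomial (Fin (d+1)) (MvPolynomial (Fin d) R))
    (hΩ : Ω.IsHomogeneous e) (m : Fin (d+1) →₀ ℕ) (hm : Ω.coeff m ∉ PA R d) (y : MvPolynomial (Fin d) R)
    (hy : MvPolynomial.eval (fun k => MvPolynomial.C (x k)) Ω * y ∈ (gen x ^ (n + e)).map (MvPolynomial.C (σ := Fin d))) :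
    y ∈ (gen x ^ n).map (MvPolynomial.C (σ := Fin d)) := by
  have hB : QR (algebraMap R (BB R d) ∘ x) := qr_of_regular _ (isRegular_ofFn_map x hreg)
  have hgen : ∀ n, ((gen x ^ n).map (MvPolynomial.C (σ := Fin d))).map (algebraMap _ (BB R d)) = gen (algebraMap R (BB R d) ∘ x) ^ n := by
    intro n
    rw [Ideal.map_map, Ideal.map_pow, gen_map]; rfl
  have h1 : algebraMap _ (BB R d) y ∈ gen (algebraMap R (BB R d) ∘ x) ^ n := by
    refine q1 _ hB e (MvPolynomial.map (algebraMap _ (BB R d)) Ω) (hΩ.map _) m ?_ n _ ?_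
    · rw [MvPolynomial.coeff_map]
      exact IsLocalization.map_units (BB R d) (⟨_, hm⟩ : (PA R d).primeCompl)
    · rw [← hgen]
      have := Ideal.mem_map_of_mem (algebraMap _ (BB R d)) hy
      rw [map_mul] at this
      convert this using 2
      rw [MvPolynomial.eval_map, MvPolynomial.eval, MvPolynomial.coe_eval₂Hom, MvPolynomial.hom_eval₂]
      rfl
  rw [← hgen] at h1
  obtain ⟨w, hw, h2⟩ := mem_BB d _ _ h1
  exact mc' _ w y hw h2

lemma key {d : ℕ} (x : Fin (d+1) → R) (hreg : IsRegular R (List.ofFn x)) (hJ : gen x ≤ maximalIdeal R) (i : Fin d)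
    (φ : MvPolynomial (Fin d) R) (r : ℝ) (c : ℝ) (hc : 0 ≤ c)
    (hφ : ∀ s n : ℕ, (n:ℝ) + c ≤ r * s → ∃ w ∉ PA R d, w * φ ^ s ∈ (gen x ^ n).map (MvPolynomial.C (σ := Fin d)) ⊔ Ideal.span {ell x}) :
    ∃ D0, ∀ D ≥ D0, ∃ z ∈ (Fr (gen x) (r + (D:ℕ))).map (MvPolynomial.C (σ := Fin d)),
      z - MvPolynomial.C (x i.castSucc) ^ D * φ ∈ Ideal.span {ell x} := by
  have hq := qr_of_regular x hreg
  obtain ⟨ι, θ, hι, hC, hX, hXi⟩ := theta_exists x i (nz_of_QR x hq hJ _)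
  obtain ⟨D0, hD0⟩ := omega_exists x i ι θ hC hX hXi φ
  refine ⟨D0, fun D hD => ?_⟩
  obtain ⟨Ω, a1, b1, -, e1⟩ := hD0 D hD
  refine ⟨_, Fr_poly_coeff _ _ _ (mem_Fr_of_lb c fun s n hn => ?_), e1⟩
  set z := MvPolynomial.eval (fun k => MvPolynomial.C (x k)) Ω with hz
  rw [← Ideal.map_pow]
  rcases le_total n (D * s) with h | h
  · have : z ^ s ∈ (gen x ^ (D * s)).map (MvPolynomial.C (σ := Fin d)) := by
      rw [pow_mul, Ideal.map_pow]; exact Ideal.pow_mem_pow (evalC_mem x D Ω a1) s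
    exact Ideal.map_mono (Ideal.pow_le_pow_right h) this
  · obtain ⟨N, rfl⟩ := Nat.exists_eq_add_of_le' h
    obtain ⟨w, hw, h2⟩ := hφ s N (by push_cast at hn; linarith)
    obtain ⟨j, hj, q, hq', h3⟩ := Submodule.mem_sup.mp h2
    obtain ⟨q, rfl⟩ := Ideal.mem_span_singleton'.mp hq'
    obtain ⟨D1, h4⟩ := omega_exists x i ι θ hC hX hXi w
    obtain ⟨D2, h5⟩ := j_exists x i ι θ hC hX hXi N j hj
    obtain ⟨Ωw, a2, b2, c2, -⟩ := h4 (max D1 D2) (le_max_left _ _)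
    obtain ⟨z', a3, b3⟩ := h5 (max D1 D2 + D * s) (le_trans (le_max_right _ _) (Nat.le_add_right _ _))
    have h6 : MvPolynomial.eval (fun k => MvPolynomial.C (x k)) Ωw * z ^ s = z' := by
      apply hι
      have h7 := congrArg θ h3
      rw [map_add, map_mul θ q, theta_ell x i ι θ hC hX hXi, mul_zero, add_zero, map_mul, map_pow] at h7
      rw [b3, map_mul, map_pow, b1, b2, h7]
      ring
    obtain ⟨m, hm⟩ : ∃ m, Ωw.coeff m ∉ PA R d := by
      by_contra hcon
      push Not at hcon
      apply hw
      rw [← c2, MvPolynomial.eval_eq]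
      exact sum_mem fun m _ => Ideal.mul_mem_right _ _ (hcon m)
    refine q1A x hreg (max D1 D2) (N + D * s) Ωw a2 m hm _ ?_
    rw [h6, show N + D * s + max D1 D2 = N + (max D1 D2 + D * s) by ring]
    exact a3

end
end LI2

namespace LI2
open RingTheory.Sequence
section
variable [CommRing R] [IsLocalRing R] [IsNoetherianRing R]

/-- generic linear form in the extension -/
noncomputable def lB {d : ℕ} (x : Fin (d+1) → R) : BB R d := algebraMap _ (BB R d) (ell x)

variable {S : Type*} [CommRing S]

/-- map to the generic hyperplane section -/
noncomputable def tS {d : ℕ} (π : BB R d →+* S) : R →+* S := π.comp (algebraMap R (BB R d))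

/-- map from polynomial ring -/
noncomputable def aS {d : ℕ} (π : BB R d →+* S) : MvPolynomial (Fin d) R →+* S := π.comp (algebraMap _ (BB R d))

/-- induced sequence -/
noncomputable def x1 {d : ℕ} (π : BB R d →+* S) (x : Fin (d+1) → R) : Fin d → S := fun j => tS π (x j.castSucc)

lemma aS_C {d : ℕ} (π : BB R d →+* S) : (aS π).comp MvPolynomial.C = tS π := rfl

lemma aS_C' {d : ℕ} (π : BB R d →+* S) (a : R) : (aS π) (MvPolynomial.C a) = tS π a := rfl

lemma aS_ell {d : ℕ} (π : BB R d →+* S) (x : Fin (d+1) → R) (hk : RingHom.ker π = Ideal.span {lB x}) (z : MvPolynomial (Fin d) R) (hz : z ∈ Ideal.span {ell x}) : aS π z = 0 := by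
  obtain ⟨q, rfl⟩ := Ideal.mem_span_singleton'.mp hz
  rw [map_mul]
  have : aS π (ell x) = 0 := by
    have : lB x ∈ RingHom.ker π := by rw [hk]; exact (Ideal.mem_span_singleton_self _)
    exact this
  rw [this, mul_zero]

lemma gen_x1 {d : ℕ} (π : BB R d →+* S) (x : Fin (d+1) → R) (hk : RingHom.ker π = Ideal.span {lB x}) : (gen x).map (tS π) = gen (x1 π x) := by
  apply le_antisymm
  · rw [gen_map, gen, Ideal.span_le]
    rintro _ ⟨k, rfl⟩
    refine Fin.lastCases ?_ (fun j => ?_) k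
    · have := aS_ell π x hk _ (Ideal.mem_span_singleton_self _)
      rw [ell, map_sub, map_sum, sub_eq_zero, aS_C'] at this
      show tS π (x (Fin.last d)) ∈ gen (x1 π x)
      rw [this]
      refine sum_mem fun j _ => ?_
      rw [map_mul]
      exact Ideal.mul_mem_left _ _ (x_mem (x1 π x) j)
    · exact x_mem (x1 π x) j
  · rw [gen, Ideal.span_le]
    rintro _ ⟨j, rfl⟩
    exact Ideal.mem_map_of_mem _ (x_mem x _)

lemma Fr_tS {d : ℕ} (π : BB R d →+* S) (x : Fin (d+1) → R) (hk : RingHom.ker π = Ideal.span {lB x}) (r : ℝ) : (Fr (gen x) r).map (tS π) ≤ Fr (gen (x1 π x)) r := by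
  rw [← gen_x1 π x hk]
  exact Ideal.map_le_iff_le_comap.mpr fun y hy => Fr_map _ r hy

lemma mem_aS {d : ℕ} (π : BB R d →+* S) (hπ : Function.Surjective π) (x : Fin (d+1) → R) (hk : RingHom.ker π = Ideal.span {lB x}) (K : Ideal R) (φ : MvPolynomial (Fin d) R) (h : aS π φ ∈ K.map (tS π)) :
    ∃ w ∉ PA R d, w * φ ∈ K.map (MvPolynomial.C (σ := Fin d)) ⊔ Ideal.span {ell x} := by
  apply mem_BB
  have h1 : K.map (tS π) ≤ ((K.map (MvPolynomial.C (σ := Fin d)) ⊔ Ideal.span {ell x}).map (algebraMap _ (BB R d))).map π := by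
    rw [Ideal.map_map, Ideal.map_sup, Ideal.map_map]
    exact le_sup_left
  obtain ⟨b, hb, hb'⟩ := (Ideal.mem_map_iff_of_surjective _ hπ).mp (h1 h)
  have h2 : algebraMap _ (BB R d) φ - b ∈ Ideal.span {lB x} := by
    rw [← hk, RingHom.mem_ker, map_sub, hb', sub_eq_zero]; rfl
  have h3 : Ideal.span {lB x} ≤ (K.map (MvPolynomial.C (σ := Fin d)) ⊔ Ideal.span {ell x}).map (algebraMap _ (BB R d)) := by
    rw [Ideal.span_singleton_le_iff_mem]
    exact Ideal.mem_map_of_mem _ (Ideal.mem_sup_right (Ideal.mem_span_singleton_self _))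
  have := add_mem (h3 h2) hb
  rwa [sub_add_cancel] at this

lemma rep_S {d : ℕ} (π : BB R d →+* S) (hπ : Function.Surjective π) (y : S) : ∃ φ : MvPolynomial (Fin d) R, ∃ u : S, IsUnit u ∧ y * u = aS π φ := by
  obtain ⟨b, rfl⟩ := hπ y
  obtain ⟨⟨φ, u⟩, hu⟩ := IsLocalization.surj (PA R d).primeCompl b
  refine ⟨φ, π (algebraMap _ (BB R d) (u : MvPolynomial (Fin d) R)), (IsLocalization.map_units (BB R d) u).map _, ?_⟩
  rw [← map_mul]
  exact congrArg π hu

lemma key1 {d : ℕ} (π : BB R d →+* S) (hπ : Function.Surjective π) (x : Fin (d+1) → R) (hk : RingHom.ker π = Ideal.span {lB x})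
    (hreg : IsRegular R (List.ofFn x)) (hJ : gen x ≤ maximalIdeal R) (i : Fin d)
    (r : ℝ) (y : S) (hy : y ∈ Fr (gen (x1 π x)) r) : ∃ D0, ∀ D ≥ D0, x1 π x i ^ D * y ∈ (Fr (gen x) (r + (D:ℕ))).map (tS π) := by
  obtain ⟨φ, u, hu, hφ⟩ := rep_S π hπ y
  have h1 : aS π φ ∈ Fr (gen (x1 π x)) r := by rw [← hφ]; exact Ideal.mul_mem_right _ _ hy
  obtain ⟨c, hc, h2⟩ := mem_pow_of_mem_Fr h1
  obtain ⟨D0, hD⟩ := key x hreg hJ i φ r c hc (by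
    intro s n hn
    refine mem_aS π hπ x hk _ _ ?_
    rw [map_pow, Ideal.map_pow, gen_x1 π x hk]
    exact h2 s n hn)
  refine ⟨D0, fun D h => ?_⟩
  obtain ⟨z, hz, hz'⟩ := hD D h
  have h3 := aS_ell π x hk _ hz'
  rw [map_sub, sub_eq_zero, map_mul, map_pow, aS_C', ← hφ, ← mul_assoc] at h3
  have h4 := Ideal.mem_map_of_mem (aS π) hz
  rw [Ideal.map_map, aS_C, h3] at h4
  exact (Ideal.mul_unit_mem_iff_mem _ hu).mp h4

end
end LI2

namespace LI2
open RingTheory.Sequence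
section
variable [CommRing R] [IsLocalRing R] [IsNoetherianRing R]
variable {S : Type*} [CommRing S]

lemma LBd_S {d : ℕ} (π : BB R d →+* S) (hπ : Function.Surjective π) (x : Fin (d+1) → R) (hk : RingHom.ker π = Ideal.span {lB x})
    (hreg : IsRegular R (List.ofFn x)) (hJ : gen x ≤ maximalIdeal R) (i : Fin d) (hq : QR (x1 π x)) (h : LBd (gen x)) :
    LBd (gen (x1 π x)) := by
  obtain ⟨c, hc⟩ := h
  refine ⟨c, fun n f hf => ?_⟩
  obtain ⟨D, hD⟩ := key1 π hπ x hk hreg hJ i _ f hf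
  have h1 := hD D le_rfl
  refine q1_var (x1 π x) hq i D n f ?_
  have h2 := hc (n + D)
  rw [show ((n + c : ℕ) : ℝ) + (D:ℕ) = ((n + D + c : ℕ) : ℝ) by push_cast; ring] at h1
  have h3 := Ideal.map_mono (f := tS π) h2 h1
  rwa [Ideal.map_pow, gen_x1 π x hk] at h3

lemma eq_large {d : ℕ} [IsNoetherianRing S] (π : BB R d →+* S) (hπ : Function.Surjective π) (x : Fin (d+1) → R) (hk : RingHom.ker π = Ideal.span {lB x})
    (hreg : IsRegular R (List.ofFn x)) (hJ : gen x ≤ maximalIdeal R) (h : LBd (gen (x1 π x))) :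
    ∃ n0 : ℕ, ∀ n ≥ n0, Fr (gen (x1 π x)) (n:ℝ) = (Fr (gen x) (n:ℝ)).map (tS π) := by
  classical
  obtain ⟨c, hc⟩ := h
  let F' : (gen (x1 π x)).Filtration S :=
    { N := fun n => Fr (gen (x1 π x)) ((n + c : ℕ):ℝ)
      mono := fun n => Fr_anti (by push_cast; linarith)
      smul_le := fun n => by
        have h1 := pow_le_Fr (J := gen (x1 π x)) 1
        rw [pow_one] at h1
        refine (Ideal.mul_mono_left h1).trans ((Fr_mul_le _ _).trans (le_of_eq ?_))
        congr 1; push_cast; ring }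
  have hst : F'.Stable := by
    refine (Ideal.stableFiltration_stable (gen (x1 π x)) (⊤ : Submodule S S)).of_le ?_
    intro n
    show Fr (gen (x1 π x)) ((n + c : ℕ):ℝ) ≤ gen (x1 π x) ^ n • (⊤ : Ideal S)
    rw [smul_eq_mul, Ideal.mul_top]
    exact hc n
  obtain ⟨n0, hn0⟩ := hst.exists_pow_smul_eq
  replace hn0 : ∀ k, Fr (gen (x1 π x)) ((n0 + k + c : ℕ):ℝ) = gen (x1 π x) ^ k * Fr (gen (x1 π x)) ((n0 + c : ℕ):ℝ) := hn0
  obtain ⟨T, hT⟩ := IsNoetherian.noetherian (Fr (gen (x1 π x)) ((n0 + c : ℕ):ℝ))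
  have hTm : ∀ g ∈ T, g ∈ Fr (gen (x1 π x)) ((n0 + c : ℕ):ℝ) := fun g hg => by
    rw [← hT]; exact Submodule.subset_span hg
  have hD : ∀ g : S, ∀ i : Fin d, ∃ D0 : ℕ, g ∈ T → ∀ D ≥ D0, x1 π x i ^ D * g ∈ (Fr (gen x) (((n0 + c : ℕ):ℝ) + (D:ℕ))).map (tS π) := by
    intro g i
    by_cases hg : g ∈ T
    · obtain ⟨D0, h⟩ := key1 π hπ x hk hreg hJ i _ g (hTm g hg)
      exact ⟨D0, fun _ => h⟩
    · exact ⟨0, fun h => absurd h hg⟩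
  choose D0 hD0 using hD
  let D := ∑ g ∈ T, ∑ i, D0 g i
  have hDle : ∀ g ∈ T, ∀ i, D0 g i ≤ D := fun g hg i =>
    (Finset.single_le_sum (f := fun i => D0 g i) (fun _ _ => Nat.zero_le _) (Finset.mem_univ i)).trans
      (Finset.single_le_sum (f := fun g => ∑ i, D0 g i) (fun _ _ => Nat.zero_le _) hg)
  refine ⟨n0 + c + (d * D + 1), fun n hn => le_antisymm ?_ (Fr_tS π x hk _)⟩
  obtain ⟨k, rfl⟩ : ∃ k, n = n0 + k + c := ⟨n - (n0 + c), by omega⟩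
  have hk' : d * D + 1 ≤ k := by omega
  rw [hn0, ← mono_span, ← hT]
  rw [show (Submodule.span S (T : Set S)) = Ideal.span (T : Set S) from rfl, Ideal.span_mul_span', Ideal.span_le]
  rintro _ ⟨_, ⟨m, hm, rfl⟩, g, hg, rfl⟩
  rw [Finset.mem_coe, mem_Mo, Finsupp.degree_eq_sum] at hm
  have hg' : g ∈ T := hg
  obtain ⟨i, hi⟩ : ∃ i, D ≤ m i := by
    by_contra hcon
    push Not at hcon
    have : ∑ i, m i ≤ ∑ i : Fin d, D := Finset.sum_le_sum fun i _ => (hcon i).le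
    simp at this
    omega
  have h1 := hD0 g i hg' (m i) ((hDle g hg' i).trans hi)
  show (∏ i, x1 π x i ^ m i) * g ∈ _
  rw [← Finset.prod_erase_mul _ _ (Finset.mem_univ i), mul_assoc]
  have h2 : (∏ j ∈ Finset.univ.erase i, x1 π x j ^ m j) ∈ (gen x ^ (k - m i)).map (tS π) := by
    have : (∏ j ∈ Finset.univ.erase i, x1 π x j ^ m j) = tS π (∏ j ∈ Finset.univ.erase i, x j.castSucc ^ m j) := by
      rw [map_prod]; refine Finset.prod_congr rfl fun j _ => ?_
      rw [map_pow]; rfl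
    rw [this]
    refine Ideal.mem_map_of_mem _ ?_
    have : k - m i = ∑ j ∈ Finset.univ.erase i, m j := by
      rw [← hm, ← Finset.sum_erase_add _ _ (Finset.mem_univ i)]; simp
    rw [this, ← Finset.prod_pow_eq_pow_sum]
    exact Ideal.prod_mem_prod fun j _ => Ideal.pow_mem_pow (x_mem x _) _
  have hmk : m i ≤ k := by rw [← hm]; exact Finset.single_le_sum (f := fun i => m i) (fun _ _ => Nat.zero_le _) (Finset.mem_univ i)
  have h3 := Ideal.mul_mem_mul h2 h1
  rw [← Ideal.map_mul] at h3
  refine Ideal.map_mono ?_ h3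
  refine (Ideal.mul_mono_left (pow_le_Fr _)).trans ((Fr_mul_le _ _).trans (le_of_eq ?_))
  congr 1; push_cast [hmk]; ring

end
end LI2

namespace LI2
open RingTheory.Sequence

lemma lq_surj {B S : Type*} [CommRing B] [CommRing S] (π : B →+* S) (hπ : Function.Surjective π) (K : Ideal B) (hK : RingHom.ker π ≤ K) :
    lq (K.map π) = lq K := by
  letI := π.toAlgebra
  have e1 : Module.length B (S ⧸ K.map π) = Module.length S (S ⧸ K.map π) := Module.length_eq_of_surjective (R := S) (S := B) hπ
  rw [lq, lq, ← e1]
  let f : B →ₗ[B] S ⧸ K.map π := (Algebra.linearMap B (S ⧸ K.map π))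
  have hf : ∀ b, f b = Ideal.Quotient.mk (K.map π) (π b) := fun b => rfl
  have hs : Function.Surjective f := fun y => by
    obtain ⟨s, rfl⟩ := Ideal.Quotient.mk_surjective y
    obtain ⟨b, rfl⟩ := hπ s
    exact ⟨b, rfl⟩
  have hker : K = LinearMap.ker f := by
    ext b
    rw [LinearMap.mem_ker, hf, Ideal.Quotient.eq_zero_iff_mem]
    constructor
    · exact fun h => Ideal.mem_map_of_mem _ h
    · intro h
      obtain ⟨k, hk, hkb⟩ := (Ideal.mem_map_iff_of_surjective _ hπ).mp h
      have : b - k ∈ RingHom.ker π := by rw [RingHom.mem_ker, map_sub, hkb, sub_self]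
      have := add_mem (hK this) hk
      rwa [sub_add_cancel] at this
  have e2 := (f.quotKerEquivOfSurjective hs).length_eq
  rw [← e2]
  exact ((Submodule.quotEquivOfEq _ _ hker).length_eq).symm

section
variable [CommRing R] [IsLocalRing R] [IsNoetherianRing R]

lemma lq_BB (d : ℕ) (I : Ideal R) : lq (I.map (algebraMap R (BB R d))) = lq I := by
  have h1 := IsLocalRing.length_baseChange R (BB R d) (R ⧸ I)
  have h2 : Module.length (BB R d) (BB R d ⧸ (maximalIdeal R).map (algebraMap R (BB R d))) = 1 := by
    rw [BB_max]; exact lq_max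
  rw [h2, mul_one, ← (Algebra.TensorProduct.quotIdealMapEquivTensorQuot (BB R d) I).toLinearEquiv.length_eq] at h1
  exact h1

lemma map_BB {d : ℕ} (I : Ideal R) : I.map (algebraMap R (BB R d)) = (I.map (MvPolynomial.C (σ := Fin d))).map (algebraMap _ (BB R d)) := by
  rw [Ideal.map_map]; rfl

lemma lB_mem {d : ℕ} (x : Fin (d+1) → R) : lB x ∈ (gen x).map (algebraMap R (BB R d)) := by
  rw [map_BB]
  refine Ideal.mem_map_of_mem _ ?_
  rw [ell]
  refine sub_mem (Ideal.mem_map_of_mem _ (x_mem x _)) (sum_mem fun j _ => Ideal.mul_mem_left _ _ (Ideal.mem_map_of_mem _ (x_mem x _)))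

lemma col_BB {d : ℕ} (x : Fin (d+1) → R) (hq : QR x) (r : ℝ) :
    col ((Fr (gen x) (r+1)).map (algebraMap R (BB R d))) (lB x) = (Fr (gen x) r).map (algebraMap R (BB R d)) := by
  apply le_antisymm
  · intro b hb
    rw [mem_col, map_BB] at hb
    obtain ⟨⟨φ, u⟩, hu⟩ := IsLocalization.surj (PA R d).primeCompl b
    have hu' : b * algebraMap _ (BB R d) (u : MvPolynomial (Fin d) R) = algebraMap _ (BB R d) φ := hu
    have h1 : algebraMap _ (BB R d) (ell x * φ) ∈ ((Fr (gen x) (r+1)).map (MvPolynomial.C (σ := Fin d))).map (algebraMap _ (BB R d)) := by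
      rw [map_mul, ← hu', ← mul_assoc]
      exact Ideal.mul_mem_right _ _ hb
    obtain ⟨w, hw, h2⟩ := mem_BB d _ _ h1
    rw [show w * (ell x * φ) = ell x * (w * φ) by ring] at h2
    have h3 := mc' _ _ _ hw (ell_colon x hq r _ h2)
    have h4 := Ideal.mem_map_of_mem (algebraMap _ (BB R d)) h3
    rw [← map_BB, ← hu'] at h4
    exact (Ideal.mul_unit_mem_iff_mem _ (IsLocalization.map_units (BB R d) u)).mp h4
  · intro b hb
    rw [mem_col]
    have h1 := Ideal.mul_mem_mul hb (lB_mem x)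
    rw [← Ideal.map_mul, mul_comm b] at h1
    refine Ideal.map_mono ?_ h1
    have h2 := pow_le_Fr (J := gen x) 1
    rw [pow_one] at h2
    refine (Ideal.mul_mono_right h2).trans ((Fr_mul_le _ _).trans (le_of_eq ?_))
    simp

variable {S : Type*} [CommRing S]

lemma lq_step {d : ℕ} (π : BB R d →+* S) (hπ : Function.Surjective π) (x : Fin (d+1) → R) (hk : RingHom.ker π = Ideal.span {lB x})
    (hq : QR x) (r : ℝ) : lq (Fr (gen x) (r+1)) = lq (Fr (gen x) r) + lq ((Fr (gen x) (r+1)).map (tS π)) := by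
  rw [← lq_BB d (Fr (gen x) (r+1)), lq_col _ (lB x), col_BB x hq, lq_BB]
  congr 1
  rw [← lq_surj π hπ _ (by rw [hk]; exact le_sup_right), Ideal.map_sup, Ideal.map_map, Ideal.map_span, Set.image_singleton]
  have : π (lB x) = 0 := by
    have : lB x ∈ RingHom.ker π := by rw [hk]; exact (Ideal.mem_span_singleton_self _)
    exact this
  rw [this, Ideal.span_singleton_eq_bot.mpr rfl, sup_bot_eq]
  rfl

lemma Hil_S {d : ℕ} [IsNoetherianRing S] (π : BB R d →+* S) (hπ : Function.Surjective π) (x : Fin (d+1) → R) (hk : RingHom.ker π = Ideal.span {lB x})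
    (hreg : IsRegular R (List.ofFn x)) (hJ : gen x ≤ maximalIdeal R) (h : LBd (gen (x1 π x))) (hH : Hil (d+1) x) :
    Hil d (x1 π x) := by
  have hq := qr_of_regular x hreg
  obtain ⟨n0, hn0⟩ := eq_large π hπ x hk hreg hJ h
  obtain ⟨e, N0, he, hH⟩ := hH
  refine ⟨e, N0 + 1 + n0, he, fun n hn => ?_⟩
  obtain ⟨k, rfl⟩ : ∃ k, n = k + 1 := ⟨n - 1, by omega⟩
  obtain ⟨l1, h1, h1'⟩ := hH (k+1) (by omega)
  obtain ⟨l0, h0, h0'⟩ := hH k (by omega)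
  have h2 := lq_step π hπ x hk hq ((k + 1 : ℕ):ℝ)
  rw [show ((k + 1 : ℕ):ℝ) + 1 = ((k + 1 + 1 : ℕ) : ℝ) by push_cast; ring, ← hn0 _ (by omega), h1, h0] at h2
  have h3 : lq (Fr (gen (x1 π x)) ((k + 1 + 1 : ℕ) : ℝ)) ≠ ⊤ := by
    intro h; rw [h] at h2; simp at h2
  obtain ⟨l, hl⟩ := ENat.ne_top_iff_exists.mp h3
  refine ⟨l, hl.symm, ?_⟩
  rw [← hl] at h2
  have h4 : l1 = l0 + l := by exact_mod_cast h2
  have h5 : (l:ℤ) = l1 - l0 := by rw [h4]; push_cast; ring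
  rw [h5, h1', h0', ← Finset.sum_sub_distrib, Finset.sum_range_succ]
  rw [show k + 1 + (d+1) - (d+1) = k + 1 by omega]
  simp only [Nat.sub_self, Nat.choose_zero_right, sub_self, add_zero]
  refine Finset.sum_congr rfl fun i hi => ?_
  rw [← mul_sub]
  congr 1
  have hi' : i ≤ d := by have := Finset.mem_range.mp hi; omega
  obtain ⟨j, rfl⟩ := Nat.exists_eq_add_of_le hi'
  rw [show k + 1 + (i + j + 1) - i = (k + 1 + j) + 1 by omega, show i + j + 1 - i = j + 1 by omega,
    show k + (i + j + 1) - i = k + 1 + j by omega, show k + 1 + (i + j) - i = k + 1 + j by omega, show i + j - i = j by omega, Nat.choose_succ_succ]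
  push_cast; ring

end
end LI2

namespace LI2
open RingTheory.Sequence

open scoped Pointwise in
lemma reg_surj {B S : Type*} [CommRing B] [CommRing S] (π : B →+* S) (hπ : Function.Surjective π) (a : B) (hk : RingHom.ker π = Ideal.span {a})
    (rs : List B) (h : IsRegular B (a :: rs)) : IsRegular S (rs.map π) := by
  have h1 := ((isRegular_cons_iff B a rs).mp h).2
  letI := π.toAlgebra
  let f : B →ₗ[B] S := Algebra.linearMap B S
  have hker : (a • (⊤ : Submodule B B)) = LinearMap.ker f := by
    have : LinearMap.ker f = RingHom.ker π := rfl
    rw [this, hk]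
    ext b
    rw [Submodule.mem_smul_pointwise_iff_exists, Ideal.mem_span_singleton']
    constructor
    · rintro ⟨c, _, rfl⟩; exact ⟨c, mul_comm _ _⟩
    · rintro ⟨c, rfl⟩; exact ⟨c, trivial, mul_comm _ _⟩
  let e : QuotSMulTop a B ≃ₗ[B] S := (Submodule.quotEquivOfEq _ _ hker).trans (f.quotKerEquivOfSurjective hπ)
  have h2 := (e.isRegular_congr rs).mp h1
  refine ((AddEquiv.refl S).isRegular_congr (R := B) (S := S) ?_).mp h2
  refine List.forall₂_map_right_iff.mpr (List.forall₂_same.mpr fun r _ y => ?_)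
  show r • y = π r • y
  rfl

section
universe u
variable {R : Type u} [CommRing R] [IsLocalRing R] [IsNoetherianRing R]

lemma reg_S {d : ℕ} {S : Type*} [CommRing S] (π : BB R d →+* S) (hπ : Function.Surjective π) (x : Fin (d+1) → R) (hk : RingHom.ker π = Ideal.span {lB x})
    (hreg : IsRegular R (List.ofFn x)) (hJ : gen x ≤ maximalIdeal R) (N : ℕ) (hN : maximalIdeal R ^ N ≤ gen x) :
    IsRegular S (List.ofFn (x1 π x)) := by
  have hregB := isRegular_ofFn_map (S := BB R d) x hreg
  have hmB : ∀ y ∈ gen x, algebraMap R (BB R d) y ∈ maximalIdeal (BB R d) := fun y hy => by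
    rw [← BB_max]; exact Ideal.mem_map_of_mem _ (hJ hy)
  have h1 := sop_regular (A := BB R d) (d+1) (BB R d) (List.ofFn (algebraMap R (BB R d) ∘ x)) (by simp)
    (by
      intro r hr
      obtain ⟨i, rfl⟩ := (List.mem_ofFn' _ _).mp hr
      exact hmB _ (x_mem x i)) hregB (lB x :: List.ofFn (fun j : Fin d => algebraMap R (BB R d) (x j.castSucc))) (by simp)
    (by
      intro r hr
      rcases List.mem_cons.mp hr with rfl | hr
      · rw [← BB_max]; exact Ideal.map_mono hJ (lB_mem x)
      · obtain ⟨i, rfl⟩ := (List.mem_ofFn' _ _).mp hr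
        exact hmB _ (x_mem x _)) N
    (by
      refine le_trans ?_ le_sup_left
      rw [← BB_max, ← Ideal.map_pow]
      refine (Ideal.map_mono hN).trans ?_
      rw [gen_map, gen, Ideal.span_le]
      have hc : ∀ j : Fin d, algebraMap R (BB R d) (x j.castSucc) ∈ Ideal.ofList (lB x :: List.ofFn (fun j : Fin d => algebraMap R (BB R d) (x j.castSucc))) := by
        intro j
        refine Ideal.subset_span ?_
        exact List.mem_cons_of_mem _ ((List.mem_ofFn' _ _).mpr ⟨j, rfl⟩)
      rintro _ ⟨k, rfl⟩
      refine Fin.lastCases ?_ (fun j => ?_) k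
      · have h2 : algebraMap R (BB R d) (x (Fin.last d)) = lB x + ∑ j : Fin d, algebraMap _ (BB R d) (MvPolynomial.X j : MvPolynomial (Fin d) R) * algebraMap R (BB R d) (x j.castSucc) := by
          rw [lB, ell, map_sub, map_sum]
          have : algebraMap R (BB R d) (x (Fin.last d)) = algebraMap _ (BB R d) (MvPolynomial.C (x (Fin.last d)) : MvPolynomial (Fin d) R) := rfl
          rw [this, sub_add_eq_add_sub, eq_sub_iff_add_eq]
          congr 1
          refine Finset.sum_congr rfl fun j _ => ?_
          rw [map_mul]; rfl
        show algebraMap R (BB R d) (x (Fin.last d)) ∈ _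
        rw [h2]
        refine add_mem (Ideal.subset_span List.mem_cons_self) (sum_mem fun j _ => Ideal.mul_mem_left _ _ (hc j))
      · exact hc j)
  have h2 := reg_surj π hπ (lB x) hk _ h1
  rwa [List.map_ofFn] at h2

lemma exists_quot {B : Type u} [CommRing B] (a : B) : ∃ (S : Type u) (_ : CommRing S) (π : B →+* S), Function.Surjective π ∧ RingHom.ker π = Ideal.span {a} :=
  ⟨B ⧸ Ideal.span {a}, inferInstance, Ideal.Quotient.mk _, Ideal.Quotient.mk_surjective, Ideal.mk_ker⟩

theorem hyper (d : ℕ) : ∀ (R : Type u) [CommRing R] [IsLocalRing R] [IsNoetherianRing R] (x : Fin (d+3) → R) (_ : IsRegular R (List.ofFn x))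
    (_ : gen x ≤ maximalIdeal R) (N : ℕ) (_ : maximalIdeal R ^ N ≤ gen x) (_ : LBd (gen x)) (_ : Hil (d+3) x), Fr (gen x) 3 ≤ gen x := by
  induction d with
  | zero => intro R _ _ _ x hreg hJ N hN hLB hH; exact dim_three x hreg hJ N hN hLB hH
  | succ d ih =>
    intro R _ _ _ x hreg hJ N hN hLB hH
    have main : ∀ (S : Type u) [CommRing S] (π : BB R (d+3) →+* S) (hπ : Function.Surjective π) (hk : RingHom.ker π = Ideal.span {lB x}),
        Fr (gen x) 3 ≤ gen x := by
      intro S _ π hπ hk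
      have hlm : lB x ∈ maximalIdeal (BB R (d+3)) := by rw [← BB_max]; exact Ideal.map_mono hJ (lB_mem x)
      haveI : Nontrivial S := by
        rw [← not_subsingleton_iff_nontrivial]
        intro h
        have : (1 : BB R (d+3)) ∈ RingHom.ker π := by rw [RingHom.mem_ker]; exact Subsingleton.elim _ _
        rw [hk] at this
        have := (Ideal.span_singleton_le_iff_mem _).mpr hlm this
        exact (Ideal.ne_top_iff_one _).mp (maximalIdeal.isMaximal _).ne_top this
      haveI : IsLocalRing S := IsLocalRing.of_surjective' π hπ
      haveI : IsNoetherianRing S := isNoetherianRing_of_surjective _ _ π hπ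
      haveI : IsLocalHom π := IsLocalHom.of_surjective π hπ
      have hmS : maximalIdeal S = (maximalIdeal R).map (tS π) := by
        rw [tS, ← Ideal.map_map, BB_max]
        apply le_antisymm
        · intro y hy
          obtain ⟨b, rfl⟩ := hπ y
          refine Ideal.mem_map_of_mem _ ?_
          rw [mem_maximalIdeal] at hy ⊢
          exact fun h => hy (h.map π)
        · rw [Ideal.map_le_iff_le_comap]
          intro b hb
          rw [Ideal.mem_comap, mem_maximalIdeal]
          rw [mem_maximalIdeal] at hb
          exact fun h => hb (isUnit_of_map_unit π b h)
      have hreg1 := reg_S π hπ x hk hreg hJ N hN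
      have hq1 := qr_of_regular _ hreg1
      have hLB1 := LBd_S π hπ x hk hreg hJ 0 hq1 hLB
      have hH1 := Hil_S π hπ x hk hreg hJ hLB1 hH
      have h3 := ih S (x1 π x) hreg1 (by rw [← gen_x1 π x hk, hmS]; exact Ideal.map_mono hJ) N
        (by rw [← gen_x1 π x hk, hmS, ← Ideal.map_pow]; exact Ideal.map_mono hN) hLB1 hH1
      intro y hy
      have h4 := h3 (Fr_tS π x hk 3 (Ideal.mem_map_of_mem _ hy))
      rw [← gen_x1 π x hk, tS, ← Ideal.map_map] at h4
      obtain ⟨b, hb, hb'⟩ := (Ideal.mem_map_iff_of_surjective _ hπ).mp h4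
      have h5 : algebraMap R (BB R (d+3)) y - b ∈ RingHom.ker π := by
        rw [RingHom.mem_ker, map_sub, hb']; exact sub_self _
      rw [hk] at h5
      have h6 := add_mem ((Ideal.span_singleton_le_iff_mem _).mpr (lB_mem x) h5) hb
      rw [sub_add_cancel] at h6
      rw [← Ideal.comap_map_eq_self_of_faithfullyFlat (B := BB R (d+3)) (gen x)]
      exact h6
    obtain ⟨S, _, π, e1, e2⟩ := exists_quot (lB x)
    exact main S π e1 e2
end
end LI2

namespace LI2
open RingTheory.Sequence

lemma mlen_le_of_inj {R M N : Type*} [CommRing R] [AddCommGroup M] [Module R M] [AddCommGroup N] [Module R N] (f : M →ₗ[R] N)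
    (hf : Function.Injective f) : mlen R M ≤ mlen R N := by
  rw [mlen, mlen, ← Module.coe_length, ← Module.coe_length]
  exact_mod_cast Module.length_le_of_injective f hf

lemma quot_le {R : Type*} [CommRing R] (F K C Q : Ideal R) (h1 : F ≤ C) (h2 : K ≤ Q) (h3 : F ⊓ Q ≤ K) :
    mlen R (idealQuot F K) ≤ mlen R (idealQuot C Q) := by
  refine mlen_le_of_inj (Submodule.mapQ (Submodule.comap F.subtype K) (Submodule.comap C.subtype Q) (Submodule.inclusion h1) ?_) ?_
  · intro y hy; exact h2 hy
  · rw [← LinearMap.ker_eq_bot, LinearMap.ker_eq_bot']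
    intro z hz
    obtain ⟨y, rfl⟩ := Submodule.mkQ_surjective _ z
    rw [Submodule.mkQ_apply, Submodule.mapQ_apply, Submodule.Quotient.mk_eq_zero] at hz
    rw [Submodule.mkQ_apply, Submodule.Quotient.mk_eq_zero]
    exact h3 ⟨y.2, hz⟩

lemma le_intCl {R : Type*} [CommRing R] (I : Ideal R) : I ≤ intCl I := by
  intro y hy
  refine Ideal.subset_span ⟨1, one_pos, fun _ => -y, ?_, ?_⟩
  · intro i hi
    have : i = 1 := by simp at hi; omega
    subst this; simpa using hy
  · simp

lemma cm_list {R : Type*} [CommRing R] [IsLocalRing R] (d : ℕ) (hd : 3 ≤ d) (hdim : ringKrullDim R = d) (hCM : IsCMLocal R) :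
    ∃ rs : List R, rs.length = d ∧ (∀ r ∈ rs, r ∈ maximalIdeal R) ∧ IsRegular R rs := by
  rw [IsCMLocal, hdim] at hCM
  have h1 : rdepth R (maximalIdeal R) R = (d : ℕ∞) := by exact_mod_cast hCM
  by_contra hcon
  have h2 : rdepth R (maximalIdeal R) R ≤ ((d - 1 : ℕ) : ℕ∞) := by
    refine sSup_le ?_
    rintro n ⟨rs, rfl, hm, hr⟩
    have h3 : (rs.length : ℕ∞) ≤ d := by
      rw [← h1]; exact le_sSup ⟨rs, rfl, hm, hr⟩
    have h4 : rs.length ≤ d := by exact_mod_cast h3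
    have h5 : rs.length ≠ d := fun h => hcon ⟨rs, h, hm, hr⟩
    have : rs.length ≤ d - 1 := by omega
    exact_mod_cast this
  rw [h1] at h2
  have : d ≤ d - 1 := by exact_mod_cast h2
  omega

lemma inter_le {R : Type*} [CommRing R] [IsLocalRing R] {d : ℕ} (x : Fin d → R) (hq : QR x) (hF : Fr (gen x) 1 ≤ maximalIdeal R) :
    Fr (gen x) 2 ⊓ gen x ≤ gen x * maximalIdeal R := by
  rintro y ⟨h2, h1⟩
  obtain ⟨F, hF1, hy⟩ := (Ideal.mem_span_pow_iff_exists_isHomogeneous x y).mp (show y ∈ gen x ^ 1 by rw [pow_one]; exact h1)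
  have hc : ∀ m, F.coeff m ∈ maximalIdeal R := by
    intro m
    by_contra hm
    have hu : IsUnit (F.coeff m) := by rwa [mem_maximalIdeal, mem_nonunits_iff, not_not] at hm
    have := Fr_colon x hq 1 F hF1 m hu 1 1 (by
      rw [mul_one, hy]; convert h2 using 1; norm_num)
    exact (Ideal.ne_top_iff_one _).mp (maximalIdeal.isMaximal R).ne_top (hF this)
  have := eval_mem_mul_pow x (maximalIdeal R) 1 F hF1 hc
  rw [hy, pow_one, mul_comm] at this
  exact this

universe u
theorem final
    (R : Type u) [CommRing R] [IsLocalRing R] [IsNoetherianRing R]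
    (d : ℕ) (hd : 3 ≤ d) (hdim : ringKrullDim R = d)
    (hCM : IsCMLocal R) (hAU : AnalyticallyUnramified R)
    (t : ℕ) (ht : CMTypeData R d t)
    (I J : Ideal R) (hIm : intCl I = maximalIdeal R)
    (hJ : IsMinimalReduction d J I)
    (L : ℕ → ℕ) (e : ℕ → ℤ) (hHilb : NormalHilbertData d I L e)
    (he3 : e 3 = 0) :
    mlen R (idealQuot (intCl (I ^ 2)) (J * intCl I)) ≤ ((t : ℕ) : WithBot ℕ∞) := by
  obtain ⟨hJI, ⟨x, hx⟩, N, hN⟩ := hJ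
  obtain ⟨rs, hrl, hrm, hrr⟩ := cm_list d hd hdim hCM
  obtain ⟨k, rfl⟩ : ∃ k, d = k + 3 := ⟨d - 3, by omega⟩
  have hJx : J = gen x := hx
  subst hJx
  have hJm : gen x ≤ maximalIdeal R := hIm ▸ (hJI.trans (le_intCl I))
  have hF1 : maximalIdeal R ≤ Fr (gen x) 1 := by
    have := intCl_le_Fr hJI N hN 1
    rw [pow_one, hIm] at this
    simpa using this
  obtain ⟨N1, hN1⟩ : ∃ N1, maximalIdeal R ^ N1 ≤ gen x := by
    refine Ideal.exists_pow_le_of_le_radical_of_fg ?_ (IsNoetherian.noetherian _)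
    intro y hy
    obtain ⟨c, hc, h⟩ := mem_pow_of_mem_Fr (hF1 hy)
    obtain ⟨s, hs⟩ := exists_nat_ge (1 + c)
    refine ⟨s, ?_⟩
    have := h s 1 (by push_cast; linarith)
    rwa [pow_one] at this
  have hxm : ∀ r ∈ List.ofFn x, r ∈ maximalIdeal R := by
    intro r hr
    obtain ⟨i, rfl⟩ := (List.mem_ofFn' _ _).mp hr
    exact hJm (x_mem x i)
  have hset : {r | r ∈ List.ofFn x} = Set.range x := by
    ext r; exact List.mem_ofFn' _ _
  have hreg : IsRegular R (List.ofFn x) := by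
    refine sop_regular (k+3) R rs hrl hrm hrr (List.ofFn x) (by simp) hxm N1 (hN1.trans (le_trans (le_of_eq ?_) le_sup_left))
    rw [Ideal.ofList, hset]
  have hq := qr_of_regular x hreg
  have hx0 : IsSMulRegular R (x 0) := by
    have := hreg
    rw [List.ofFn_succ, isRegular_cons_iff] at this
    exact this.1
  have hcl : ∀ n : ℕ, intCl (I ^ n) = Fr (gen x) n := fun n =>
    le_antisymm (intCl_le_Fr hJI N hN n) (Fr_le_intCl hJI n (x 0) (x_mem x 0) hx0)
  have hLB : LBd (gen x) := LB (d := k+2) hAU hreg hJm N1 hN1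
  have hH : Hil (k+3) x := by
    obtain ⟨hL, N0, hP⟩ := hHilb
    refine ⟨e, N0, he3, fun n hn => ⟨L n, ?_, hP n hn⟩⟩
    have := hL n
    rw [mlen, ← Module.coe_length, hcl] at this
    rw [lq]
    exact_mod_cast this
  have h3 := hyper k R x hreg hJm N1 hN1 hLB hH
  have hF1' : Fr (gen x) 1 = maximalIdeal R := by
    have := hcl 1
    rw [pow_one, hIm] at this
    simpa using this.symm
  have hty := ht (List.ofFn x) (by simp) hxm hreg
  rw [← hty, hset, hIm]
  have hc2 := hcl 2
  push_cast at hc2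
  refine quot_le _ _ _ _ ?_ Ideal.mul_le_left ?_
  · rw [hc2]
    intro y hy
    rw [Submodule.mem_colon]
    intro p hp
    rw [smul_eq_mul]
    refine h3 ?_
    have := Fr_mul hy (hF1 hp)
    norm_num at this
    exact this
  · rw [hc2]
    exact inter_le x hq hF1'.le
end LI2

theorem length_I2_mod_JI_le_type
    (R : Type*) [CommRing R] [IsLocalRing R] [IsNoetherianRing R]
    (d : ℕ) (hd : 3 ≤ d) (hdim : ringKrullDim R = d)
    (hCM : IsCMLocal R) (hAU : AnalyticallyUnramified R)
    (hres : Infinite (ResidueField R))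
    (t : ℕ) (ht : CMTypeData R d t)
    (I J : Ideal R) (hIm : intCl I = maximalIdeal R)
    (hJ : IsMinimalReduction d J I)
    (L : ℕ → ℕ) (e : ℕ → ℤ) (hHilb : NormalHilbertData d I L e)
    (he3 : e 3 = 0) :
    mlen R (idealQuot (intCl (I ^ 2)) (J * intCl I)) ≤ ((t : ℕ) : WithBot ℕ∞) := by
  exact LI2.final R d hd hdim hCM hAU t ht I J hIm hJ L e hHilb he3
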